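/- Suppose p ≡ −1 (mod 3). Then F[V]^{SL2(F_p)} is generated as an F-algebra by the invariants D, K, L, N·a0, δ = tr_B^G(N^{p−1}), ẽ = tr_B^G(N·e), d̃ = tr_B^G(N^{(p+1)/3}·d), together with the transfers tr^G(N^j a2^{(m−1)(p−1)−3j} a3^{p−1}) for j = 1, …, p−2; tr^G(N^j a3^{p−1−j}) for j = 1, …, (p−2)/3; tr^G(N^j a3^{p−2} a2^{(m−1)(p−1)+3−3j}) for j = 2, …, p−2 with j ∉ {(p+1)/3, (2p−1)/3}; and tr^G(N^j a3^{(5p−7−3j)/3} a2²) for j = (2p−1)/3, …, p−2, where in each case m = 2 + ⌊3j/(p−1)⌋. -/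

import Mathlib

open MvPolynomial

noncomputable section

/-- The right action of the 2×2 matrix `g` over `F_p` on `F[V] = F[a₃,a₂,a₁,a₀]`
(with `aᵢ = X i`), given by the dual of the third symmetric power representation. -/
def act (p : ℕ) [Fact p.Prime] (F : Type) [Field F] [CharP F p]
    (g : Matrix (Fin 2) (Fin 2) (ZMod p)) :
    MvPolynomial (Fin 4) F →ₐ[F] MvPolynomial (Fin 4) F :=
  letI c : ZMod p → MvPolynomial (Fin 4) F := fun x => C (ZMod.castHom (dvd_refl p) F x)
  letI al := c (g 0 0)
  letI be := c (g 0 1)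
  letI ga := c (g 1 0)
  letI de := c (g 1 1)
  aeval ![
    de ^ 3 * X 0 + 3 * de ^ 2 * ga * X 1 + 3 * de * ga ^ 2 * X 2 + ga ^ 3 * X 3,
    de ^ 2 * be * X 0 + (de ^ 2 * al + 2 * de * be * ga) * X 1
      + (2 * de * ga * al + be * ga ^ 2) * X 2 + ga ^ 2 * al * X 3,
    de * be ^ 2 * X 0 + (2 * de * be * al + be ^ 2 * ga) * X 1
      + (de * al ^ 2 + 2 * be * ga * al) * X 2 + ga * al ^ 2 * X 3,
    be ^ 3 * X 0 + 3 * be ^ 2 * al * X 1 + 3 * be * al ^ 2 * X 2 + al ^ 3 * X 3]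

/-- The transfer with respect to the Sylow `p`-subgroup `P = ⟨σ⟩`,
`tr^P(f) = ∑_{τ ∈ P} (f)τ`, where the elements of `P` are the matrices `[[1,s],[0,1]]`. -/
def trP (p : ℕ) [Fact p.Prime] (F : Type) [Field F] [CharP F p]
    (f : MvPolynomial (Fin 4) F) : MvPolynomial (Fin 4) F :=
  ∑ s : ZMod p, act p F !![1, s; 0, 1] f

/-- The relative transfer `tr_B^G(f) = ∑_{τ ∈ Q ∪ {η}} (f)τ`, using the coset
representatives `Q ∪ {η}` of the Borel subgroup `B` in `G = SL₂(F_p)`. -/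
def trBG (p : ℕ) [Fact p.Prime] (F : Type) [Field F] [CharP F p]
    (f : MvPolynomial (Fin 4) F) : MvPolynomial (Fin 4) F :=
  (∑ s : ZMod p, act p F !![1, 0; s, 1] f) + act p F !![0, 1; -1, 0] f

/-- The full transfer `tr^G(f) = ∑_{τ ∈ SL₂(F_p)} (f)τ`. -/
def trG (p : ℕ) [Fact p.Prime] (F : Type) [Field F] [CharP F p]
    (f : MvPolynomial (Fin 4) F) : MvPolynomial (Fin 4) F :=
  ∑ g : Matrix.SpecialLinearGroup (Fin 2) (ZMod p), act p F g.1 f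

/-- `N = ∏_{τ ∈ P} (a₃)τ = ∏_{s ∈ F_p} (a₃ + 3s a₂ + 3s² a₁ + s³ a₀)`. -/
def Npoly (p : ℕ) [Fact p.Prime] (F : Type) [Field F] [CharP F p] :
    MvPolynomial (Fin 4) F :=
  ∏ s : ZMod p, act p F !![1, s; 0, 1] (X 3)

/-- The weight of the monomial `a₃^e₃ a₂^e₂ a₁^e₁ a₀^e₀`, i.e. `3e₃ + e₂ - e₁ - 3e₀`. -/
def wt (d : Fin 4 →₀ ℕ) : ℤ :=
  3 * (d 3 : ℤ) + (d 2 : ℤ) - (d 1 : ℤ) - 3 * (d 0 : ℤ)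

/-- `f` is isobaric of weight `lam` modulo `p - 1`: every monomial occurring in `f`
has weight congruent to `lam` modulo `p - 1`. -/
def Isobaric (p : ℕ) {F : Type} [Field F] (f : MvPolynomial (Fin 4) F) (lam : ℤ) : Prop :=
  ∀ d ∈ f.support, ((p : ℤ) - 1) ∣ (wt d - lam)

/-- Strict grevlex comparison on exponent vectors, for the graded reverse
lexicographic order with `a₀ < a₁ < a₂ < a₃`. -/
def grevlexLt (d e : Fin 4 →₀ ℕ) : Prop :=
  (∑ i : Fin 4, d i) < (∑ i : Fin 4, e i) ∨
    ((∑ i : Fin 4, d i) = (∑ i : Fin 4, e i) ∧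
      ∃ k : Fin 4, e k < d k ∧ ∀ j : Fin 4, j < k → d j = e j)

/-- `d` is the lead monomial of `f` in the grevlex order with `a₀ < a₁ < a₂ < a₃`. -/
def LeadMonomialIs {F : Type} [Field F] (f : MvPolynomial (Fin 4) F) (d : Fin 4 →₀ ℕ) : Prop :=
  coeff d f ≠ 0 ∧ ∀ e ∈ f.support, e ≠ d → grevlexLt e d

/-- The lead term of `f` is `c · x^d` in the grevlex order with `a₀ < a₁ < a₂ < a₃`. -/
def LeadTermIs {F : Type} [Field F] (f : MvPolynomial (Fin 4) F) (c : F) (d : Fin 4 →₀ ℕ) :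
    Prop :=
  LeadMonomialIs f d ∧ coeff d f = c

/-- The discriminant `D` of the binary cubic. -/
def Dpoly (F : Type) [Field F] : MvPolynomial (Fin 4) F :=
  3 * X 2 ^ 2 * X 1 ^ 2 - 4 * X 3 * X 1 ^ 3 - 4 * X 2 ^ 3 * X 0
    + 6 * X 3 * X 2 * X 1 * X 0 - X 3 ^ 2 * X 0 ^ 2

/-- `K = -tr^G(a₁^{p-1})`. -/
def Kpoly (p : ℕ) [Fact p.Prime] (F : Type) [Field F] [CharP F p] :
    MvPolynomial (Fin 4) F :=
  - trG p F (X 1 ^ (p - 1))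

/-- Dickson's invariant `L = 3(a₂^p a₁ - a₂ a₁^p) - (a₃^p a₀ - a₃ a₀^p)`. -/
def Lpoly (p : ℕ) (F : Type) [Field F] : MvPolynomial (Fin 4) F :=
  3 * (X 2 ^ p * X 1 - X 2 * X 1 ^ p) - (X 3 ^ p * X 0 - X 3 * X 0 ^ p)

/-- `e = 2a₁³ + a₀(a₃a₀ - 3a₂a₁)`. -/
def epoly (F : Type) [Field F] : MvPolynomial (Fin 4) F :=
  2 * X 1 ^ 3 + X 0 * (X 3 * X 0 - 3 * X 2 * X 1)

/-- `d = a₁² - a₂a₀`. -/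
def dpoly (F : Type) [Field F] : MvPolynomial (Fin 4) F :=
  X 1 ^ 2 - X 2 * X 0

/-- `ξ = 3a₂² - 4a₃a₁`. -/
def xipoly (F : Type) [Field F] : MvPolynomial (Fin 4) F :=
  3 * X 2 ^ 2 - 4 * X 3 * X 1

/-- The ring of `SL₂(F_p)`-invariants `F[V]^{SL₂(F_p)}`, as a subalgebra of `F[V]`. -/
def invariants (p : ℕ) [Fact p.Prime] (F : Type) [Field F] [CharP F p] :
    Subalgebra F (MvPolynomial (Fin 4) F) where
  carrier := {f | ∀ g : Matrix.SpecialLinearGroup (Fin 2) (ZMod p), act p F g.1 f = f}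
  mul_mem' := fun hf hg g => by rw [map_mul, hf g, hg g]
  one_mem' := fun g => map_one _
  add_mem' := fun hf hg g => by rw [map_add, hf g, hg g]
  zero_mem' := fun g => map_zero _
  algebraMap_mem' := fun c g => (act _ _ _).commutes c

set_option linter.all false

/-- Polynomial ring in four variables. -/
abbrev RR (F : Type) [Field F] := MvPolynomial (Fin 4) F

/-- Unipotent substitution; `ε = 1` is the group action, `ε = 0` the action modulo `a₀`. -/
def sig {F : Type} [Field F] (ε s : F) : RR F →ₐ[F] RR F :=
  aeval ![X 0, X 1 + C (ε * s) * X 0, X 2 + 2 * C s * X 1 + C (ε * s ^ 2) * X 0,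
    X 3 + 3 * C s * X 2 + 3 * C s ^ 2 * X 1 + C (ε * s ^ 3) * X 0]

/-- Set the variables in `S` to zero. -/
def kill {F : Type} [Field F] (S : Finset (Fin 4)) : RR F →ₐ[F] RR F :=
  aeval (fun i => if i ∈ S then 0 else X i)

/-- Torus substitution. -/
def tau {F : Type} [Field F] (w : F) : RR F →ₐ[F] RR F :=
  aeval (fun i => C (w ^ (i : ℕ)) * X i)

/-- grade of a monomial -/
def gr (d : Fin 4 →₀ ℕ) : ℕ := d 1 + 2 * d 2 + 3 * d 3

section basics
variable {F : Type} [Field F]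

lemma sig_X0 (ε s : F) : sig ε s (X 0) = X 0 := by simp [sig]
lemma sig_X1 (ε s : F) : sig ε s (X 1) = X 1 + C (ε * s) * X 0 := by simp [sig]
lemma sig_X2 (ε s : F) : sig ε s (X 2) = X 2 + 2 * C s * X 1 + C (ε * s ^ 2) * X 0 := by
  simp [sig]
lemma sig_X3 (ε s : F) : sig ε s (X 3) =
    X 3 + 3 * C s * X 2 + 3 * C s ^ 2 * X 1 + C (ε * s ^ 3) * X 0 := by simp [sig]
lemma tau_X (w : F) (i : Fin 4) : tau w (X i) = C (w ^ (i : ℕ)) * X i := by simp [tau]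
lemma sig_C (ε s c : F) : sig ε s (C c) = C c := by simp [sig]
lemma tau_C (w c : F) : tau w (C c) = C c := by simp [tau]
lemma kill_C (S : Finset (Fin 4)) (c : F) : kill S (C c) = C c := by simp [kill]

lemma kill_X (S : Finset (Fin 4)) (i : Fin 4) :
    kill (F := F) S (X i) = if i ∈ S then 0 else X i := by simp [kill]

lemma kill_monomial (S : Finset (Fin 4)) (d : Fin 4 →₀ ℕ) (c : F) :
    kill S (monomial d c) = if ∀ i ∈ S, d i = 0 then monomial d c else 0 := by
  rw [kill, aeval_monomial, monomial_eq]
  split_ifs with h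
  · rw [algebraMap_eq]
    congr 1
    apply Finsupp.prod_congr
    intro i hi
    have : i ∉ S := fun hS => (Finsupp.mem_support_iff.mp hi) (h i hS)
    simp [this]
  · push Not at h
    obtain ⟨i, hi, hd⟩ := h
    have : (d.prod fun i k => (if i ∈ S then (0 : RR F) else X i) ^ k) = 0 := by
      apply Finset.prod_eq_zero (Finsupp.mem_support_iff.mpr hd)
      simp [hi, hd]
    rw [this, mul_zero]

lemma coeff_kill (S : Finset (Fin 4)) (d : Fin 4 →₀ ℕ) (f : RR F) :
    coeff d (kill S f) = if ∀ i ∈ S, d i = 0 then coeff d f else 0 := by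
  classical
  induction f using MvPolynomial.induction_on' with
  | monomial e c =>
    rw [kill_monomial]
    split_ifs with h1 h2 h3
    · rfl
    · rw [coeff_monomial, if_neg]; rintro rfl; exact h2 h1
    · rw [coeff_monomial, if_neg]; simp
      rintro rfl; exact h1 h3
    · simp
  | add f g hf hg =>
    rw [map_add, coeff_add, coeff_add, hf, hg]
    split_ifs <;> simp

lemma X_dvd_sub_kill (i : Fin 4) (f : RR F) : X i ∣ f - kill {i} f := by
  induction f using MvPolynomial.induction_on with
  | C a => simp [kill]
  | add f g hf hg =>
    have : f + g - kill {i} (f + g) = (f - kill {i} f) + (g - kill {i} g) := by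
      rw [map_add]; ring
    rw [this]; exact dvd_add hf hg
  | mul_X f j hf =>
    by_cases hj : j = i
    · subst hj
      rw [map_mul, kill_X]; simp
    · rw [map_mul, kill_X]; simp only [Finset.mem_singleton, hj, if_false]
      rw [← sub_mul]; exact Dvd.dvd.mul_right hf _

lemma X_dvd_of_kill (i : Fin 4) (f : RR F) (h : kill {i} f = 0) : X i ∣ f := by
  have := X_dvd_sub_kill i f
  rwa [h, sub_zero] at this

lemma kill_kill (S T : Finset (Fin 4)) (f : RR F) : kill S (kill T f) = kill (S ∪ T) f := by
  ext d
  rw [coeff_kill, coeff_kill, coeff_kill]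
  by_cases h1 : ∀ i ∈ S, d i = 0 <;> by_cases h2 : ∀ i ∈ T, d i = 0
  · rw [if_pos h1, if_pos h2, if_pos]
    intro i hi; rcases Finset.mem_union.mp hi with h | h
    exacts [h1 i h, h2 i h]
  · rw [if_pos h1, if_neg h2, if_neg]
    exact fun h => h2 fun i hi => h i (Finset.mem_union_right _ hi)
  · rw [if_neg h1, if_neg]
    exact fun h => h1 fun i hi => h i (Finset.mem_union_left _ hi)
  · rw [if_neg h1, if_neg]
    exact fun h => h1 fun i hi => h i (Finset.mem_union_left _ hi)

lemma tau_monomial (w : F) (d : Fin 4 →₀ ℕ) (c : F) :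
    tau w (monomial d c) = monomial d (w ^ gr d * c) := by
  rw [tau, aeval_monomial, monomial_eq, algebraMap_eq, C_mul]
  rw [Finsupp.prod_fintype _ _ (by simp), Finsupp.prod_fintype _ _ (by simp)]
  simp only [Fin.prod_univ_four, gr, mul_pow, ← C_pow]
  simp only [Fin.isValue, Fin.val_zero, pow_zero, one_pow, map_one, Fin.val_one,
    Fin.val_two, pow_one]
  have : (((3 : Fin 4) : ℕ)) = 3 := rfl
  rw [this]
  simp only [map_pow, map_mul, pow_add, pow_mul]
  ring

lemma coeff_tau (w : F) (d : Fin 4 →₀ ℕ) (f : RR F) :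
    coeff d (tau w f) = w ^ gr d * coeff d f := by
  classical
  induction f using MvPolynomial.induction_on' with
  | monomial e c =>
    rw [tau_monomial, coeff_monomial, coeff_monomial]
    split_ifs with h
    · rw [h]
    · simp
  | add f g hf hg => rw [map_add, coeff_add, coeff_add, hf, hg, mul_add]

lemma sig_tau (ε s w : F) (f : RR F) : sig ε s (tau w f) = tau w (sig ε (w * s) f) := by
  have : (sig ε s).comp (tau w) = (tau w).comp (sig ε (w * s)) := by
    apply MvPolynomial.algHom_ext
    intro i
    fin_cases i <;> simp [sig_X0, sig_X1, sig_X2, sig_X3, tau_X, sig_C, tau_C, map_ofNat] <;> ring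
  exact DFunLike.congr_fun this f

lemma kill_sig (s : F) (f : RR F) : kill {0} (sig 1 s f) = sig 0 s (kill {0} f) := by
  have : (kill {0}).comp (sig 1 s) = (sig 0 s).comp (kill {0}) := by
    apply MvPolynomial.algHom_ext
    intro i
    fin_cases i <;> simp [sig_X0, sig_X1, sig_X2, sig_X3, sig_C, kill_X, kill_C, map_ofNat]
  exact DFunLike.congr_fun this f

lemma kill_sig0 (s : F) (f : RR F) : kill {0} (sig 0 s f) = sig 0 s (kill {0} f) := by
  have : (kill {0}).comp (sig 0 s) = (sig 0 s).comp (kill {0}) := by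
    apply MvPolynomial.algHom_ext
    intro i
    fin_cases i <;> simp [sig_X0, sig_X1, sig_X2, sig_X3, sig_C, kill_X, kill_C, map_ofNat]
  exact DFunLike.congr_fun this f

lemma kill_tau (S : Finset (Fin 4)) (w : F) (f : RR F) :
    kill S (tau w f) = tau w (kill S f) := by
  ext d
  rw [coeff_kill, coeff_tau, coeff_tau, coeff_kill]
  split_ifs <;> simp

lemma sig_sig (ε s t : F) (f : RR F) : sig ε s (sig ε t f) = sig ε (s + t) f := by
  have : (sig ε s).comp (sig ε t) = sig ε (s + t) := by
    apply MvPolynomial.algHom_ext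
    intro i
    fin_cases i <;> simp [sig_X0, sig_X1, sig_X2, sig_X3, sig_C, map_ofNat] <;> ring
  exact DFunLike.congr_fun this f

lemma sig_zero (ε : F) (f : RR F) : sig ε 0 f = f := by
  have : sig ε (0:F) = AlgHom.id F _ := by
    apply MvPolynomial.algHom_ext
    intro i
    fin_cases i <;> simp [sig]
  rw [this]; rfl

/-- product of pairwise non-dividing primes divides -/
lemma prod_dvd_of_primes {ι A : Type*} [CommRing A] [IsDomain A] (S : Finset ι) (π : ι → A)
    (hpr : ∀ s, Prime (π s)) (hne : ∀ s t, s ≠ t → ¬ π s ∣ π t) (f : A)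
    (hf : ∀ s, π s ∣ f) : ∏ s ∈ S, π s ∣ f := by
  classical
  induction S using Finset.induction_on with
  | empty => simp
  | insert s S hs ih =>
    obtain ⟨h, rfl⟩ := ih
    rw [Finset.prod_insert hs, mul_comm]
    apply mul_dvd_mul_left
    rcases (hpr s).dvd_or_dvd (hf s) with h1 | h1
    · obtain ⟨t, ht, h2⟩ := (hpr s).exists_mem_finset_dvd h1
      exact absurd h2 (hne s t (by rintro rfl; exact hs ht))
    · exact h1

lemma prime_algHom {f : RR F} (hf : Prime f) (a b : RR F →ₐ[F] RR F)
    (hab : ∀ x, a (b x) = x) (hba : ∀ x, b (a x) = x) : Prime (a f) := by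
  let e : RR F ≃ₐ[F] RR F := AlgEquiv.ofAlgHom a b (AlgHom.ext hab) (AlgHom.ext hba)
  have := (MulEquiv.prime_iff (e : RR F ≃* RR F) (p := f)).mpr hf
  exact this

lemma prime_sig (ε s : F) : Prime (sig ε s (X 3 : RR F)) := by
  apply prime_algHom (MvPolynomial.X_prime) _ (sig ε (-s))
  · intro x; rw [sig_sig, add_neg_cancel, sig_zero]
  · intro x; rw [sig_sig, neg_add_cancel, sig_zero]

end basics

/-- weight of a monomial -/
def wgt (w : Fin 4 → ℤ) (d : Fin 4 →₀ ℕ) : ℤ :=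
  w 0 * d 0 + w 1 * d 1 + w 2 * d 2 + w 3 * d 3

/-- all monomials of `f` have weight in `S` -/
def Sp {F : Type} [Field F] (w : Fin 4 → ℤ) (S : Set ℤ) (f : RR F) : Prop :=
  ∀ d, coeff d f ≠ 0 → wgt w d ∈ S

section spsec
variable {F : Type} [Field F] {w : Fin 4 → ℤ} {S T U : Set ℤ} {f g : RR F}

lemma wgt_add (d e : Fin 4 →₀ ℕ) : wgt w (d + e) = wgt w d + wgt w e := by
  simp [wgt]; ring

lemma wgt_zero : wgt w 0 = 0 := by simp [wgt]

lemma wgt_single (i : Fin 4) (n : ℕ) : wgt w (Finsupp.single i n) = w i * n := by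
  fin_cases i <;> simp [wgt, Finsupp.single_apply]

lemma Sp.mono (h : Sp w S f) (hST : S ⊆ T) : Sp w T f := fun d hd => hST (h d hd)

lemma Sp.add (hf : Sp w S f) (hg : Sp w S g) : Sp w S (f + g) := by
  intro d hd
  rw [coeff_add] at hd
  by_cases h : coeff d f = 0
  · rw [h, zero_add] at hd; exact hg d hd
  · exact hf d h

lemma Sp.neg (hf : Sp w S f) : Sp w S (-f) := by
  intro d hd
  rw [coeff_neg] at hd
  exact hf d (by simpa using hd)

lemma Sp.sub (hf : Sp w S f) (hg : Sp w S g) : Sp w S (f - g) := by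
  rw [sub_eq_add_neg]; exact hf.add hg.neg

lemma Sp.zero : Sp w S (0 : RR F) := by intro d hd; simp at hd

lemma Sp.sum {ι : Type*} (s : Finset ι) (h : ι → RR F) (hh : ∀ i ∈ s, Sp w S (h i)) :
    Sp w S (∑ i ∈ s, h i) := by
  classical
  induction s using Finset.induction_on with
  | empty => simpa using Sp.zero
  | insert a s ha ih =>
    rw [Finset.sum_insert ha]
    exact (hh a (by simp)).add (ih fun i hi => hh i (by simp [hi]))

lemma Sp.mul (hf : Sp w S f) (hg : Sp w T g) (hU : ∀ a ∈ S, ∀ b ∈ T, a + b ∈ U) :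
    Sp w U (f * g) := by
  classical
  intro d hd
  rw [coeff_mul] at hd
  obtain ⟨⟨x, y⟩, hxy, hne⟩ := Finset.exists_ne_zero_of_sum_ne_zero hd
  rw [Finset.HasAntidiagonal.mem_antidiagonal] at hxy
  rw [← hxy, wgt_add]
  exact hU _ (hf x (left_ne_zero_of_mul hne)) _ (hg y (right_ne_zero_of_mul hne))

lemma Sp.monomial (d : Fin 4 →₀ ℕ) (c : F) (h : wgt w d ∈ S) : Sp w S (monomial d c) := by
  classical
  intro e he
  rw [coeff_monomial] at he
  split_ifs at he with h1
  · rwa [← h1]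
  · exact absurd rfl he

lemma Sp.X (i : Fin 4) (h : w i ∈ S) : Sp w S (X i : RR F) := by
  apply Sp.monomial; rw [wgt_single]; simpa using h

lemma Sp.C (c : F) (h : (0 : ℤ) ∈ S) : Sp w S (C c : RR F) := by
  apply Sp.monomial; rw [wgt_zero]; exact h

lemma Sp.C_mul (c : F) (h : Sp w S f) : Sp w S (MvPolynomial.C c * f) := by
  intro d hd
  rw [coeff_C_mul] at hd
  exact h d (right_ne_zero_of_mul hd)

lemma Sp.map (θ : RR F →ₗ[F] RR F)
    (hθ : ∀ d (c : F), wgt w d ∈ S → Sp w T (θ (MvPolynomial.monomial d c))) (hf : Sp w S f) :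
    Sp w T (θ f) := by
  rw [f.as_sum, map_sum]
  apply Sp.sum
  intro d hd
  exact hθ d _ (hf d (mem_support_iff.mp hd))

abbrev Le (w : Fin 4 → ℤ) (f : RR F) (M : ℤ) : Prop := Sp w (Set.Iic M) f
abbrev Ex (w : Fin 4 → ℤ) (f : RR F) (M : ℤ) : Prop := Sp w {M} f

lemma Le.mul {M N : ℤ} (hf : Le w f M) (hg : Le w g N) : Le w (f * g) (M + N) :=
  Sp.mul hf hg fun a ha b hb => by simp only [Set.mem_Iic] at *; omega

lemma Ex.mul {M N : ℤ} (hf : Ex w f M) (hg : Ex w g N) : Ex w (f * g) (M + N) :=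
  Sp.mul hf hg fun a ha b hb => by simp only [Set.mem_singleton_iff] at *; omega

lemma Le.mono {M N : ℤ} (hf : Le w f M) (h : M ≤ N) : Le w f N :=
  Sp.mono hf (Set.Iic_subset_Iic.mpr h)

lemma Le.pow {M : ℤ} (hf : Le w f M) (n : ℕ) : Le w (f ^ n) (n * M) := by
  induction n with
  | zero => simp only [pow_zero]; exact Sp.C 1 (by simp)
  | succ n ih => rw [pow_succ]; have := ih.mul hf; convert this using 1; push_cast; ring

lemma Ex.pow {M : ℤ} (hf : Ex w f M) (n : ℕ) : Ex w (f ^ n) (n * M) := by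
  induction n with
  | zero => simp only [pow_zero]; exact Sp.C 1 (by simp)
  | succ n ih => rw [pow_succ]; have := ih.mul hf; convert this using 1; push_cast; ring

lemma Le.prod {ι : Type*} (s : Finset ι) (h : ι → RR F) {M : ℤ} (hh : ∀ i ∈ s, Le w (h i) M) :
    Le w (∏ i ∈ s, h i) (s.card * M) := by
  classical
  induction s using Finset.induction_on with
  | empty => simpa using (Sp.C (F := F) (w := w) (S := Set.Iic 0) 1 (by simp))
  | insert a s ha ih =>
    rw [Finset.prod_insert ha, Finset.card_insert_of_notMem ha]
    have := (hh a (by simp)).mul (ih fun i hi => hh i (by simp [hi]))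
    convert this using 1; push_cast; ring

lemma Ex.prod {ι : Type*} (s : Finset ι) (h : ι → RR F) {M : ℤ} (hh : ∀ i ∈ s, Ex w (h i) M) :
    Ex w (∏ i ∈ s, h i) (s.card * M) := by
  classical
  induction s using Finset.induction_on with
  | empty => simpa using (Sp.C (F := F) (w := w) (S := {0}) 1 (by simp))
  | insert a s ha ih =>
    rw [Finset.prod_insert ha, Finset.card_insert_of_notMem ha]
    have := (hh a (by simp)).mul (ih fun i hi => hh i (by simp [hi]))
    convert this using 1; push_cast; ring

lemma hom_monomial_Le (θ : RR F →ₐ[F] RR F) (hθ : ∀ i, Le w (θ (MvPolynomial.X i)) (w i))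
    (d : Fin 4 →₀ ℕ) (c : F) : Le w (θ (MvPolynomial.monomial d c)) (wgt w d) := by
  have h1 : MvPolynomial.monomial d c = MvPolynomial.C c * (MvPolynomial.X 0 ^ d 0 *
      MvPolynomial.X 1 ^ d 1 * MvPolynomial.X 2 ^ d 2 * MvPolynomial.X 3 ^ d 3) := by
    rw [monomial_eq, Finsupp.prod_fintype _ _ (by simp), Fin.prod_univ_four]
  rw [h1]
  simp only [map_mul, map_pow]
  have hC : θ (MvPolynomial.C c) = MvPolynomial.C c := θ.commutes c
  rw [hC]
  apply Sp.C_mul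
  have := ((((hθ 0).pow (d 0)).mul ((hθ 1).pow (d 1))).mul ((hθ 2).pow (d 2))).mul
    ((hθ 3).pow (d 3))
  convert this using 1
  rw [wgt]; ring

lemma hom_monomial_Ex (θ : RR F →ₐ[F] RR F) (hθ : ∀ i, Ex w (θ (MvPolynomial.X i)) (w i))
    (d : Fin 4 →₀ ℕ) (c : F) : Ex w (θ (MvPolynomial.monomial d c)) (wgt w d) := by
  have h1 : MvPolynomial.monomial d c = MvPolynomial.C c * (MvPolynomial.X 0 ^ d 0 *
      MvPolynomial.X 1 ^ d 1 * MvPolynomial.X 2 ^ d 2 * MvPolynomial.X 3 ^ d 3) := by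
    rw [monomial_eq, Finsupp.prod_fintype _ _ (by simp), Fin.prod_univ_four]
  rw [h1]
  simp only [map_mul, map_pow]
  have hC : θ (MvPolynomial.C c) = MvPolynomial.C c := θ.commutes c
  rw [hC]
  apply Sp.C_mul
  have := ((((hθ 0).pow (d 0)).mul ((hθ 1).pow (d 1))).mul ((hθ 2).pow (d 2))).mul
    ((hθ 3).pow (d 3))
  convert this using 1
  rw [wgt]; ring

lemma Le.hom (θ : RR F →ₐ[F] RR F) (hθ : ∀ i, Le w (θ (MvPolynomial.X i)) (w i)) {M : ℤ}
    (hf : Le w f M) : Le w (θ f) M :=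
  Sp.map θ.toLinearMap (fun d c hd => (hom_monomial_Le θ hθ d c).mono hd) hf

lemma Ex.hom (θ : RR F →ₐ[F] RR F) (hθ : ∀ i, Ex w (θ (MvPolynomial.X i)) (w i)) {M : ℤ}
    (hf : Ex w f M) : Ex w (θ f) M :=
  Sp.map θ.toLinearMap (fun d c hd => by
    have := hom_monomial_Ex θ hθ d c
    rw [Set.mem_singleton_iff] at hd; rwa [hd] at this) hf

lemma eq_zero_of_Le_neg (hw : ∀ i, 0 ≤ w i) {M : ℤ} (hM : M < 0) (hf : Le w f M) : f = 0 := by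
  ext d
  by_contra h
  have h1 := hf d (by simpa using h)
  have : 0 ≤ wgt w d := by
    unfold wgt
    have := hw 0; have := hw 1; have := hw 2; have := hw 3; positivity
  simp only [Set.mem_Iic] at h1; omega

lemma eq_zero_of_Le_Ex {M N : ℤ} (hMN : M < N) (h1 : Le w f M) (h2 : Ex w f N) : f = 0 := by
  ext d
  by_contra h
  have h1 := h1 d (by simpa using h)
  have h2 := h2 d (by simpa using h)
  simp only [Set.mem_Iic, Set.mem_singleton_iff] at h1 h2; omega

lemma Sp.kill (hf : Sp w S f) (A : Finset (Fin 4)) : Sp w S (kill A f) := by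
  intro d hd
  rw [coeff_kill] at hd
  split_ifs at hd with h
  · exact hf d hd
  · exact absurd rfl hd

/-- weights -/
def w3 : Fin 4 → ℤ := ![0, 0, 0, 1]
def w1 : Fin 4 → ℤ := ![1, 1, 1, 1]
def wg : Fin 4 → ℤ := ![0, 1, 2, 3]

lemma wgt_w3 (d : Fin 4 →₀ ℕ) : wgt w3 d = d 3 := by simp [wgt, w3]
lemma wgt_wg (d : Fin 4 →₀ ℕ) : wgt wg d = gr d := by simp [wgt, wg, gr]
lemma wgt_w1 (d : Fin 4 →₀ ℕ) : wgt w1 d = d 0 + d 1 + d 2 + d 3 := by simp [wgt, w1]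

lemma ex_w1_X (i : Fin 4) : Ex w1 (X i : RR F) 1 := Sp.X i (by fin_cases i <;> simp [w1])

lemma ex_w1_sig (ε s : F) {n : ℤ} (hf : Ex w1 f n) : Ex w1 (sig ε s f) n := by
  apply Ex.hom _ _ hf
  have h0 := ex_w1_X (F := F)
  have h2 : ∀ (c : RR F) k, Ex w1 c 0 → Ex w1 (c * X k) 1 := fun c k hc => by
    simpa using hc.mul (h0 k)
  have hC : ∀ c : F, Ex w1 (C c) 0 := fun c => Sp.C c (by simp)
  have e2 : (2 : RR F) = C 2 := (map_ofNat C 2).symm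
  have e3 : (3 : RR F) = C 3 := (map_ofNat C 3).symm
  intro i
  fin_cases i
  · simpa [sig_X0, w1] using h0 0
  · simp only [Fin.mk_one, sig_X1]
    exact (h0 1).add (h2 _ _ (hC _))
  · simp only [Fin.reduceFinMk, sig_X2, e2, ← C_mul, ← C_pow]
    exact ((h0 2).add (h2 _ _ (hC _))).add (h2 _ _ (hC _))
  · simp only [Fin.reduceFinMk, sig_X3, e3, ← C_mul, ← C_pow]
    exact (((h0 3).add (h2 _ _ (hC _))).add (h2 _ _ (hC _))).add (h2 _ _ (hC _))

lemma le_w3_X (i : Fin 4) (h : i ≠ 3) : Le w3 (X i : RR F) 0 :=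
  Sp.X i (by fin_cases i <;> simp [w3] at *)

lemma le_w3_sigX3 (ε s : F) : Le w3 (sig ε s (X 3) - X 3) 0 := by
  have h2 : ∀ (c : RR F) k, k ≠ 3 → Le w3 c 0 → Le w3 (c * X k) 0 := fun c k hk hc => by
    simpa using hc.mul (le_w3_X k hk)
  have hC : ∀ c : F, Le w3 (C c) 0 := fun c => Sp.C c (by simp)
  have e3 : (3 : RR F) = C 3 := (map_ofNat C 3).symm
  have : sig ε s (X 3) - X 3 =
    3 * C s * X 2 + 3 * C s ^ 2 * X 1 + C (ε * s ^ 3) * X 0 := by rw [sig_X3]; ring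
  rw [this, e3]
  simp only [← C_mul, ← C_pow]
  exact (((h2 _ _ (by decide) (hC _))).add (h2 _ _ (by decide)  (hC _))).add
    (h2 _ _ (by decide)  (hC _))

lemma le_w3_sig (ε s : F) {n : ℤ} (hf : Le w3 f n) : Le w3 (sig ε s f) n := by
  apply Le.hom _ _ hf
  have h2 : ∀ (c : RR F) k, k ≠ 3 → Le w3 c 0 → Le w3 (c * X k) 0 := fun c k hk hc => by
    simpa using hc.mul (le_w3_X k hk)
  have hC : ∀ c : F, Le w3 (C c) 0 := fun c => Sp.C c (by simp)
  have e2 : (2 : RR F) = C 2 := (map_ofNat C 2).symm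
  intro i
  fin_cases i
  · simpa [sig_X0, w3] using le_w3_X (F := F) 0 (by decide)
  · simp only [Fin.mk_one, sig_X1]
    exact (le_w3_X 1 (by decide)).add (h2 _ _ (by decide) (hC _))
  · simp only [Fin.reduceFinMk, sig_X2, e2, ← C_mul, ← C_pow]
    exact ((le_w3_X 2 (by decide)).add (h2 _ _ (by decide) (hC _))).add
      (h2 _ _ (by decide) (hC _))
  · simp only [Fin.reduceFinMk]
    have := (le_w3_sigX3 ε s).mono (N := 1) (by norm_num)
    have h3 : Le w3 (X 3 : RR F) 1 := Sp.X 3 (by simp [w3])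
    simpa [w3] using this.add h3

end spsec

/-- the embedding of the prime field -/
def io (p : ℕ) [Fact p.Prime] (F : Type) [Field F] [CharP F p] : ZMod p →+* F :=
  ZMod.castHom (dvd_refl p) F

/-- invariance under the unipotent group -/
def PInv (p : ℕ) [Fact p.Prime] {F : Type} [Field F] [CharP F p] (ε : F) (f : RR F) : Prop :=
  ∀ s : ZMod p, sig ε (io p F s) f = f

/-- norm of `a₃` -/
def Nn (p : ℕ) [Fact p.Prime] {F : Type} [Field F] [CharP F p] (ε : F) : RR F :=
  ∏ s : ZMod p, sig ε (io p F s) (X 3)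

/-- projection on the part of class `g` -/
def proj (p : ℕ) [Fact p.Prime] {F : Type} [Field F] [CharP F p] (g : ℕ) : RR F →ₗ[F] RR F :=
  - ∑ w : (ZMod p)ˣ, (io p F w) ^ ((p - 2) * g) • (tau (io p F w)).toLinearMap

section psec
variable {p : ℕ} [Fact p.Prime] {F : Type} [Field F] [CharP F p]

lemma io_inj : Function.Injective (io p F) := RingHom.injective _

lemma PInv.add {ε : F} {f g : RR F} (hf : PInv p ε f) (hg : PInv p ε g) : PInv p ε (f + g) :=
  fun s => by rw [map_add, hf s, hg s]
lemma PInv.sub {ε : F} {f g : RR F} (hf : PInv p ε f) (hg : PInv p ε g) : PInv p ε (f - g) :=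
  fun s => by rw [map_sub, hf s, hg s]
lemma PInv.mul {ε : F} {f g : RR F} (hf : PInv p ε f) (hg : PInv p ε g) : PInv p ε (f * g) :=
  fun s => by rw [map_mul, hf s, hg s]
lemma PInv.pow {ε : F} {f : RR F} (hf : PInv p ε f) (n : ℕ) : PInv p ε (f ^ n) :=
  fun s => by rw [map_pow, hf s]
lemma PInv.C {ε : F} (c : F) : PInv p ε (MvPolynomial.C c) := fun s => sig_C _ _ _
lemma PInv.C_mul {ε : F} {f : RR F} (c : F) (hf : PInv p ε f) :
    PInv p ε (MvPolynomial.C c * f) := (PInv.C c).mul hf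
lemma PInv.kill {f : RR F} (hf : PInv p 1 f) : PInv p 0 (kill {0} f) := fun s => by
  rw [← kill_sig, hf s]

lemma PInv_Nn (ε : F) : PInv p ε (Nn p ε) := by
  intro s
  rw [Nn, map_prod]
  simp only [sig_sig, ← map_add]
  exact Equiv.prod_comp (Equiv.addLeft s) (fun t => sig ε (io p F t) (X 3))

lemma kill_Nn : kill {0} (Nn p (1 : F)) = Nn p 0 := by
  rw [Nn, map_prod, Nn]
  simp [kill_sig, kill_X]

lemma kill_Nn0 : kill {0} (Nn p (0 : F)) = Nn p 0 := by
  rw [Nn, map_prod]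
  simp [kill_sig0, kill_X]

lemma le_prodlin (ε : F) (S : Finset (ZMod p)) :
    Le w3 (∏ s ∈ S, sig ε (io p F s) (X 3) - X 3 ^ S.card) (S.card - 1) := by
  classical
  have h3 : Le w3 (X 3 : RR F) 1 := Sp.X 3 (by simp [w3])
  induction S using Finset.induction_on with
  | empty => simp; exact Sp.zero
  | insert a s ha ih =>
    rw [Finset.prod_insert ha, Finset.card_insert_of_notMem ha]
    have : sig ε (io p F a) (X 3) * ∏ x ∈ s, sig ε (io p F x) (X 3) - X 3 ^ (s.card + 1)
      = sig ε (io p F a) (X 3) * (∏ x ∈ s, sig ε (io p F x) (X 3) - X 3 ^ s.card)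
        + (sig ε (io p F a) (X 3) - X 3) * X 3 ^ s.card := by ring
    rw [this]
    apply Sp.add
    · exact ((le_w3_sig ε _ h3).mul ih).mono (by push_cast; omega)
    · exact ((le_w3_sigX3 ε _).mul (h3.pow _)).mono (by push_cast; omega)

lemma le_Nn (ε : F) : Le w3 (Nn p ε - X 3 ^ p) (p - 1) := by
  have := le_prodlin (p := p) ε Finset.univ
  rw [Finset.card_univ, ZMod.card] at this
  exact this

lemma Nn_div (ε : F) (f : RR F) : ∃ x Y : RR F, f = x + Nn p ε * Y ∧ Le w3 x (p - 1) := by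
  have hadd : ∀ f g : RR F, (∃ x Y : RR F, f = x + Nn p ε * Y ∧ Le w3 x (p - 1)) →
      (∃ x Y : RR F, g = x + Nn p ε * Y ∧ Le w3 x (p - 1)) →
      (∃ x Y : RR F, f + g = x + Nn p ε * Y ∧ Le w3 x (p - 1)) := by
    rintro f g ⟨x, Y, h, hx⟩ ⟨x', Y', h', hx'⟩
    exact ⟨x + x', Y + Y', by rw [h, h']; ring, hx.add hx'⟩
  have h3 : Le w3 (X 3 : RR F) 1 := Sp.X 3 (by simp [w3])
  have hp1 := (Fact.out : p.Prime).one_lt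
  have key : ∀ k : ℕ, ∀ f : RR F, Le w3 f k →
      (∃ x Y : RR F, f = x + Nn p ε * Y ∧ Le w3 x (p - 1)) := by
    intro k
    induction k using Nat.strong_induction_on with
    | _ k ih =>
      intro f hf
      by_cases hk : (k : ℤ) ≤ p - 1
      · exact ⟨f, 0, by simp, hf.mono hk⟩
      · push Not at hk
        rw [f.as_sum]
        have hmono : ∀ d ∈ f.support, ∃ x Y : RR F, monomial d (coeff d f) = x + Nn p ε * Y ∧
            Le w3 x (p - 1) := by
          intro d hd
          have hdk := hf d (mem_support_iff.mp hd)
          simp only [wgt_w3, Set.mem_Iic, Nat.cast_le] at hdk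
          by_cases hdp : (d 3 : ℤ) ≤ p - 1
          · exact ⟨monomial d (coeff d f), 0, by simp,
              Sp.monomial _ _ (by rw [wgt_w3]; exact hdp)⟩
          · push Not at hdp
            have e1 : monomial d (coeff d f) = X 3 ^ p *
                monomial (d - Finsupp.single 3 p) (coeff d f) := by
              rw [X_pow_eq_monomial, monomial_mul, one_mul]
              have hde : d = Finsupp.single 3 p + (d - Finsupp.single 3 p) := by
               ext i
               simp only [Finsupp.coe_add, Finsupp.coe_tsub, Pi.add_apply, Pi.sub_apply,
                Finsupp.single_apply]
               split_ifs with h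
               · subst h; omega
               · omega
              rw [← hde]
            have hm : Le w3 (monomial (d - Finsupp.single 3 p) (coeff d f)) (d 3 - p) :=
              Sp.monomial _ _ (by
                rw [wgt_w3]; simp only [Finsupp.coe_tsub, Pi.sub_apply, Finsupp.single_eq_same, Set.mem_Iic]; omega)
            have e2 : monomial d (coeff d f) =
              - ((Nn p ε - X 3 ^ p) * monomial (d - Finsupp.single 3 p) (coeff d f)) +
                Nn p ε * monomial (d - Finsupp.single 3 p) (coeff d f) := by
              conv_lhs => rw [e1]
              ring
            rw [e2]
            apply hadd
            · apply ih (k - 1) (by omega)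
              apply Sp.neg
              exact Le.mono ((le_Nn ε).mul hm) (by push_cast [Nat.cast_sub (show 1 ≤ k by omega)]; omega)
            · exact ⟨0, _, by rw [zero_add], Sp.zero⟩
        have : ∀ s : Finset (Fin 4 →₀ ℕ), s ⊆ f.support → ∃ x Y : RR F,
            ∑ d ∈ s, monomial d (coeff d f) = x + Nn p ε * Y ∧ Le w3 x (p - 1) := by
          classical
          intro s
          induction s using Finset.induction_on with
          | empty => intro _; exact ⟨0, 0, by simp, Sp.zero⟩
          | insert a s ha ih' =>
            intro hs
            rw [Finset.sum_insert ha]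
            exact hadd _ _ (hmono a (hs (by simp)))
              (ih' fun x hx => hs (by simp [hx]))
        exact this _ subset_rfl
  apply key (degreeOf 3 f)
  intro d hd
  rw [wgt_w3]
  simp only [Set.mem_Iic, Nat.cast_le]
  exact degreeOf_le_iff.mp le_rfl d (mem_support_iff.mpr hd)

lemma Nn_mul_le (ε : F) (Y : RR F) (k : ℤ) (h : Le w3 (Nn p ε * Y) (p + k)) : Le w3 Y k := by
  by_cases hY : Y = 0
  · subst hY; exact Sp.zero
  have hp1 := (Fact.out : p.Prime).one_lt
  have hc : coeff (Finsupp.single 3 p) (Nn p ε) = 1 := by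
    by_contra hne
    have := le_Nn (p := p) ε (Finsupp.single 3 p) (by
      rw [coeff_sub, X_pow_eq_monomial, coeff_monomial, if_pos rfl, sub_ne_zero]; exact hne)
    rw [wgt_w3] at this
    simp at this
  have hN0 : Nn p ε ≠ 0 := by rintro h; rw [h] at hc; simp at hc
  have h1 : p ≤ degreeOf 3 (Nn p ε) := by
    have := monomial_le_degreeOf (f := Nn p ε) (i := 3) (h_m :=       by rw [mem_support_iff, hc]; exact one_ne_zero)
    simpa using this
  have h2 : (degreeOf 3 (Nn p ε * Y) : ℤ) ≤ p + k := by
    by_cases hpk : p + k < 0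
    · exfalso
      have := eq_zero_of_Le_neg (by intro i; fin_cases i <;> simp [w3]) hpk h
      exact mul_ne_zero hN0 hY this
    · obtain ⟨m, hm⟩ := Int.eq_ofNat_of_zero_le (not_lt.mp hpk)
      rw [hm]
      have : degreeOf 3 (Nn p ε * Y) ≤ m := by
        rw [degreeOf_le_iff]
        intro d hd
        have := h d (mem_support_iff.mp hd)
        rw [wgt_w3, hm] at this
        simpa using this
      exact_mod_cast this
  rw [degreeOf_mul_eq hN0 hY] at h2
  intro d hd
  rw [wgt_w3, Set.mem_Iic]
  have := monomial_le_degreeOf (f := Y) (i := 3) (mem_support_iff.mpr hd)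
  push_cast at h2
  omega

lemma Nn_mul_eq_zero (ε : F) (Y : RR F) (h : Le w3 (Nn p ε * Y) (p - 1)) : Y = 0 := by
  have := Nn_mul_le ε Y (-1) (by rw [← sub_eq_add_neg]; exact h)
  exact eq_zero_of_Le_neg (by intro i; fin_cases i <;> simp [w3]) (by norm_num) this

lemma Nn_ne_zero (ε : F) : Nn p ε ≠ 0 := by
  intro h
  have := Nn_mul_eq_zero (p := p) ε 1 (by rw [h, zero_mul]; exact Sp.zero)
  exact one_ne_zero this

lemma Nn_uniq (ε : F) {x x' Y Y' : RR F} (h : x + Nn p ε * Y = x' + Nn p ε * Y')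
    (hx : Le w3 x (p - 1)) (hx' : Le w3 x' (p - 1)) : x = x' ∧ Y = Y' := by
  have h1 : Nn p ε * (Y - Y') = x' - x := by linear_combination h
  have h2 : Y - Y' = 0 := Nn_mul_eq_zero (p := p) ε _ (by rw [h1]; exact hx'.sub hx)
  rw [h2, mul_zero] at h1
  exact ⟨(sub_eq_zero.mp h1.symm).symm, sub_eq_zero.mp h2⟩

lemma Nn_div_inv (ε : F) {f : RR F} (hf : PInv p ε f) : ∃ x Y : RR F, f = x + Nn p ε * Y ∧
    Le w3 x (p - 1) ∧ PInv p ε x ∧ PInv p ε Y := by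
  obtain ⟨x, Y, h, hx⟩ := Nn_div (p := p) ε f
  have : ∀ s : ZMod p, sig ε (io p F s) x = x ∧ sig ε (io p F s) Y = Y := by
    intro s
    apply Nn_uniq (p := p) ε _ (le_w3_sig ε _ hx) hx
    have := hf s
    rw [h, map_add, map_mul, PInv_Nn ε s] at this
    exact this
  exact ⟨x, Y, h, hx, fun s => (this s).1, fun s => (this s).2⟩

lemma Nn_dvd {ε : F} (h3 : (3 : F) ≠ 0) {f : RR F} (hf : PInv p ε f) (hk : kill {3} f = 0) :
    Nn p ε ∣ f := by
  apply prod_dvd_of_primes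
  · intro s; exact prime_sig _ _
  · rintro s t hst hdvd
    have := (map_dvd (aeval ![(0 : F), 0, 1, -3 * io p F s]) hdvd)
    simp only [sig_X3, map_add, map_mul, aeval_X, map_ofNat, map_pow, algHom_C] at this
    simp at this
    have h4 : io p F t - io p F s = 0 := by
      have h5 : 3 * (io p F t - io p F s) = 0 := by linear_combination this
      exact (mul_eq_zero.mp h5).resolve_left h3
    exact hst (io_inj (sub_eq_zero.mp h4)).symm
  · intro s
    have := map_dvd (sig ε (io p F s)) (X_dvd_of_kill 3 f hk)
    rwa [hf s] at this

end psec

/-- class of monomials modulo `p-1` -/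
def Cl (p : ℕ) {F : Type} [Field F] (g : ℕ) (f : RR F) : Prop :=
  ∀ d, coeff d f ≠ 0 → gr d ≡ g [MOD (p - 1)]

/-- component of grade exactly `M` -/
def gcomp {F : Type} [Field F] (M : ℕ) : RR F →ₗ[F] RR F :=
  weightedHomogeneousComponent (fun i : Fin 4 => (i : ℕ)) M

/-- infinitesimal generator -/
def Eder {F : Type} [Field F] (ε : F) : Derivation F (RR F) (RR F) :=
  mkDerivation F ![0, C ε * X 0, 2 * X 1, 3 * X 2]

section projsec
variable {p : ℕ} [Fact p.Prime] {F : Type} [Field F] [CharP F p]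

lemma gr_add (d e : Fin 4 →₀ ℕ) : gr (d + e) = gr d + gr e := by simp [gr]; ring

lemma proj_apply (g : ℕ) (f : RR F) : proj p g f =
    - ∑ w : (ZMod p)ˣ, (io p F w) ^ ((p - 2) * g) • tau (io p F w) f := by
  simp [proj]

lemma cl_dvd (g k : ℕ) : (p - 1 ∣ (p - 2) * g + k) ↔ k ≡ g [MOD (p - 1)] := by
  have hp1 := (Fact.out : p.Prime).one_lt
  have h1 : (p - 2) * g + g = (p - 1) * g := by
    obtain ⟨m, rfl⟩ : ∃ m, p = m + 2 := ⟨p - 2, by omega⟩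
    simp only [Nat.add_sub_cancel, show m + 2 - 1 = m + 1 by omega]; ring
  have h2 : (p - 2) * g + g ≡ 0 [MOD (p - 1)] := by
    rw [h1]; exact (Nat.modEq_zero_iff_dvd.mpr (dvd_mul_right _ _))
  rw [← Nat.modEq_zero_iff_dvd]
  constructor
  · intro h
    exact Nat.ModEq.add_left_cancel' _ (h.trans h2.symm)
  · intro h
    exact (Nat.ModEq.add_left _ h).trans h2

lemma sum_units_pow (i : ℕ) :
    ∑ w : (ZMod p)ˣ, (io p F w) ^ i = if p - 1 ∣ i then -1 else 0 := by
  have := FiniteField.sum_pow_units (ZMod p) i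
  rw [ZMod.card] at this
  have h2 := congrArg (io p F) this
  rw [map_sum] at h2
  simp only [map_pow] at h2
  rw [h2]; split_ifs <;> simp

lemma coeff_proj (g : ℕ) (d : Fin 4 →₀ ℕ) (f : RR F) :
    coeff d (proj p g f) = if gr d ≡ g [MOD (p - 1)] then coeff d f else 0 := by
  rw [proj_apply, coeff_neg, coeff_sum]
  simp only [coeff_smul, coeff_tau, smul_eq_mul, ← mul_assoc, ← pow_add]
  rw [← Finset.sum_mul, sum_units_pow]
  simp only [cl_dvd]
  split_ifs <;> simp

lemma Cl_proj (g : ℕ) (f : RR F) : Cl p g (proj p g f) := by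
  intro d hd
  rw [coeff_proj] at hd
  by_contra h
  rw [if_neg h] at hd; exact hd rfl

lemma proj_eq_self {g : ℕ} {f : RR F} (h : Cl p g f) : proj p g f = f := by
  ext d
  rw [coeff_proj]
  split_ifs with h1
  · rfl
  · by_contra h2
    exact h1 (h d fun h3 => h2 h3.symm)

lemma proj_of_ne {g k : ℕ} {f : RR F} (h : Cl p k f) (hk : ¬ k ≡ g [MOD (p - 1)]) :
    proj p g f = 0 := by
  ext d
  rw [coeff_proj]
  split_ifs with h1
  · by_contra h2
    exact hk ((h d (by simpa using h2)).symm.trans h1)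
  · simp

lemma PInv_proj {ε : F} {f : RR F} (hf : PInv p ε f) (g : ℕ) : PInv p ε (proj p g f) := by
  intro s
  rw [proj_apply, map_neg, map_sum]
  congr 1
  apply Finset.sum_congr rfl
  intro w _
  rw [map_smul, sig_tau, ← map_mul, hf]

lemma Sp.proj {w : Fin 4 → ℤ} {S : Set ℤ} {f : RR F} (hf : Sp w S f) (g : ℕ) :
    Sp w S (proj p g f) := by
  intro d hd
  rw [coeff_proj] at hd
  split_ifs at hd with h
  · exact hf d hd
  · exact absurd rfl hd

lemma kill_proj (S : Finset (Fin 4)) (g : ℕ) (f : RR F) :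
    kill S (proj p g f) = proj p g (kill S f) := by
  ext d
  rw [coeff_kill, coeff_proj, coeff_proj, coeff_kill]
  split_ifs <;> rfl

lemma sum_proj (f : RR F) : ∑ g ∈ Finset.range (p - 1), proj p g f = f := by
  have hp1 := (Fact.out : p.Prime).one_lt
  ext d
  rw [coeff_sum]
  rw [Finset.sum_eq_single (gr d % (p - 1))]
  · rw [coeff_proj, if_pos (Nat.mod_modEq _ _).symm]
  · intro b hb hne
    rw [coeff_proj, if_neg]
    intro h
    apply hne
    have h2 : gr d % (p - 1) = b % (p - 1) := h
    rw [h2, Nat.mod_eq_of_lt (Finset.mem_range.mp hb)]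
  · intro h
    exact absurd (Finset.mem_range.mpr (Nat.mod_lt _ (by omega))) h

lemma Cl.mul {g k : ℕ} {f h : RR F} (hf : Cl p g f) (hh : Cl p k h) : Cl p (g + k) (f * h) := by
  classical
  intro d hd
  rw [coeff_mul] at hd
  obtain ⟨⟨x, y⟩, hxy, hne⟩ := Finset.exists_ne_zero_of_sum_ne_zero hd
  rw [Finset.HasAntidiagonal.mem_antidiagonal] at hxy
  rw [← hxy, gr_add]
  exact (hf x (left_ne_zero_of_mul hne)).add (hh y (right_ne_zero_of_mul hne))

lemma Cl.C (c : F) : Cl p 0 (C c : RR F) := by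
  classical
  intro d hd
  rw [coeff_C] at hd
  split_ifs at hd with h
  · rw [← h]; simp [gr]; rfl
  · exact absurd rfl hd

lemma Cl.pow {g : ℕ} {f : RR F} (hf : Cl p g f) (n : ℕ) : Cl p (n * g) (f ^ n) := by
  induction n with
  | zero => rw [pow_zero, zero_mul]; exact Cl.C 1
  | succ n ih => rw [pow_succ, add_mul, one_mul]; exact ih.mul hf

lemma Cl.X (i : Fin 4) : Cl p (i : ℕ) (X i : RR F) := by
  classical
  intro d hd
  rw [coeff_X'] at hd
  split_ifs at hd with h
  · rw [← h]
    fin_cases i <;> simp [gr, Finsupp.single_apply] <;> rfl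
  · exact absurd rfl hd

lemma Cl.add {g : ℕ} {f h : RR F} (hf : Cl p g f) (hh : Cl p g h) : Cl p g (f + h) := by
  intro d hd
  rw [coeff_add] at hd
  by_cases h : coeff d f = 0
  · rw [h, zero_add] at hd; exact hh d hd
  · exact hf d h

lemma Cl.neg {g : ℕ} {f : RR F} (hf : Cl p g f) : Cl p g (-f) := by
  intro d hd
  rw [coeff_neg] at hd
  exact hf d (by simpa using hd)

lemma Cl.sub {g : ℕ} {f h : RR F} (hf : Cl p g f) (hh : Cl p g h) : Cl p g (f - h) := by
  rw [sub_eq_add_neg]; exact hf.add hh.neg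

lemma Cl.kill {g : ℕ} {f : RR F} (hf : Cl p g f) (S : Finset (Fin 4)) : Cl p g (kill S f) := by
  intro d hd
  rw [coeff_kill] at hd
  split_ifs at hd with h
  · exact hf d hd
  · exact absurd rfl hd

lemma Cl.congr {g k : ℕ} {f : RR F} (hf : Cl p g f) (h : g ≡ k [MOD (p - 1)]) : Cl p k f :=
  fun d hd => (hf d hd).trans h

end projsec

section topsec
variable {F : Type} [Field F]

lemma coeff_gcomp (M : ℕ) (d : Fin 4 →₀ ℕ) (f : RR F) :
    coeff d (gcomp M f) = if gr d = M then coeff d f else 0 := by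
  classical
  rw [gcomp, coeff_weightedHomogeneousComponent]
  have : Finsupp.weight (fun i : Fin 4 => (i : ℕ)) d = gr d := by
    rw [Finsupp.weight_apply, Finsupp.sum_fintype _ _ (by simp), Fin.sum_univ_four]
    simp only [gr, smul_eq_mul]
    have : (((3 : Fin 4) : ℕ)) = 3 := rfl
    rw [this]; simp; ring
  rw [this]

lemma Sp.gcomp {w : Fin 4 → ℤ} {S : Set ℤ} {f : RR F} (hf : Sp w S f) (M : ℕ) :
    Sp w S (gcomp M f) := by
  intro d hd
  rw [coeff_gcomp] at hd
  split_ifs at hd with h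
  · exact hf d hd
  · exact absurd rfl hd

lemma Ex_gcomp (M : ℕ) (f : RR F) : Ex wg (gcomp M f) M := by
  intro d hd
  rw [coeff_gcomp] at hd
  split_ifs at hd with h
  · rw [wgt_wg, h]; rfl
  · exact absurd rfl hd

lemma gcomp_eq_self {M : ℕ} {f : RR F} (hf : Ex wg f M) : gcomp M f = f := by
  ext d
  rw [coeff_gcomp]
  split_ifs with h
  · rfl
  · by_contra h2
    have := hf d fun h3 => h2 h3.symm
    rw [wgt_wg, Set.mem_singleton_iff] at this
    exact h (by exact_mod_cast this)

lemma gcomp_of_ne {M k : ℕ} {f : RR F} (hf : Ex wg f k) (h : k ≠ M) : gcomp M f = 0 := by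
  ext d
  rw [coeff_gcomp]
  split_ifs with h1
  · by_contra h2
    have := hf d (by simpa using h2)
    rw [wgt_wg, Set.mem_singleton_iff, h1] at this
    exact h (by exact_mod_cast this.symm)
  · simp

lemma kill_gcomp (S : Finset (Fin 4)) (g : ℕ) (f : RR F) :
    kill S (gcomp g f) = gcomp g (kill S f) := by
  ext d
  rw [coeff_kill, coeff_gcomp, coeff_gcomp, coeff_kill]
  split_ifs <;> rfl

lemma Eder_X0 (ε : F) : Eder ε (X 0) = 0 := by simp [Eder, mkDerivation_X]
lemma Eder_X1 (ε : F) : Eder ε (X 1) = C ε * X 0 := by simp [Eder, mkDerivation_X]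
lemma Eder_X2 (ε : F) : Eder ε (X 2) = 2 * X 1 := by simp [Eder, mkDerivation_X]
lemma Eder_X3 (ε : F) : Eder ε (X 3) = 3 * X 2 := by simp [Eder, mkDerivation_X]

/-- the nonlinear remainder -/
def Trem (ε : F) : RR F →ₗ[F] RR F := (sig ε 1).toLinearMap - LinearMap.id - (Eder ε).toLinearMap

lemma Trem_apply (ε : F) (f : RR F) : Trem ε f = sig ε 1 f - f - Eder ε f := rfl

lemma Ex.le {w : Fin 4 → ℤ} {f : RR F} {M N : ℤ} (h : Ex w f M) (hMN : M ≤ N) : Le w f N :=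
  Sp.mono h (by simpa using hMN)

lemma ET_X (ε : F) (i : Fin 4) : Ex wg (Eder ε (X i)) (wg i - 1) ∧
    Le wg (Trem ε (X i)) (wg i - 2) := by
  have h0 : ∀ i, Ex wg (X i : RR F) (wg i) := fun i => Sp.X i rfl
  have e2 : (2 : RR F) = C 2 := (map_ofNat C 2).symm
  have e3 : (3 : RR F) = C 3 := (map_ofNat C 3).symm
  fin_cases i
  · simp only [Fin.zero_eta, Trem_apply, Eder_X0, sig_X0]
    simp only [sub_self]
    exact ⟨Sp.zero, Sp.zero⟩
  · simp only [Fin.mk_one, Trem_apply, Eder_X1, sig_X1]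
    constructor
    · apply Sp.C_mul; simpa [wg] using h0 0
    · simp only [mul_one, add_sub_cancel_left, sub_self]; exact Sp.zero
  · simp only [Fin.reduceFinMk, Trem_apply, Eder_X2, sig_X2]
    constructor
    · rw [e2]; apply Sp.C_mul; simpa [wg] using h0 1
    · have : X 2 + 2 * C 1 * X 1 + C (ε * 1 ^ 2) * X 0 - X 2 - 2 * X 1 = C ε * (X 0 : RR F) := by
        simp; ring
      rw [this]
      apply Sp.C_mul
      exact Ex.le (h0 0) (by simp [wg])
  · simp only [Fin.reduceFinMk, Trem_apply, Eder_X3, sig_X3]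
    constructor
    · rw [e3]; apply Sp.C_mul; simpa [wg] using h0 2
    · have : X 3 + 3 * C 1 * X 2 + 3 * C 1 ^ 2 * X 1 + C (ε * 1 ^ 3) * X 0 - X 3 - 3 * X 2
        = C 3 * X 1 + C ε * (X 0 : RR F) := by
        simp [← e3]; ring
      rw [this]
      apply Sp.add
      · apply Sp.C_mul
        exact Ex.le (h0 1) (by simp [wg])
      · apply Sp.C_mul
        exact Ex.le (h0 0) (by simp [wg])

lemma ET_monomial (ε : F) (d : Fin 4 →₀ ℕ) (c : F) : ∀ G : ℤ, Ex wg (monomial d c) G →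
    Ex wg (Eder ε (monomial d c)) (G - 1) ∧ Le wg (Trem ε (monomial d c)) (G - 2) := by
  refine MvPolynomial.induction_on_monomial (motive := fun f => ∀ G : ℤ, Ex wg f G →
    Ex wg (Eder ε f) (G - 1) ∧ Le wg (Trem ε f) (G - 2)) ?_ ?_ d c
  · intro a G _
    have : Trem ε (C a) = 0 := by
      rw [Trem_apply, sig_C]
      have : Eder ε (C a) = 0 := (Eder ε).map_algebraMap a
      rw [this]; ring
    rw [this]
    have h2 : Eder ε (C a) = 0 := (Eder ε).map_algebraMap a
    rw [h2]
    exact ⟨Sp.zero, Sp.zero⟩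
  · intro f n ih G hG
    have hf : Ex wg f (G - wg n) := by
      intro d hd
      have := hG (d + Finsupp.single n 1) (by rwa [coeff_mul_X])
      rw [wgt_add, wgt_single] at this
      simp only [Set.mem_singleton_iff] at *
      push_cast at this
      omega
    obtain ⟨h1, h2⟩ := ih _ hf
    obtain ⟨h3, h4⟩ := ET_X ε n
    have hX : Ex wg (X n : RR F) (wg n) := Sp.X n rfl
    constructor
    · rw [Derivation.leibniz, smul_eq_mul, smul_eq_mul]
      apply Sp.add
      · have := hf.mul h3; convert this using 2; ring
      · have := hX.mul h1; convert this using 2; ring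
    · have e : Trem ε (f * X n) = Trem ε f * (X n + Eder ε (X n) + Trem ε (X n))
          + Eder ε f * Eder ε (X n) + (f + Eder ε f) * Trem ε (X n) := by
        simp only [Trem_apply, map_mul, Derivation.leibniz, smul_eq_mul]; ring
      rw [e]
      have k1 : Le wg (X n + Eder ε (X n) + Trem ε (X n)) (wg n) :=
        ((Ex.le hX le_rfl).add (Ex.le h3 (by omega))).add (Le.mono h4 (by omega))
      have k2 : Le wg (f + Eder ε f) (G - wg n) :=
        (Ex.le hf le_rfl).add (Ex.le h1 (by omega))
      exact (((h2.mul k1).mono (by omega)).add (Ex.le (h1.mul h3) (by omega))).add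
        ((k2.mul h4).mono (by omega))

lemma Ex_Eder (ε : F) {f : RR F} {M : ℤ} (hf : Ex wg f M) : Ex wg (Eder ε f) (M - 1) :=
  Sp.map (Eder ε).toLinearMap (fun d c hd => by
    exact (ET_monomial ε d c M (Sp.monomial d c hd)).1) hf

lemma Le_Eder (ε : F) {f : RR F} {M : ℤ} (hf : Le wg f M) : Le wg (Eder ε f) (M - 1) :=
  Sp.map (Eder ε).toLinearMap (fun d c hd => by
    simp only [Set.mem_Iic] at hd
    exact Ex.le (ET_monomial ε d c _ (Sp.monomial d c rfl)).1 (by omega)) hf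

lemma Le_Trem (ε : F) {f : RR F} {M : ℤ} (hf : Le wg f M) : Le wg (Trem ε f) (M - 2) :=
  Sp.map (Trem ε) (fun d c hd => by
    simp only [Set.mem_Iic] at hd
    exact Le.mono (ET_monomial ε d c _ (Sp.monomial d c rfl)).2 (by omega)) hf

lemma topE (ε : F) {f f' fM : RR F} {M : ℤ} (h : f = fM + f') (hM : Ex wg fM M)
    (hf' : Le wg f' (M - 2)) (hinv : sig ε 1 f = f) : Eder ε fM = 0 := by
  have h1 : Trem ε f = - Eder ε f := by rw [Trem_apply, hinv]; ring
  have h2 : Eder ε fM = - Eder ε f' - Trem ε f := by rw [h1, h, map_add]; ring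
  have hf : Le wg f M := by
    rw [h]; exact (Ex.le hM le_rfl).add (hf'.mono (by omega))
  have h3 : Le wg (Eder ε fM) (M - 2) := by
    rw [h2]
    exact (((Le_Eder ε hf').mono (by omega)).neg).sub (Le_Trem ε hf)
  exact eq_zero_of_Le_Ex (by omega) h3 (Ex_Eder ε hM)

end topsec

/-- `β = a₂^p - a₂ a₁^{p-1}` -/
def be (p : ℕ) (F : Type) [Field F] : RR F := X 2 ^ p - X 2 * X 1 ^ (p - 1)

/-- monomials in `N, a₁, ξ, β` -/
def mon (p : ℕ) [Fact p.Prime] (F : Type) [Field F] [CharP F p] (j a b c : ℕ) : RR F :=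
  Nn p 0 ^ j * X 1 ^ a * xipoly F ^ b * be p F ^ c

/-- invariants modulo `a₀` of small degree in `a₃` -/
structure Sy (p : ℕ) [Fact p.Prime] {F : Type} [Field F] [CharP F p] (n : ℤ) (y : RR F) : Prop where
  k : kill {0} y = y
  e : Ex w1 y n
  i : PInv p 0 y
  l : Le w3 y (p - 1)

section ssec
variable {p : ℕ} [Fact p.Prime] {F : Type} [Field F] [CharP F p]

lemma natDegree_aeval_le (h : Fin 4 → Polynomial F) (w : Fin 4 → ℤ)
    (hw : ∀ i, ((h i).natDegree : ℤ) ≤ w i) (f : RR F) (M : ℕ) (hf : Le w f M) :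
    (aeval h f).natDegree ≤ M := by
  rw [aeval_def, eval₂_eq']
  apply Polynomial.natDegree_sum_le_of_forall_le
  intro d hd
  have h1 := hf d (by simpa using hd)
  simp only [Set.mem_Iic, wgt] at h1
  have h2 : (∏ i, h i ^ d i).natDegree ≤ ∑ i, d i * (h i).natDegree := by
    refine (Polynomial.natDegree_prod_le _ _).trans ?_
    exact Finset.sum_le_sum fun i _ => Polynomial.natDegree_pow_le
  have h3 : ((∑ i, d i * (h i).natDegree : ℕ) : ℤ) ≤ M := by
    push_cast
    rw [Fin.sum_univ_four]
    have := fun i => mul_le_mul_of_nonneg_left (hw i) (Int.natCast_nonneg (d i))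
    linarith [this 0, this 1, this 2, this 3]
  have h4 : (algebraMap F (Polynomial F) (coeff d f) * ∏ i, h i ^ d i).natDegree
    ≤ (∏ i, h i ^ d i).natDegree := by
    rw [Polynomial.algebraMap_eq]
    exact Polynomial.natDegree_C_mul_le _ _
  have : (((algebraMap F (Polynomial F) (coeff d f) * ∏ i, h i ^ d i).natDegree : ℕ) : ℤ) ≤ M :=
    le_trans (by exact_mod_cast h4.trans h2) h3
  exact_mod_cast this

lemma ex_of_X_mul {w : Fin 4 → ℤ} {M : ℤ} {z : RR F} (i : Fin 4) (h : Ex w (X i * z) M) :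
    Ex w z (M - w i) := by
  intro d hd
  have := h (Finsupp.single i 1 + d) (by rwa [coeff_X_mul])
  rw [wgt_add, wgt_single] at this
  simp only [Set.mem_singleton_iff] at *
  push_cast at this
  omega

lemma le_of_X1_mul {M : ℤ} {z : RR F} (h : Le w3 (X 1 * z) M) : Le w3 z M := by
  intro d hd
  have := h (Finsupp.single 1 1 + d) (by rwa [coeff_X_mul])
  rw [wgt_add, wgt_single] at this
  simpa [w3] using this

lemma sig0_X1 (s : F) : sig 0 s (X 1 : RR F) = X 1 := by rw [sig_X1]; simp
lemma sig0_X2 (s : F) : sig 0 s (X 2 : RR F) = X 2 + 2 * C s * X 1 := by rw [sig_X2]; simp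
lemma sig0_X3 (s : F) : sig 0 s (X 3 : RR F) = X 3 + 3 * C s * X 2 + 3 * C s ^ 2 * X 1 := by
  rw [sig_X3]; simp

lemma PInv_X1 : PInv p (0 : F) (X 1) := fun s => sig0_X1 _

lemma PInv_xi : PInv p (0 : F) (xipoly F) := by
  intro s
  simp only [xipoly, map_sub, map_mul, map_pow, sig0_X1, sig0_X2, sig0_X3, map_ofNat]
  ring

lemma PInv_be : PInv p (0 : F) (be p F) := by
  intro s
  have hp := (Fact.out : p.Prime)
  simp only [be, map_sub, map_mul, map_pow, sig0_X1, sig0_X2, map_ofNat]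
  rw [add_pow_char, mul_pow, mul_pow]
  have h2 : (2 : RR F) ^ p = 2 := by
    have : (2 : RR F) = C (io p F 2) := by rw [map_ofNat, map_ofNat]
    rw [this, ← map_pow, ← map_pow, ZMod.pow_card]
  have hs : (C (io p F s) : RR F) ^ p = C (io p F s) := by
    rw [← map_pow, ← map_pow, ZMod.pow_card]
  rw [h2, hs]
  have : (X 1 : RR F) ^ p = X 1 * X 1 ^ (p - 1) := by
    rw [← pow_succ']; congr 1; have := hp.one_le; omega
  rw [this]; ring

lemma two_ne (hp : 3 < p) : (2 : F) ≠ 0 := by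
  intro h
  have := (CharP.cast_eq_zero_iff F p 2).mp (by exact_mod_cast h)
  have := Nat.le_of_dvd (by norm_num) this
  omega

lemma three_ne (hp : 3 < p) : (3 : F) ≠ 0 := by
  intro h
  have := (CharP.cast_eq_zero_iff F p 3).mp (by exact_mod_cast h)
  have := Nat.le_of_dvd (by norm_num) this
  omega

lemma ex_xi : Ex w1 (xipoly F) 2 := by
  have e3 : (3 : RR F) = C 3 := (map_ofNat C 3).symm
  have e4 : (4 : RR F) = C 4 := (map_ofNat C 4).symm
  rw [xipoly, e3, e4, mul_assoc]
  exact (Sp.C_mul _ ((ex_w1_X 2).pow 2)).sub (Sp.C_mul _ ((ex_w1_X 3).mul (ex_w1_X 1)))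

lemma ex_be : Ex w1 (be p F) p := by
  have hp := (Fact.out : p.Prime).one_le
  have h1 : Ex w1 (X 2 ^ p : RR F) p := by simpa using (ex_w1_X (F := F) 2).pow p
  have h2 : Ex w1 (X 2 * X 1 ^ (p - 1) : RR F) p := by
    have := (ex_w1_X (F := F) 2).mul ((ex_w1_X (F := F) 1).pow (p - 1))
    convert this using 2; push_cast [hp]; ring
  exact h1.sub h2

lemma le3_xi : Le w3 (xipoly F) 1 := by
  have e3 : (3 : RR F) = C 3 := (map_ofNat C 3).symm
  have e4 : (4 : RR F) = C 4 := (map_ofNat C 4).symm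
  rw [xipoly, e3, e4, mul_assoc]
  have hX3 : Le w3 (X 3 : RR F) 1 := Sp.X 3 (by simp [w3])
  have h2 : Le w3 (X 2 : RR F) 0 := le_w3_X 2 (by decide)
  have h1 : Le w3 (X 1 : RR F) 0 := le_w3_X 1 (by decide)
  exact (Sp.C_mul _ ((h2.pow 2).mono (by norm_num))).sub (Sp.C_mul _ ((hX3.mul h1).mono (by norm_num)))

lemma le3_be : Le w3 (be p F) 0 := by
  have h2 : Le w3 (X 2 : RR F) 0 := le_w3_X 2 (by decide)
  have h1 : Le w3 (X 1 : RR F) 0 := le_w3_X 1 (by decide)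
  exact ((h2.pow p).mono (by simp)).sub ((h2.mul (h1.pow (p-1))).mono (by simp))

lemma kill0_xi : kill {0} (xipoly F) = xipoly F := by
  simp [xipoly, kill_X, map_ofNat]

lemma kill0_be : kill {0} (be p F) = be p F := by
  simp [be, kill_X]

lemma cl_xi : Cl p 4 (xipoly F) := by
  have e3 : (3 : RR F) = C 3 := (map_ofNat C 3).symm
  have e4 : (4 : RR F) = C 4 := (map_ofNat C 4).symm
  rw [xipoly, e3, e4, mul_assoc]
  exact ((Cl.C 3).mul ((Cl.X 2).pow 2)).sub ((Cl.C 4).mul ((Cl.X 3).mul (Cl.X 1)))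

lemma cl_be : Cl p 2 (be p F) := by
  have hp := (Fact.out : p.Prime).one_le
  have h1 : Cl p 2 (X 2 ^ p : RR F) := ((Cl.X 2).pow p).congr (by
    have : p * 2 = 2 + (p - 1) * 2 := by omega
    show p * 2 ≡ 2 [MOD p - 1]
    rw [this]; simp [Nat.ModEq])
  have h2 : Cl p 2 (X 2 * X 1 ^ (p - 1) : RR F) := ((Cl.X 2).mul ((Cl.X 1).pow (p - 1))).congr (by
    show 2 + (p - 1) * 1 ≡ 2 [MOD p - 1]
    simp [Nat.ModEq])
  exact h1.sub h2

lemma ex_Nn (ε : F) : Ex w1 (Nn p ε) p := by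
  have := Ex.prod (Finset.univ : Finset (ZMod p)) (fun s => sig ε (io p F s) (X 3))
    (fun s _ => ex_w1_sig ε (io p F s) (ex_w1_X 3))
  simpa [Nn, ZMod.card] using this

lemma Sy.mono_ (a b c : ℕ) (hb : b < p) : Sy p (a + 2 * b + p * c) (mon p F 0 a b c) where
  k := by simp [mon, kill0_xi, kill0_be, kill_X]
  e := by
    have := (((ex_w1_X (F := F) 1).pow a).mul (ex_xi.pow b)).mul ((ex_be (p := p) (F := F)).pow c)
    simp only [mon, pow_zero, one_mul]
    have e : (a : ℤ) + 2 * b + p * c = a * 1 + b * 2 + c * p := by ring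
    rw [e]; exact this
  i := by
    simp only [mon, pow_zero, one_mul]
    exact ((PInv_X1.pow a).mul (PInv_xi.pow b)).mul (PInv_be.pow c)
  l := by
    simp only [mon, pow_zero, one_mul]
    have h1 : Le w3 (X 1 : RR F) 0 := le_w3_X 1 (by decide)
    exact (((h1.pow a).mul (le3_xi.pow b)).mul (le3_be.pow c)).mono (by simp; omega)

lemma Sy.sub {n : ℤ} {y z : RR F} (hy : Sy p n y) (hz : Sy p n z) : Sy p n (y - z) :=
  ⟨by rw [map_sub, hy.k, hz.k], hy.e.sub hz.e, hy.i.sub hz.i, hy.l.sub hz.l⟩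

lemma Sy.C_mul {n : ℤ} {y : RR F} (c : F) (hy : Sy p n y) : Sy p n (C c * y) :=
  ⟨by rw [map_mul, hy.k, kill_C], Sp.C_mul _ hy.e, hy.i.C_mul c, Sp.C_mul _ hy.l⟩

lemma Sy.div {n : ℤ} {y : RR F} (hy : Sy p n y) (h : kill {0, 1} y = 0) :
    ∃ z, y = X 1 * z ∧ Sy p (n - 1) z := by
  have h1 : kill {1} y = 0 := by
    rw [← hy.k, kill_kill]; rw [← h]; congr 2; ext i; simp [or_comm]
  obtain ⟨z, rfl⟩ := X_dvd_of_kill 1 y h1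
  have hX : (X 1 : RR F) ≠ 0 := X_ne_zero 1
  refine ⟨z, rfl, ?_, ?_, ?_, ?_⟩
  · have := hy.k
    rw [map_mul, kill_X] at this
    exact mul_left_cancel₀ hX (by simpa using this)
  · simpa [w1] using ex_of_X_mul 1 hy.e
  · intro s
    have := hy.i s
    rw [map_mul, sig0_X1] at this
    exact mul_left_cancel₀ hX this
  · exact le_of_X1_mul hy.l

lemma coeff_q (y : RR F) (n k : ℕ) (hk : k ≤ n) (he : Ex w1 y n) :
    (aeval ![0, 0, 1, (Polynomial.X : Polynomial F)] y).coeff k =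
      coeff (Finsupp.single 2 (n - k) + Finsupp.single 3 k) y := by
  classical
  rw [aeval_def, eval₂_eq', Polynomial.finsetSum_coeff]
  rw [Finset.sum_eq_single (Finsupp.single 2 (n - k) + Finsupp.single 3 k)]
  · simp [Fin.prod_univ_four, Polynomial.algebraMap_eq]
  · intro d hd hne
    simp only [Fin.prod_univ_four, Polynomial.algebraMap_eq, Polynomial.coeff_C_mul]
    simp only [Matrix.cons_val]
    by_cases h0 : d 0 = 0
    · by_cases h1 : d 1 = 0
      · have := he d (by simpa using hd)
        rw [wgt_w1, h0, h1] at this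
        simp only [Set.mem_singleton_iff] at this
        have h3 : d 3 ≠ k := by
          rintro rfl
          apply hne
          ext i
          fin_cases i <;> simp [h0, h1]
          omega
        simp [h0, h1, Polynomial.coeff_X_pow, h3.symm]
      · simp [h1]
    · simp [h0]
  · intro h
    simp only [mem_support_iff, not_not] at h
    rw [h]; simp

lemma Sy.key (hp : 3 < p) {n : ℕ} {y : RR F} (hy : Sy p n y) :
    kill {0, 1} y = C (coeff (Finsupp.single 2 n) y) * X 2 ^ n := by
  classical
  set q := aeval ![0, 0, 1, (Polynomial.X : Polynomial F)] y with hq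
  have hdeg : q.natDegree ≤ p - 1 := by
    apply natDegree_aeval_le _ w3
    · intro i; fin_cases i <;> simp [w3]
    · have := hy.l; have := (Fact.out : p.Prime).one_le; push_cast [this]; assumption
  have hev : ∀ s : ZMod p, q.eval (3 * io p F s) = q.eval 0 := by
    intro s
    have h1 : ∀ f : RR F, (Polynomial.aeval (0 : F)) (aeval ![0, 0, 1, (Polynomial.X : Polynomial F)] (sig 0 (io p F s) f)) = (Polynomial.aeval (3 * io p F s)) (aeval ![0, 0, 1, (Polynomial.X : Polynomial F)] f) := by
      intro f
      have : ((Polynomial.aeval (0 : F)).comp (aeval ![0, 0, 1, (Polynomial.X : Polynomial F)])).comp (sig 0 (io p F s)) = (Polynomial.aeval (3 * io p F s)).comp (aeval ![0, 0, 1, (Polynomial.X : Polynomial F)]) := by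
        apply MvPolynomial.algHom_ext
        intro i
        fin_cases i
        · simp [sig_X0]
        · simp [sig0_X1]
        · simp [sig0_X2]
        · simp [sig0_X3, map_ofNat, MvPolynomial.algHom_C]
      exact DFunLike.congr_fun this f
    have h2 := h1 y
    rw [hy.i s] at h2
    rw [Polynomial.coe_aeval_eq_eval, Polynomial.coe_aeval_eq_eval] at h2
    exact h2.symm
  have hq0 : q = Polynomial.C (q.eval 0) := by
    rw [← sub_eq_zero]
    apply Polynomial.eq_zero_of_natDegree_lt_card_of_eval_eq_zero (q - Polynomial.C (q.eval 0))
      (f := fun s : ZMod p => 3 * io p F s)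
    · intro a b hab
      exact io_inj (mul_left_cancel₀ (three_ne hp) hab)
    · intro s
      rw [Polynomial.eval_sub, hev]; simp
    · rw [ZMod.card]
      refine lt_of_le_of_lt (Polynomial.natDegree_sub_le _ _) ?_
      simp; omega
  ext d
  rw [coeff_kill]
  rw [X_pow_eq_monomial, C_mul_monomial, mul_one, coeff_monomial]
  split_ifs with h1 h2 h2
  · rw [h2]
  · by_contra hne
    have he := hy.e d hne
    rw [wgt_w1] at he
    have h10 := h1 0 (by simp)
    have h11 := h1 1 (by simp)
    rw [h10, h11] at he
    simp only [Set.mem_singleton_iff] at he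
    have hd : d = Finsupp.single 2 (n - d 3) + Finsupp.single 3 (d 3) := by
      ext i
      fin_cases i <;> simp [h10, h11]
      omega
    have hd3 : d 3 ≠ 0 := by
      intro h3; apply h2; rw [hd, h3]; simp
    have h5 := coeff_q y n (d 3) (by omega) hy.e
    rw [← hq, hq0, Polynomial.coeff_C, if_neg hd3, ← hd] at h5
    exact hne h5.symm
  · exact absurd (by subst h2; intro i hi; simp at hi; rcases hi with rfl | rfl <;> simp) h1
  · rfl

lemma Sy.zero_of_neg {n : ℤ} (hn : n < 0) {y : RR F} (hy : Sy p n y) : y = 0 :=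
  eq_zero_of_Le_neg (w := w1) (by intro i; fin_cases i <;> simp [w1]) hn (hy.e.le le_rfl)

lemma coeff_lead (b c : ℕ) (hp : 3 < p) :
    kill {0, 1} (mon p F 0 0 b c) = C (3 ^ b) * X 2 ^ (2 * b + p * c) := by
  have h : (0 : ℕ) ^ (p - 1) = 0 := by apply zero_pow; omega
  have e3 : (3 : RR F) = C 3 := (map_ofNat C 3).symm
  have h' : (0 : RR F) ^ (p - 1) = 0 := by apply zero_pow; omega
  simp only [mon, pow_zero, one_mul, map_mul, map_pow, xipoly, be, map_sub, kill_X, map_ofNat]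
  simp [h', e3]
  ring

lemma Sy.peel (hp : 3 < p) {n : ℕ} {y : RR F} (hy : Sy p n y) (b c : ℕ) (hb : b < p)
    (hbc : 2 * b + p * c = n) :
    ∃ z, y = C (coeff (Finsupp.single 2 n) y / 3 ^ b) * mon p F 0 0 b c + X 1 * z ∧
      Sy p (n - 1) z := by
  have h1 : Sy p n (y - C (coeff (Finsupp.single 2 n) y / 3 ^ b) * mon p F 0 0 b c) := by
    refine hy.sub (Sy.C_mul _ ?_)
    have := Sy.mono_ (p := p) (F := F) 0 b c hb
    rw [← hbc]; push_cast; simpa using this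
  obtain ⟨z, hz, hs⟩ := h1.div (by
    rw [map_sub, hy.key hp, map_mul, coeff_lead b c hp, kill_C, hbc, ← mul_assoc, ← MvPolynomial.C_mul,
      div_mul_cancel₀, sub_self]
    exact pow_ne_zero _ (three_ne hp))
  exact ⟨z, by rw [← hz]; ring, hs⟩

lemma Sy.lead (hp : 3 < p) (a : ℕ) : ∀ {n : ℕ} {y : RR F} (hy : Sy p n y) (b c : ℕ) (hb : b < p)
    (hbc : a + 2 * b + p * c = n) (l : F) (r : RR F)
    (hl : kill {3} y = X 1 ^ a * (C l * X 2 ^ (n - a) + X 1 * r)),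
    ∃ z, y = C (l / 3 ^ b) * mon p F 0 a b c + X 1 ^ (a + 1) * z ∧
      Sy p (n - a - 1) z := by
  induction a with
  | zero =>
    intro n y hy b c hb hbc l r hl
    obtain ⟨z, hz, hs⟩ := hy.peel hp b c hb (by omega)
    have hc : coeff (Finsupp.single 2 n) y = l := by
      have h1 : coeff (Finsupp.single 2 n) (kill {3} y) = coeff (Finsupp.single 2 n) y := by
        rw [coeff_kill, if_pos]; simp
      rw [← h1, hl]
      simp only [pow_zero, one_mul, tsub_zero, coeff_add]
      rw [coeff_C_mul, coeff_X_pow, coeff_X_mul']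
      simp
    rw [hc] at hz
    exact ⟨z, by rw [hz]; ring, by simpa using hs⟩
  | succ a ih =>
    intro n y hy b c hb hbc l r hl
    have hc : coeff (Finsupp.single 2 n) y = 0 := by
      have h1 : coeff (Finsupp.single 2 n) (kill {3} y) = coeff (Finsupp.single 2 n) y := by
        rw [coeff_kill, if_pos]; simp
      rw [← h1, hl, pow_succ', mul_assoc, coeff_X_mul']
      simp
    obtain ⟨z, hz, hs⟩ := hy.div (by rw [hy.key hp, hc]; simp)
    have hX : (X 1 : RR F) ≠ 0 := X_ne_zero 1
    have hs' : Sy p ((n - 1 : ℕ) : ℤ) z := by rw [Nat.cast_sub (by omega)]; exact_mod_cast hs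
    obtain ⟨z', hz', hs''⟩ := ih hs' b c hb (by omega) l r (by
      rw [hz, map_mul, kill_X, if_neg (by decide), pow_succ', mul_assoc] at hl
      rw [mul_left_cancel₀ hX hl]
      congr 4; omega)
    refine ⟨z', ?_, ?_⟩
    · rw [hz, hz', mon, mon]; ring
    · have e : (((n - 1 : ℕ) : ℤ) - a - 1) = n - (a + 1 : ℕ) - 1 := by omega
      rwa [e] at hs''

/-- path used for the odd case -/
def chi (F : Type) [Field F] : RR F →ₐ[F] Polynomial F :=
  aeval ![0, 1, Polynomial.X, Polynomial.C (3 / 4) * (Polynomial.X ^ 2 - 1)]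

lemma deriv_chi (hp : 3 < p) (f : RR F) :
    Polynomial.derivative (chi F f) = Polynomial.C (1 / 2) * chi F (Eder 0 f) := by
  have h2 : (2 : F) ≠ 0 := two_ne hp
  have h4 : (4 : F) ≠ 0 := by
    have : (4 : F) = 2 * 2 := by norm_num
    rw [this]; exact mul_ne_zero h2 h2
  have c2 : (Polynomial.C (1 / 2) * 2 : Polynomial F) = 1 := by
    have : (2 : Polynomial F) = Polynomial.C 2 := (map_ofNat Polynomial.C 2).symm
    rw [this, ← Polynomial.C_mul, one_div_mul_cancel h2, Polynomial.C_1]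
  induction f using MvPolynomial.induction_on with
  | C a => rw [algHom_C, Polynomial.algebraMap_eq, Polynomial.derivative_C]
           have : Eder (0 : F) (C a) = 0 := (Eder 0).map_algebraMap a
           rw [this]; simp
  | add f g hf hg => simp only [map_add, hf, hg]; ring
  | mul_X f i hf =>
    have hX : Polynomial.derivative (chi F (X i)) = Polynomial.C (1 / 2) * chi F (Eder 0 (X i)) := by
      fin_cases i
      · simp [chi, Eder_X0]
      · simp [chi, Eder_X1]
      · simp only [Fin.reduceFinMk, Eder_X2]
        simp [chi, map_ofNat]
        rw [← one_div, c2]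
      · simp only [Fin.reduceFinMk, Eder_X3]
        simp [chi, map_ofNat]
        have : (3 : Polynomial F) = Polynomial.C 3 := (map_ofNat Polynomial.C 3).symm
        have e2 : (2 : Polynomial F) = Polynomial.C 2 := (map_ofNat Polynomial.C 2).symm
        rw [one_add_one_eq_two, this, e2, ← mul_assoc, ← mul_assoc, ← Polynomial.C_mul, ← Polynomial.C_mul]
        congr 2
        field_simp; norm_num
    rw [map_mul, Polynomial.derivative_mul, hf, hX, Derivation.leibniz]
    simp only [smul_eq_mul, map_add, map_mul]
    ring

end ssec

section s2sec
variable {p : ℕ} [Fact p.Prime] {F : Type} [Field F] [CharP F p]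

lemma modEq_gap {a b m : ℕ} (h : a ≡ b [MOD m]) (hab : a < b) : a + m ≤ b := by
  have := (Nat.modEq_iff_dvd' hab.le).mp h
  have := Nat.le_of_dvd (by omega) this
  omega

lemma const_of_deriv {q : Polynomial F} (hq : Polynomial.derivative q = 0) (hd : q.natDegree < p) :
    q = Polynomial.C (q.coeff 0) := by
  ext k
  rw [Polynomial.coeff_C]
  split_ifs with h
  · rw [h]
  · by_contra hne
    have hk : k < p := lt_of_le_of_lt (Polynomial.le_natDegree_of_ne_zero hne) hd
    have h1 : (Polynomial.derivative q).coeff (k - 1) = 0 := by rw [hq]; simp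
    rw [Polynomial.coeff_derivative, Nat.sub_add_cancel (by omega)] at h1
    rcases mul_eq_zero.mp h1 with h2 | h2
    · exact hne h2
    · have h3 : ((k : ℕ) : F) = 0 := by
        have : ((k - 1 : ℕ) : F) + 1 = ((k - 1 + 1 : ℕ) : F) := by push_cast; rfl
        rw [this, Nat.sub_add_cancel (by omega)] at h2; exact h2
      have := Nat.le_of_dvd (by omega) ((CharP.cast_eq_zero_iff F p k).mp h3)
      omega

lemma Sy.odd (hp : 3 < p) {n : ℕ} {y : RR F} (hy : Sy p n y) (ho : n % 2 = 1) (hn : n + 2 ≤ p) :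
    coeff (Finsupp.single 2 n) y = 0 := by
  classical
  set y' := proj p (2 * n) y with hy'
  set fM := gcomp (2 * n) y' with hfM
  have hinv : sig 0 1 y' = y' := by
    have := PInv_proj hy.i (2 * n) 1
    rwa [map_one] at this
  have hE : Eder 0 fM = 0 := by
    refine topE 0 (f := y') (f' := y' - fM) (M := (2 * n : ℕ)) (by ring) (Ex_gcomp _ _) ?_ hinv
    intro d hd
    rw [coeff_sub, hfM, coeff_gcomp] at hd
    split_ifs at hd with h
    · simp at hd
    · rw [sub_zero] at hd
      have h1 := Cl_proj (p := p) (2 * n) y d hd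
      have h2 : Ex w1 y' n := Sp.proj hy.e _
      have h2 := h2 d hd
      rw [wgt_w1] at h2
      simp only [Set.mem_singleton_iff, Set.mem_Iic, wgt_wg] at *
      rcases lt_or_gt_of_ne h with h3 | h3
      · have := modEq_gap h1 h3; omega
      · have := modEq_gap h1.symm h3
        unfold gr at this; omega
  have hmon : ∀ d, coeff d fM ≠ 0 → d 0 = 0 ∧ d 1 = d 3 ∧ d 2 + 2 * d 3 = n := by
    intro d hd
    have hk : kill {0} fM = fM := by rw [hfM, kill_gcomp, hy', kill_proj, hy.k]
    have h0 : d 0 = 0 := by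
      rw [← hk, coeff_kill] at hd
      by_contra h; apply hd; rw [if_neg]; simpa using h
    have h1 : Ex w1 fM n := Sp.gcomp (Sp.proj hy.e _) _
    have h1 := h1 d hd
    have h2 := Ex_gcomp _ _ d hd
    rw [wgt_w1] at h1
    simp only [Set.mem_singleton_iff, wgt_wg, gr] at *
    omega
  have hdeg : (chi F fM).natDegree ≤ n := by
    apply natDegree_aeval_le _ ![0, 0, 1, 2]
    · intro i; fin_cases i <;> simp
      refine (Polynomial.natDegree_C_mul_le _ _).trans ?_
      refine (Polynomial.natDegree_sub_le _ _).trans ?_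
      simp
    · intro d hd
      have := hmon d hd
      simp [wgt]; omega
  have hconst := const_of_deriv (p := p) (q := chi F fM) (by rw [deriv_chi hp, hE]; simp) (by omega)
  set c := coeff (Finsupp.single 2 n) y with hc
  have hcM : coeff (Finsupp.single 2 n) fM = c := by
    rw [hfM, coeff_gcomp, hy', coeff_proj]; simp [gr, Nat.ModEq, hc]
  have hk3 : kill {3} fM = C c * X 2 ^ n := by
    ext d
    rw [coeff_kill, X_pow_eq_monomial, C_mul_monomial, mul_one, coeff_monomial]
    split_ifs with h1 h2 h2
    · rw [← h2, hcM]
    · by_contra hne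
      obtain ⟨h3, h4, h5⟩ := hmon d hne
      have h13 := h1 3 (by simp)
      apply h2
      ext i
      fin_cases i <;> simp [h3, h13]
      · omega
      · omega
    · exact absurd (by subst h2; simp) h1
    · rfl
  have hfac : ∀ t : F, t ^ 2 = 1 → (chi F fM).eval t = c * t ^ n := by
    intro t ht
    have h : ∀ f : RR F, (Polynomial.aeval t) (chi F f) = (Polynomial.aeval t) (chi F (kill {3} f)) := by
      intro f
      have : (Polynomial.aeval t).comp (chi F) = ((Polynomial.aeval t).comp (chi F)).comp (kill {3}) := by
        apply MvPolynomial.algHom_ext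
        intro i
        fin_cases i
        · simp [kill_X]
        · simp [kill_X]
        · simp [kill_X]
        · simp [kill_X, chi, ht]
      exact DFunLike.congr_fun this f
    have h1 := h fM
    rw [hk3, Polynomial.coe_aeval_eq_eval] at h1
    rw [h1]
    rw [map_mul, algHom_C, map_pow]
    simp [chi]
  have e1 := hfac 1 (by ring)
  have e2 := hfac (-1) (by ring)
  rw [hconst, Polynomial.eval_C] at e1 e2
  rw [e1] at e2
  have : (-1 : F) ^ n = -1 := Odd.neg_one_pow (Nat.odd_iff.mpr ho)
  rw [this] at e2
  have h2 : (2 : F) * c = 0 := by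
    simp only [one_pow, mul_one] at e2
    linear_combination e2
  exact (mul_eq_zero.mp h2).resolve_left (two_ne hp)

lemma Sy.span (hp : 3 < p) (n : ℕ) : ∀ {y : RR F} (hy : Sy p n y),
    y ∈ Submodule.span F {m | ∃ a b c, a + 2 * b + p * c = n ∧ m = mon p F 0 a b c} := by
  induction n using Nat.strong_induction_on with
  | _ n ih =>
  intro y hy
  have hpodd : p % 2 = 1 := by
    have := (Fact.out : p.Prime).eq_two_or_odd; omega
  have main : ∀ (l : F) (b c : ℕ) (z : RR F), 2 * b + p * c = n → y = C l * mon p F 0 0 b c + X 1 * z →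
      Sy p (n - 1) z → y ∈ Submodule.span F {m | ∃ a b c, a + 2 * b + p * c = n ∧ m = mon p F 0 a b c} := by
    intro l b c z hbc hy' hz
    rw [hy']
    apply Submodule.add_mem
    · rw [← smul_eq_C_mul]
      exact Submodule.smul_mem _ _ (Submodule.subset_span ⟨0, b, c, by omega, rfl⟩)
    · rcases Nat.eq_zero_or_pos n with h0 | h0
      · rw [hz.zero_of_neg (by omega)]; simp
      · have hz' : Sy p ((n - 1 : ℕ) : ℤ) z := by rw [Nat.cast_sub (by omega)]; exact_mod_cast hz
        have := ih (n - 1) (by omega) hz'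
        have h2 := Submodule.mem_map_of_mem (f := LinearMap.mulLeft F (X 1 : RR F)) this
        rw [Submodule.map_span] at h2
        refine Submodule.span_mono ?_ h2
        rintro _ ⟨_, ⟨a, b, c, h, rfl⟩, rfl⟩
        exact ⟨a + 1, b, c, by omega, by simp [mon]; ring⟩
  by_cases hsmall : n % 2 = 1 ∧ n < p
  · have h0 := hy.odd hp hsmall.1 (by omega)
    obtain ⟨z, hz, hs⟩ := hy.div (by rw [hy.key hp, h0]; simp)
    have hn : n ≠ 0 := by omega
    have hz' : Sy p ((n - 1 : ℕ) : ℤ) z := by rw [Nat.cast_sub (by omega)]; exact_mod_cast hs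
    have := ih (n - 1) (by omega) hz'
    have h2 := Submodule.mem_map_of_mem (f := LinearMap.mulLeft F (X 1 : RR F)) this
    rw [Submodule.map_span] at h2
    rw [hz]
    refine Submodule.span_mono ?_ h2
    rintro _ ⟨_, ⟨a, b, c, h, rfl⟩, rfl⟩
    exact ⟨a + 1, b, c, by omega, by simp [mon]; ring⟩
  · obtain ⟨b, c, hb, hbc⟩ : ∃ b c : ℕ, b < p ∧ 2 * b + p * c = n := by
      have hdm := Nat.div_add_mod n p
      have hlt := Nat.mod_lt n (show 0 < p by omega)
      set Q := n / p
      set R := n % p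
      have hpQ : (p * Q) % 2 = Q % 2 := by rw [Nat.mul_mod, hpodd]; simp
      by_cases hpar : R % 2 = 0
      · exact ⟨R / 2, Q, by omega, by omega⟩
      · have hQ : Q ≠ 0 := by
          intro hQ
          rw [hQ] at hdm
          apply hsmall; omega
        obtain ⟨Q', hQ'⟩ := Nat.exists_eq_succ_of_ne_zero hQ
        refine ⟨(R + p) / 2, Q', by omega, ?_⟩
        have : p * Q = p * Q' + p := by rw [hQ', Nat.mul_succ]
        omega
    obtain ⟨z, hz, hs⟩ := hy.peel hp b c hb hbc
    exact main _ b c z hbc hz hs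

lemma kill3_Nn (ε : F) : kill {3} (Nn p ε) = 0 := by
  rw [Nn, map_prod]
  apply Finset.prod_eq_zero (Finset.mem_univ 0)
  rw [map_zero, sig_zero, kill_X]; simp

lemma cl_Nn (ε : F) : Cl p 3 (Nn p ε) := by
  -- via torus equivariance
  have h : ∀ w : (ZMod p)ˣ, tau (io p F w) (Nn p ε) = C ((io p F w) ^ 3) * Nn p ε := by
    intro w
    have hw : (io p F w) ≠ 0 := by
      rw [Ne, map_eq_zero]; exact w.ne_zero
    have h1 : ∀ s : ZMod p, tau (io p F w) (sig ε (io p F s) (X 3)) =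
        C ((io p F w) ^ 3) * sig ε (io p F (s * (w⁻¹ : (ZMod p)ˣ))) (X 3) := by
      intro s
      have := sig_tau ε (io p F (s * (w⁻¹ : (ZMod p)ˣ))) (io p F w) (X 3)
      rw [← map_mul] at this
      have e : (w : ZMod p) * (s * (w⁻¹ : (ZMod p)ˣ)) = s := by
        rw [mul_comm, mul_assoc, Units.inv_mul, mul_one]
      rw [e] at this
      rw [← this, tau_X, map_mul, sig_C]; rfl
    rw [Nn, map_prod, Finset.prod_congr rfl fun s _ => h1 s, Finset.prod_mul_distrib,
      Finset.prod_const, Finset.card_univ, ZMod.card, ← map_pow]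
    congr 1
    · congr 1
      rw [← map_pow, ← map_pow, ZMod.pow_card]
    · exact Fintype.prod_equiv (Units.mulRight (w⁻¹)) _ _ (fun s => rfl)
  have hpr : proj p 3 (Nn p ε) = Nn p ε := by
    rw [proj_apply]
    have : ∀ w : (ZMod p)ˣ, (io p F w) ^ ((p - 2) * 3) • tau (io p F w) (Nn p ε) = Nn p ε := by
      intro w
      rw [h, smul_eq_C_mul, ← mul_assoc, ← C_mul, ← pow_add]
      have e : (p - 2) * 3 + 3 = (p - 1) * 3 := by
        have := (Fact.out : p.Prime).two_le; omega
      rw [e, ← map_pow, pow_mul, ZMod.pow_card_sub_one_eq_one w.ne_zero]; simp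
    rw [Finset.sum_congr rfl fun w _ => this w, Finset.sum_const, Finset.card_univ,
      ZMod.card_units]
    have h2 : ((p - 1 : ℕ) : RR F) = -1 := by
      rw [Nat.cast_sub (Fact.out : p.Prime).one_le]; simp
    rw [nsmul_eq_mul, h2]; ring
  rw [← hpr]; exact Cl_proj _ _

lemma ex_mon (j a b c : ℕ) : Ex w1 (mon p F j a b c) ((p * j + a + 2 * b + p * c : ℕ) : ℤ) := by
  have := ((((ex_Nn (p := p) (0 : F)).pow j).mul ((ex_w1_X (F := F) 1).pow a)).mul (ex_xi.pow b)).mul ((ex_be (p := p) (F := F)).pow c)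
  have e : ((p * j + a + 2 * b + p * c : ℕ) : ℤ) = j * p + a * 1 + b * 2 + c * p := by push_cast; ring
  rw [e]; exact this

lemma cl_mon (j a b c : ℕ) : Cl p (3 * j + a + 4 * b + 2 * c) (mon p F j a b c) := by
  have := ((((cl_Nn (p := p) (0 : F)).pow j).mul ((Cl.X (p := p) (F := F) 1).pow a)).mul (cl_xi.pow b)).mul ((cl_be (p := p) (F := F)).pow c)
  have e : j * 3 + a * ((1 : Fin 4) : ℕ) + b * 4 + c * 2 = 3 * j + a + 4 * b + 2 * c := by simp; ring
  rw [e] at this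
  exact this

lemma span_cl {S : Set (RR F)} {g : ℕ} {y : RR F} (hS : ∀ m ∈ S, ∃ k, Cl p k m) (hy : y ∈ Submodule.span F S)
    (hg : Cl p g y) : y ∈ Submodule.span F {m | m ∈ S ∧ Cl p g m} := by
  have h2 := Submodule.mem_map_of_mem (f := proj p g) hy
  rw [Submodule.map_span, proj_eq_self hg] at h2
  refine Submodule.span_le.mpr ?_ h2
  rintro _ ⟨m, hm, rfl⟩
  obtain ⟨k, hk⟩ := hS m hm
  by_cases h : k ≡ g [MOD (p - 1)]
  · rw [proj_eq_self (hk.congr h)]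
    exact Submodule.subset_span ⟨hm, hk.congr h⟩
  · rw [proj_of_ne hk h]; exact Submodule.zero_mem _

lemma mon_ne_zero (hp : 3 < p) (j a b c : ℕ) : mon p F j a b c ≠ 0 := by
  have h1 : mon p F 0 0 1 0 ≠ 0 := by
    intro h
    have := coeff_lead (p := p) (F := F) 1 0 hp
    rw [h, map_zero] at this
    have h3 : (C (3 ^ 1) : RR F) ≠ 0 := by simpa using three_ne (F := F) hp
    exact mul_ne_zero h3 (pow_ne_zero _ (X_ne_zero 2)) this.symm
  have h2 : mon p F 0 0 0 1 ≠ 0 := by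
    intro h
    have := coeff_lead (p := p) (F := F) 0 1 hp
    rw [h, map_zero] at this
    have h3 : (C (3 ^ 0) : RR F) ≠ 0 := by simp
    exact mul_ne_zero h3 (pow_ne_zero _ (X_ne_zero 2)) this.symm
  simp only [mon, pow_zero, pow_one, one_mul, mul_one] at h1 h2 ⊢
  exact mul_ne_zero (mul_ne_zero (mul_ne_zero (pow_ne_zero _ (Nn_ne_zero 0)) (pow_ne_zero _ (X_ne_zero 1)))
    (pow_ne_zero _ h1)) (pow_ne_zero _ h2)

lemma cl_unique {f : RR F} (hf : f ≠ 0) {g k : ℕ} (h1 : Cl p g f) (h2 : Cl p k f) : g ≡ k [MOD (p - 1)] := by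
  obtain ⟨d, hd⟩ := MvPolynomial.ne_zero_iff.mp hf
  exact (h1 d hd).symm.trans (h2 d hd)

lemma Sy.spanCl (hp : 3 < p) (n g : ℕ) {y : RR F} (hy : Sy p n y) (hg : Cl p g y) :
    y ∈ Submodule.span F {m | ∃ a b c, a + 2 * b + p * c = n ∧ a + 4 * b + 2 * c ≡ g [MOD (p - 1)] ∧
      m = mon p F 0 a b c} := by
  have := span_cl (p := p) (g := g) (by
    rintro m ⟨a, b, c, _, rfl⟩
    exact ⟨_, cl_mon 0 a b c⟩) (hy.span hp) hg
  refine Submodule.span_mono ?_ this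
  rintro m ⟨⟨a, b, c, h, rfl⟩, hm⟩
  refine ⟨a, b, c, h, ?_, rfl⟩
  have := cl_unique (mon_ne_zero hp 0 a b c) (cl_mon 0 a b c) hm
  simpa using this

end s2sec

/-- homogeneous component -/
def hcomp {F : Type} [Field F] (n : ℕ) : RR F →ₗ[F] RR F := homogeneousComponent n

section s3sec
variable {p : ℕ} [Fact p.Prime] {F : Type} [Field F] [CharP F p]

lemma degree_eq (d : Fin 4 →₀ ℕ) : d.degree = d 0 + d 1 + d 2 + d 3 := by
  rw [Finsupp.degree_eq_sum, Fin.sum_univ_four]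

lemma coeff_hcomp (n : ℕ) (d : Fin 4 →₀ ℕ) (f : RR F) :
    coeff d (hcomp n f) = if d 0 + d 1 + d 2 + d 3 = n then coeff d f else 0 := by
  rw [hcomp, coeff_homogeneousComponent, degree_eq]

lemma Ex_hcomp (n : ℕ) (f : RR F) : Ex w1 (hcomp n f) n := by
  intro d hd
  rw [coeff_hcomp] at hd
  rw [wgt_w1]
  by_contra h
  apply hd; rw [if_neg]; intro h'; apply h; simp only [Set.mem_singleton_iff]; exact_mod_cast h'

lemma Sp.hcomp {w : Fin 4 → ℤ} {S : Set ℤ} {f : RR F} (hf : Sp w S f) (n : ℕ) :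
    Sp w S (hcomp n f) := by
  intro d hd
  rw [coeff_hcomp] at hd
  apply hf
  intro h; apply hd; rw [h]; simp

lemma Cl.hcomp {g : ℕ} {f : RR F} (hf : Cl p g f) (n : ℕ) : Cl p g (hcomp n f) := by
  intro d hd
  rw [coeff_hcomp] at hd
  apply hf
  intro h; apply hd; rw [h]; simp

lemma hcomp_eq_self {n : ℕ} {f : RR F} (hf : Ex w1 f n) : hcomp n f = f := by
  ext d
  rw [coeff_hcomp]
  split_ifs with h
  · rfl
  · by_contra hne
    have := hf d (Ne.symm hne)
    rw [wgt_w1] at this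
    simp only [Set.mem_singleton_iff] at this
    omega

lemma hcomp_of_ne {n : ℕ} {m : ℤ} {f : RR F} (hf : Ex w1 f m) (hm : m ≠ n) : hcomp n f = 0 := by
  ext d
  rw [coeff_hcomp]
  split_ifs with h
  · by_contra hne
    have := hf d hne
    rw [wgt_w1] at this
    simp only [Set.mem_singleton_iff] at this
    apply hm; rw [← this, ← h]; push_cast; ring
  · simp

lemma sum_hcomp (f : RR F) : ∑ i ∈ Finset.range (f.totalDegree + 1), hcomp i f = f :=
  sum_homogeneousComponent f

lemma hcomp_mul {m : ℕ} {f : RR F} (hf : Ex w1 f m) (k : ℕ) (h : RR F) :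
    hcomp (m + k) (f * h) = f * hcomp k h := by
  classical
  conv_lhs => rw [← sum_hcomp h, Finset.mul_sum, map_sum]
  have h1 : ∀ i, hcomp (m + k) (f * hcomp i h) = if i = k then f * hcomp k h else 0 := by
    intro i
    have h2 : Ex w1 (f * hcomp i h) ((m + i : ℕ) : ℤ) := by
      push_cast; exact hf.mul (Ex_hcomp i h)
    split_ifs with hi
    · subst hi; exact hcomp_eq_self h2
    · apply hcomp_of_ne h2; exact_mod_cast (by omega)
  rw [Finset.sum_congr rfl fun i _ => h1 i, Finset.sum_ite_eq']
  split_ifs with hk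
  · rfl
  · simp only [Finset.mem_range, not_lt] at hk
    have : hcomp k h = 0 := homogeneousComponent_eq_zero k h (by omega)
    rw [this, mul_zero]

lemma hcomp_mul_lt {m : ℕ} {f : RR F} (hf : Ex w1 f m) (k : ℕ) (hk : k < m) (h : RR F) :
    hcomp k (f * h) = 0 := by
  ext d
  rw [coeff_hcomp]
  split_ifs with h1
  · rw [coeff_mul, coeff_zero]
    apply Finset.sum_eq_zero
    rintro ⟨a, b⟩ hab
    have hab : a + b = d := Finset.HasAntidiagonal.mem_antidiagonal.mp hab
    by_contra hne
    have h2 := hf a (left_ne_zero_of_mul hne)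
    rw [wgt_w1] at h2
    simp only [Set.mem_singleton_iff] at h2
    have this : ∀ i, a i + b i = d i := fun i => DFunLike.congr_fun hab i
    have t0 := this 0
    have t1 := this 1
    have t2 := this 2
    have t3 := this 3
    omega
  · simp

lemma Ex.div {m n : ℕ} {f h : RR F} (hf0 : f ≠ 0) (hf : Ex w1 f m) (hfh : Ex w1 (f * h) ((m + n : ℕ) : ℤ)) :
    Ex w1 h n := by
  have := hcomp_mul hf n h
  rw [hcomp_eq_self hfh] at this
  rw [mul_left_cancel₀ hf0 this]
  exact Ex_hcomp n h

lemma proj_mul {m : ℕ} {f : RR F} (hf : Cl p m f) (k : ℕ) (h : RR F) :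
    proj p (m + k) (f * h) = f * proj p k h := by
  classical
  conv_lhs => rw [← sum_proj (p := p) h, Finset.mul_sum, map_sum]
  have h1 : ∀ i, proj p (m + k) (f * proj p i h) = if i ≡ k [MOD (p - 1)] then f * proj p i h else 0 := by
    intro i
    have h2 : Cl p (m + i) (f * proj p i h) := hf.mul (Cl_proj i h)
    split_ifs with hi
    · exact proj_eq_self (h2.congr (Nat.ModEq.add_left m hi))
    · apply proj_of_ne h2
      intro h3; exact hi (Nat.ModEq.add_left_cancel' m h3)
  rw [Finset.sum_congr rfl fun i _ => h1 i]
  have h4 : ∀ i, (if i ≡ k [MOD (p - 1)] then f * proj p i h else 0) = f * proj p k (proj p i h) := by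
    intro i
    split_ifs with hi
    · rw [proj_eq_self ((Cl_proj i h).congr hi)]
    · rw [proj_of_ne (Cl_proj i h) hi, mul_zero]
  rw [Finset.sum_congr rfl fun i _ => h4 i, ← Finset.mul_sum, ← map_sum, sum_proj]

lemma Cl.div {m k : ℕ} {f h : RR F} (hf0 : f ≠ 0) (hf : Cl p m f) (hfh : Cl p (m + k) (f * h)) :
    Cl p k h := by
  have := proj_mul hf k h
  rw [proj_eq_self hfh] at this
  rw [mul_left_cancel₀ hf0 this]
  exact Cl_proj k h

lemma hcomp_hom {θ : RR F →ₐ[F] RR F} (hθ : ∀ i, Ex w1 (θ (X i)) 1) (n : ℕ) (f : RR F) :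
    hcomp n (θ f) = θ (hcomp n f) := by
  classical
  conv_lhs => rw [← sum_hcomp f, map_sum, map_sum]
  have h1 : ∀ i, hcomp n (θ (hcomp i f)) = if i = n then θ (hcomp n f) else 0 := by
    intro i
    have h2 : Ex w1 (θ (hcomp i f)) i := Ex.hom θ (by
      intro i; have : w1 i = 1 := by fin_cases i <;> rfl
      rw [this]; exact hθ i) (Ex_hcomp i f)
    split_ifs with hi
    · subst hi; exact hcomp_eq_self h2
    · apply hcomp_of_ne h2; exact_mod_cast hi
  rw [Finset.sum_congr rfl fun i _ => h1 i, Finset.sum_ite_eq']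
  split_ifs with hk
  · rfl
  · simp only [Finset.mem_range, not_lt] at hk
    have : hcomp n f = 0 := homogeneousComponent_eq_zero n f (by omega)
    rw [this, map_zero]

lemma hcomp_kill (S : Finset (Fin 4)) (n : ℕ) (f : RR F) : kill S (hcomp n f) = hcomp n (kill S f) := by
  ext d
  rw [coeff_kill, coeff_hcomp, coeff_hcomp, coeff_kill]
  split_ifs <;> rfl

lemma hcomp_proj (g n : ℕ) (f : RR F) : proj p g (hcomp n f) = hcomp n (proj p g f) := by
  ext d
  rw [coeff_proj, coeff_hcomp, coeff_hcomp, coeff_proj]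
  split_ifs <;> rfl

lemma PInv_hcomp {ε : F} {f : RR F} (hf : PInv p ε f) (n : ℕ) : PInv p ε (hcomp n f) := by
  intro s
  rw [← hcomp_hom (fun i => ex_w1_sig ε _ (ex_w1_X i)), hf s]

/-- graded division by the norm -/
lemma Nn_div_graded (ε : F) {f : RR F} (hf : PInv p ε f) {n g : ℕ} (hn : Ex w1 f ((p + n : ℕ) : ℤ))
    (hg : Cl p (3 + g) f) :
    ∃ x Y : RR F, f = x + Nn p ε * Y ∧ Le w3 x (p - 1) ∧ PInv p ε x ∧ PInv p ε Y ∧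
      Ex w1 x ((p + n : ℕ) : ℤ) ∧ Cl p (3 + g) x ∧ Ex w1 Y n ∧ Cl p g Y := by
  obtain ⟨x, Y, h, hx, ix, iY⟩ := Nn_div_inv ε hf
  refine ⟨proj p (3 + g) (hcomp (p + n) x), proj p g (hcomp n Y), ?_, Sp.proj (hx.hcomp _) _,
    PInv_proj (PInv_hcomp ix _) _, PInv_proj (PInv_hcomp iY _) _, Sp.proj (Ex_hcomp _ _) _,
    Cl_proj _ _, Sp.proj (Ex_hcomp _ _) _, Cl_proj _ _⟩
  rw [← proj_mul (cl_Nn ε), ← hcomp_mul (ex_Nn ε), ← map_add, ← map_add, ← h, hcomp_eq_self hn,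
    proj_eq_self hg]

lemma le3_of_ex {f : RR F} {n : ℤ} (h : Ex w1 f n) : Le w3 f n := by
  intro d hd
  have := h d hd
  rw [wgt_w1] at this
  simp only [Set.mem_singleton_iff, Set.mem_Iic, wgt_w3] at *
  omega

/-- `3β² = ξ((ξ/3)^q - a₁^{p-1})² + N h`. -/
lemma relation (hp : 3 < p) : ∃ h ∈ Submodule.span F {m | ∃ a b c, a + 2 * b + p * c = p ∧
      a + 4 * b + 2 * c ≡ 1 [MOD (p - 1)] ∧ m = mon p F 0 a b c},
    3 * be p F ^ 2 = xipoly F * ((C (1 / 3) * xipoly F) ^ ((p - 1) / 2) - X 1 ^ (p - 1)) ^ 2 +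
      Nn p 0 * h := by
  have hpodd : p % 2 = 1 := by
    have := (Fact.out : p.Prime).eq_two_or_odd; omega
  obtain ⟨q, hq⟩ : ∃ q, p = 2 * q + 1 := ⟨p / 2, by omega⟩
  have hq' : (p - 1) / 2 = q := by omega
  have e3 : (3 : RR F) = C 3 := (map_ofNat C 3).symm
  rw [hq']
  set T := 3 * be p F ^ 2 - xipoly F * ((C (1 / 3) * xipoly F) ^ q - X 1 ^ (p - 1)) ^ 2 with hT
  have iT : PInv p 0 T := by
    rw [hT, e3]
    exact ((PInv_be.pow 2).C_mul 3).sub (PInv_xi.mul ((((PInv_xi.C_mul _).pow q).sub (PInv_X1.pow _)).pow 2))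
  have kT : kill {3} T = 0 := by
    have h1 : kill {3} (xipoly F) = C 3 * X 2 ^ 2 := by
      simp [xipoly, kill_X, map_ofNat]
    have h2 : kill {3} (be p F) = X 2 * (X 2 ^ (2 * q) - X 1 ^ (2 * q)) := by
      have hq1 : p - 1 = 2 * q := by omega
      rw [be, hq1]
      conv_lhs => rw [hq]
      simp [kill_X]; ring
    rw [hT, e3]
    simp only [map_sub, map_mul, map_pow, h1, h2, kill_C, kill_X]
    rw [← mul_assoc, ← C_mul, one_div_mul_cancel (three_ne hp), if_neg (by decide)]
    have hq1 : p - 1 = 2 * q := by omega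
    rw [hq1, C_1, one_mul, ← pow_mul]; ring
  have eT : Ex w1 T ((p + p : ℕ) : ℤ) := by
    rw [hT, e3]
    have a1 : Ex w1 (C 3 * be p F ^ 2) ((p + p : ℕ) : ℤ) := by
      refine Sp.C_mul _ ?_
      have := (ex_be (p := p) (F := F)).pow 2
      convert this using 2; push_cast; ring
    have a2 : Ex w1 ((C (1 / 3) * xipoly F) ^ q) ((p : ℤ) - 1) := by
      have := Ex.pow (Sp.C_mul (1 / 3) (ex_xi (F := F))) q
      convert this using 2; omega
    have a3 : Ex w1 (X 1 ^ (p - 1) : RR F) ((p : ℤ) - 1) := by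
      have := (ex_w1_X (F := F) 1).pow (p - 1)
      convert this using 2; omega
    have a4 := ex_xi.mul (Ex.pow (a2.sub a3) 2)
    refine a1.sub ?_
    convert a4 using 2; push_cast; ring
  have cT : Cl p (3 + 1) T := by
    rw [hT, e3]
    have a1 : Cl p 4 (C 3 * be p F ^ 2) := (Cl.C 3).mul (cl_be.pow 2)
    have a2 : Cl p 0 ((C (1 / 3) * xipoly F) ^ q) := (((Cl.C _).mul cl_xi).pow q).congr (by
      have : q * (0 + 4) = (p - 1) * 2 := by omega
      rw [this]; simp [Nat.ModEq])
    have a3 : Cl p 0 (X 1 ^ (p - 1) : RR F) := ((Cl.X 1).pow (p - 1)).congr (by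
      show (p - 1) * 1 ≡ 0 [MOD p - 1]
      simp [Nat.ModEq])
    exact a1.sub (cl_xi.mul ((a2.sub a3).pow 2))
  have lT : Le w3 T ((p : ℤ) + 0) := by
    rw [hT, e3]
    have a1 : Le w3 (C 3 * be p F ^ 2) ((p : ℤ) + 0) := by
      refine Sp.C_mul _ ((le3_be.pow 2).mono ?_); omega
    have a2 : Le w3 ((C (1 / 3) * xipoly F) ^ q) q := by
      have := Le.pow (Sp.C_mul (1 / 3) (le3_xi (F := F))) q
      simpa using this
    have a3 : Le w3 (X 1 ^ (p - 1) : RR F) q := by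
      have h1 : Le w3 (X 1 : RR F) 0 := le_w3_X 1 (by decide)
      exact (h1.pow _).mono (by simp)
    refine a1.sub ((le3_xi.mul (Le.pow (a2.sub a3) 2)).mono ?_)
    push_cast; omega
  obtain ⟨h, hh⟩ := Nn_dvd (three_ne hp) iT kT
  have hN := Nn_ne_zero (p := p) (0 : F)
  refine ⟨h, ?_, by rw [← hh, hT]; ring⟩
  rw [hh] at eT cT lT iT
  refine Sy.spanCl hp p 1 ⟨?_, Ex.div hN (ex_Nn 0) eT, ?_, ?_⟩ (Cl.div hN (cl_Nn 0) cT)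
  · apply mul_left_cancel₀ hN
    conv_lhs => rw [← kill_Nn0, ← map_mul, ← hh]
    rw [← hh, hT]
    simp only [map_sub, map_mul, map_pow, kill0_xi, kill0_be, kill_C, kill_X, map_ofNat]
    simp
  · intro s
    apply mul_left_cancel₀ hN
    have := iT s
    rwa [map_mul, PInv_Nn] at this
  · exact (Nn_mul_le 0 h 0 lT).mono (by omega)

end s3sec

section badsec
variable {p : ℕ} [Fact p.Prime] {F : Type} [Field F] [CharP F p]

lemma cast_ne {k : ℕ} (h0 : 0 < k) (hk : k < p) : (k : F) ≠ 0 := by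
  intro h
  have := Nat.le_of_dvd h0 ((CharP.cast_eq_zero_iff F p k).mp h)
  omega

lemma fact_ne {k : ℕ} (hk : k < p) : ((k.factorial : ℕ) : F) ≠ 0 := by
  intro h
  have := (CharP.cast_eq_zero_iff F p _).mp h
  have := ((Fact.out : p.Prime).dvd_factorial).mp this
  omega

lemma diag_coeff (W : MvPolynomial (Fin 2) F) (h : pderiv 0 W + pderiv 1 W = 0) (m : ℕ) (hm : m < p) :
    coeff (Finsupp.single 0 m) W = (-1) ^ m * coeff (Finsupp.single 1 m) W := by
  have step : ∀ k i : ℕ, coeff (Finsupp.single 0 (k + 1) + Finsupp.single 1 i) W * (k + 1) =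
      - (coeff (Finsupp.single 0 k + Finsupp.single 1 (i + 1)) W * (i + 1)) := by
    intro k i
    have h1 := congrArg (coeff (Finsupp.single 0 k + Finsupp.single 1 i)) h
    rw [coeff_add, coeff_pderiv, coeff_pderiv] at h1
    have e1 : Finsupp.single (0 : Fin 2) k + Finsupp.single 1 i + Finsupp.single 0 1 =
      Finsupp.single 0 (k + 1) + Finsupp.single 1 i := by
      ext j; fin_cases j <;> simp
    have e2 : Finsupp.single (0 : Fin 2) k + Finsupp.single 1 i + Finsupp.single 1 1 =
      Finsupp.single 0 k + Finsupp.single 1 (i + 1) := by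
      ext j; fin_cases j <;> simp
    rw [e1, e2, coeff_zero] at h1
    have v0 : (Finsupp.single 0 k + Finsupp.single 1 i : Fin 2 →₀ ℕ) 0 = k := by simp
    have v1 : (Finsupp.single 0 k + Finsupp.single 1 i : Fin 2 →₀ ℕ) 1 = i := by simp
    rw [v0, v1] at h1
    linear_combination h1
  have main : ∀ k ≤ m, (k.factorial : F) * coeff (Finsupp.single 0 k + Finsupp.single 1 (m - k)) W =
      (-1) ^ k * (m.descFactorial k : F) * coeff (Finsupp.single 1 m) W := by
    intro k hk
    induction k with
    | zero => simp
    | succ k ih =>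
      have h1 := ih (by omega)
      have h2 := step k (m - (k + 1))
      have e : m - (k + 1) + 1 = m - k := by omega
      rw [e] at h2
      have e2 : ((m - (k + 1) : ℕ) : F) + 1 = ((m - k : ℕ) : F) := by
        rw [← e]; push_cast; rfl
      rw [e2] at h2
      rw [Nat.factorial_succ, Nat.descFactorial_succ]
      push_cast
      linear_combination (k.factorial : F) * h2 - ((m - k : ℕ) : F) * h1
  have h1 := main m le_rfl
  simp [Nat.descFactorial_self] at h1
  apply mul_left_cancel₀ (fact_ne (F := F) hm)
  rw [h1]; ring

lemma coeff_rest0 (W : MvPolynomial (Fin 2) F) (k : ℕ) :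
    (aeval ![Polynomial.X, (0 : Polynomial F)] W).coeff k = coeff (Finsupp.single 0 k) W := by
  classical
  induction W using MvPolynomial.induction_on' with
  | monomial d c =>
    rw [aeval_monomial, coeff_monomial, Finsupp.prod_fintype _ _ (by simp), Fin.prod_univ_two]
    simp only [Polynomial.algebraMap_eq, Polynomial.coeff_C_mul, Matrix.cons_val_zero, Matrix.cons_val_one]
    by_cases h1 : d 1 = 0
    · by_cases h0 : d 0 = k
      · rw [if_pos]
        · simp [h1, h0]
        · ext j; fin_cases j <;> simp [h1, h0]
      · rw [if_neg]
        · simp [h1, Polynomial.coeff_X_pow, Ne.symm h0]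
        · rintro rfl; simp at h0
    · rw [if_neg]
      · simp [h1]
      · rintro rfl; simp at h1
  | add f g hf hg => simp [hf, hg]

lemma coeff_rest1 (W : MvPolynomial (Fin 2) F) (k : ℕ) :
    (aeval ![(0 : Polynomial F), Polynomial.X] W).coeff k = coeff (Finsupp.single 1 k) W := by
  classical
  induction W using MvPolynomial.induction_on' with
  | monomial d c =>
    rw [aeval_monomial, coeff_monomial, Finsupp.prod_fintype _ _ (by simp), Fin.prod_univ_two]
    simp only [Polynomial.algebraMap_eq, Polynomial.coeff_C_mul, Matrix.cons_val_zero, Matrix.cons_val_one]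
    by_cases h1 : d 0 = 0
    · by_cases h0 : d 1 = k
      · rw [if_pos]
        · simp [h1, h0]
        · ext j; fin_cases j <;> simp [h1, h0]
      · rw [if_neg]
        · simp [h1, Polynomial.coeff_X_pow, Ne.symm h0]
        · rintro rfl; simp at h0
    · rw [if_neg]
      · simp [h1]
      · rintro rfl; simp at h1
  | add f g hf hg => simp [hf, hg]

/-- bivariate path -/
def psi (F : Type) [Field F] : RR F →ₐ[F] MvPolynomial (Fin 2) F :=
  aeval ![1, C (1 / 3) * (X 1 + 2 * X 0), C (1 / 3) * (2 * X 0 * X 1 + X 0 ^ 2 - 1),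
    X 1 * (X 0 ^ 2 - 1)]

/-- restriction `z = 0` -/
def pG (F : Type) [Field F] : RR F →ₐ[F] Polynomial F :=
  aeval ![1, Polynomial.C (2 / 3) * Polynomial.X, Polynomial.C (1 / 3) * (Polynomial.X ^ 2 - 1), 0]

/-- restriction `s = 0` -/
def pH (F : Type) [Field F] : RR F →ₐ[F] Polynomial F :=
  aeval ![1, Polynomial.C (1 / 3) * Polynomial.X, Polynomial.C (- (1 / 3)), - Polynomial.X]

lemma psi_deriv (hp : 3 < p) (f : RR F) :
    pderiv 0 (psi F f) + pderiv 1 (psi F f) = psi F (Eder 1 f) := by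
  have h3 := three_ne (F := F) hp
  have c3 : (C (1 / 3) * 3 : MvPolynomial (Fin 2) F) = 1 := by
    have : (3 : MvPolynomial (Fin 2) F) = C 3 := (map_ofNat C 3).symm
    rw [this, ← C_mul, one_div_mul_cancel h3, C_1]
  induction f using MvPolynomial.induction_on with
  | C a => rw [algHom_C, algebraMap_eq, pderiv_C, pderiv_C]
           have : Eder (1 : F) (C a) = 0 := (Eder 1).map_algebraMap a
           rw [this]; simp
  | add f g hf hg => rw [map_add, map_add, map_add, map_add, map_add, ← hf, ← hg]; ring
  | mul_X f i hf =>
    have k2 : ∀ j : Fin 2, pderiv j (2 : MvPolynomial (Fin 2) F) = 0 := by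
      intro j
      have : (2 : MvPolynomial (Fin 2) F) = C 2 := (map_ofNat C 2).symm
      rw [this, pderiv_C]
    have hX : pderiv 0 (psi F (X i)) + pderiv 1 (psi F (X i)) = psi F (Eder 1 (X i)) := by
      fin_cases i
      · simp [psi, Eder_X0]
      · simp only [Fin.mk_one, Eder_X1]
        simp [psi, pderiv_X, k2, Pi.single_apply]
        rw [← one_div]
        linear_combination c3
      · simp only [Fin.reduceFinMk, Eder_X2]
        simp [psi, pderiv_X, k2, Pi.single_apply, map_ofNat]
        ring
      · simp only [Fin.reduceFinMk, Eder_X3]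
        simp [psi, pderiv_X, k2, Pi.single_apply, map_ofNat]
        rw [← one_div]
        linear_combination (-2 * X 0 * X 1 - X 0 ^ 2 + 1) * c3
    rw [map_mul, pderiv_mul, pderiv_mul, Derivation.leibniz]
    simp only [smul_eq_mul, map_add, map_mul]
    linear_combination psi F (X i) * hf + psi F f * hX

lemma pG_eq (f : RR F) : pG F f = aeval ![Polynomial.X, (0 : Polynomial F)] (psi F f) := by
  have : pG F = (aeval ![Polynomial.X, (0 : Polynomial F)]).comp (psi F) := by
    apply MvPolynomial.algHom_ext
    intro i
    fin_cases i
    · simp [pG, psi]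
    · simp [pG, psi, map_ofNat, MvPolynomial.algHom_C, Polynomial.algebraMap_eq]
      have : (2 : Polynomial F) = Polynomial.C 2 := (map_ofNat Polynomial.C 2).symm
      rw [this, ← mul_assoc, ← Polynomial.C_mul]; congr 2; ring
    · simp [pG, psi, map_ofNat, MvPolynomial.algHom_C, Polynomial.algebraMap_eq]
    · simp [pG, psi]
  exact DFunLike.congr_fun this f

lemma pH_eq (f : RR F) : pH F f = aeval ![(0 : Polynomial F), Polynomial.X] (psi F f) := by
  have : pH F = (aeval ![(0 : Polynomial F), Polynomial.X]).comp (psi F) := by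
    apply MvPolynomial.algHom_ext
    intro i
    fin_cases i
    · simp [pH, psi]
    · simp [pH, psi, map_ofNat, MvPolynomial.algHom_C, Polynomial.algebraMap_eq]
    · simp [pH, psi, map_ofNat, MvPolynomial.algHom_C, Polynomial.algebraMap_eq]
    · simp [pH, psi]
  exact DFunLike.congr_fun this f

lemma pGH (hp : 3 < p) {f : RR F} (hf : Eder 1 f = 0) (k : ℕ) (hk : k < p) :
    (pG F f).coeff k = (-1) ^ k * (pH F f).coeff k := by
  rw [pG_eq, pH_eq, coeff_rest0, coeff_rest1]
  apply diag_coeff _ _ k hk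
  rw [psi_deriv hp, hf, map_zero]

/-- the functional `coeff (p-1)` kills derivatives -/
lemma J_byparts (U Q : Polynomial F) (k : ℕ) :
    (Polynomial.derivative^[k] U * Q).coeff (p - 1) =
      (-1) ^ k * (U * Polynomial.derivative^[k] Q).coeff (p - 1) := by
  have hJ : ∀ f : Polynomial F, (Polynomial.derivative f).coeff (p - 1) = 0 := by
    intro f
    rw [Polynomial.coeff_derivative]
    have h1 := (Fact.out : p.Prime).one_le
    have : ((p - 1 : ℕ) : F) + 1 = ((p - 1 + 1 : ℕ) : F) := by push_cast; rfl
    rw [this, Nat.sub_add_cancel h1]; simp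
  induction k generalizing Q with
  | zero => simp
  | succ k ih =>
    rw [Function.iterate_succ_apply', Function.iterate_succ_apply]
    have h1 := hJ (Polynomial.derivative^[k] U * Q)
    rw [Polynomial.derivative_mul, Polynomial.coeff_add] at h1
    rw [ih] at h1
    rw [pow_succ]
    linear_combination h1

lemma J_case (a b : ℕ) (hab : a < 2 * b) (hq : 2 * a + 2 * b + 3 ≤ p) (G Q : Polynomial F)
    (hG : G = (Polynomial.X ^ 2 - 1) ^ (2 * b) * Q) (hQ : Q.natDegree ≤ a)
    (hG0 : ∀ k, a + 2 * b < k → k < p → G.coeff k = 0) : G.coeff (a + 2 * b) = 0 := by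
  set P : Polynomial F := Polynomial.X ^ 2 - 1 with hP
  have hPm : P.Monic := by rw [hP]; exact Polynomial.monic_X_pow_sub_C 1 (by norm_num)
  have hPd : P.natDegree = 2 := by rw [hP]; exact Polynomial.natDegree_X_pow_sub_C
  set e := p - 2 - 2 * a - 2 * b with he
  set U := P ^ (2 * b + a + 1) * Polynomial.X ^ e with hU
  have hUm : U.Monic := (hPm.pow _).mul (Polynomial.monic_X_pow _)
  have hUd : U.natDegree = p + 2 * b := by
    rw [hU, (hPm.pow _).natDegree_mul (Polynomial.monic_X_pow _), hPm.natDegree_pow, hPd,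
      Polynomial.natDegree_X_pow]; omega
  obtain ⟨ρ, hρ⟩ : P ^ (2 * b) ∣ Polynomial.derivative^[a + 1] U := by
    have := Polynomial.pow_sub_dvd_iterate_derivative_of_pow_dvd (p := U) (q := P) (n := 2 * b + a + 1) (a + 1) (Dvd.intro _ rfl)
    have e : 2 * b + a + 1 - (a + 1) = 2 * b := by omega
    rwa [e] at this
  have hPb : (P ^ (2 * b)).Monic := hPm.pow _
  have hPbd : (P ^ (2 * b)).natDegree = 4 * b := by rw [hPm.natDegree_pow, hPd]; omega
  have hdD : (Polynomial.derivative^[a + 1] U).natDegree ≤ p + 2 * b - (a + 1) := by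
    refine (Polynomial.natDegree_iterate_derivative _ _).trans ?_
    rw [hUd]
  have hρd : ρ.natDegree ≤ p - 1 - (a + 2 * b) := by
    rw [hρ] at hdD
    by_cases h0 : ρ = 0
    · simp [h0]
    · rw [hPb.natDegree_mul' h0, hPbd] at hdD
      omega
  have hJ1 : (ρ * G).coeff (p - 1) = 0 := by
    have : ρ * G = Polynomial.derivative^[a + 1] U * Q := by rw [hρ, hG]; ring
    rw [this, J_byparts, Polynomial.iterate_derivative_eq_zero (by omega)]; simp
  have hJ2 : (ρ * G).coeff (p - 1) = ρ.coeff (p - 1 - (a + 2 * b)) * G.coeff (a + 2 * b) := by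
    rw [Polynomial.coeff_mul, Finset.sum_eq_single (p - 1 - (a + 2 * b), a + 2 * b)]
    · rintro ⟨i, j⟩ hij hne
      have hij : i + j = p - 1 := Finset.HasAntidiagonal.mem_antidiagonal.mp hij
      by_cases hi : i ≤ p - 1 - (a + 2 * b)
      · have : j ≠ a + 2 * b := by
          rintro rfl
          apply hne; ext <;> simp; omega
        rw [hG0 j (by omega) (by omega), mul_zero]
      · rw [Polynomial.coeff_eq_zero_of_natDegree_lt (by omega), zero_mul]
    · intro h; exact absurd (Finset.HasAntidiagonal.mem_antidiagonal.mpr (by simp; omega)) h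
  have hlead : ρ.coeff (p - 1 - (a + 2 * b)) ≠ 0 := by
    have h1 : (Polynomial.derivative^[a + 1] U).coeff (p + 2 * b - (a + 1)) = ρ.coeff (p - 1 - (a + 2 * b)) := by
      rw [hρ]
      have e : p + 2 * b - (a + 1) = 4 * b + (p - 1 - (a + 2 * b)) := by omega
      rw [e]
      have := Polynomial.coeff_mul_add_eq_of_natDegree_le hPbd.le hρd
      rw [this]
      have h2 : (P ^ (2 * b)).coeff (4 * b) = 1 := by rw [← hPbd]; exact hPb.coeff_natDegree
      rw [h2, one_mul]
    rw [← h1, Polynomial.coeff_iterate_derivative]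
    have e : p + 2 * b - (a + 1) + (a + 1) = p + 2 * b := by omega
    rw [e]
    have h2 : U.coeff (p + 2 * b) = 1 := by rw [← hUd]; exact hUm.coeff_natDegree
    rw [h2, nsmul_eq_mul, mul_one]
    intro h
    have h3 := (CharP.cast_eq_zero_iff F p _).mp h
    rw [Nat.descFactorial_eq_prod_range] at h3
    obtain ⟨i, hi, hd⟩ := (Prime.dvd_finset_prod_iff (Fact.out : p.Prime).prime _).mp h3
    simp only [Finset.mem_range] at hi
    have e : p + 2 * b - i = p + (2 * b - i) := by omega
    rw [e, Nat.dvd_add_right (dvd_refl p)] at hd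
    have := Nat.le_of_dvd (by omega) hd
    omega
  rw [hJ2] at hJ1
  exact (mul_eq_zero.mp hJ1).resolve_left hlead

end badsec

section badsec
variable {p : ℕ} [Fact p.Prime] {F : Type} [Field F] [CharP F p]

/-- the second path -/
def pP (F : Type) [Field F] : RR F →ₐ[F] Polynomial F :=
  aeval ![1, Polynomial.X + 2, Polynomial.C (1 / 3) * (3 * Polynomial.X ^ 2 + 12 * Polynomial.X + 8),
    Polynomial.X * (Polynomial.X + 2) * (Polynomial.X + 4)]

lemma pP_deriv (hp : 3 < p) (f : RR F) :
    Polynomial.derivative (pP F f) = pP F (Eder 1 f) := by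
  have h3 := three_ne (F := F) hp
  have c3 : (Polynomial.C (1 / 3) * 3 : Polynomial F) = 1 := by
    have : (3 : Polynomial F) = Polynomial.C 3 := (map_ofNat Polynomial.C 3).symm
    rw [this, ← Polynomial.C_mul, one_div_mul_cancel h3, Polynomial.C_1]
  induction f using MvPolynomial.induction_on with
  | C a => rw [algHom_C]
           have : Eder (1 : F) (C a) = 0 := (Eder 1).map_algebraMap a
           rw [this]; simp
  | add f g hf hg => rw [map_add, map_add, map_add, map_add, ← hf, ← hg]
  | mul_X f i hf =>
    have hX : Polynomial.derivative (pP F (X i)) = pP F (Eder 1 (X i)) := by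
      fin_cases i
      · simp [pP, Eder_X0]
      · simp only [Fin.mk_one, Eder_X1]
        simp [pP]
      · simp only [Fin.reduceFinMk, Eder_X2]
        simp [pP, map_ofNat]
        rw [← one_div]
        linear_combination (2 * Polynomial.X + 4) * c3
      · simp only [Fin.reduceFinMk, Eder_X3]
        simp [pP, map_ofNat]
        rw [← one_div]
        linear_combination (- (3 * Polynomial.X ^ 2 + 12 * Polynomial.X + 8)) * c3
    rw [map_mul, Polynomial.derivative_mul, hf, hX, Derivation.leibniz, map_add, smul_eq_mul,
      smul_eq_mul, map_mul, map_mul]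
    ring

lemma pP_zero (hp : 3 < p) (f : RR F) : (pP F f).eval 0 = (pG F f).eval 3 := by
  have h3 := three_ne (F := F) hp
  have : (Polynomial.aeval (0 : F)).comp (pP F) = (Polynomial.aeval (3 : F)).comp (pG F) := by
    apply MvPolynomial.algHom_ext
    intro i
    fin_cases i <;> simp [pP, pG, map_ofNat]
    · field_simp
    · left; norm_num
  simpa [Polynomial.aeval_def, Polynomial.eval₂_eq_eval_map] using DFunLike.congr_fun this f

lemma pP_neg (hp : 3 < p) (f : RR F) : (pP F f).eval (-4) = (pG F f).eval (-3) := by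
  have h3 := three_ne (F := F) hp
  have : (Polynomial.aeval (-4 : F)).comp (pP F) = (Polynomial.aeval (-3 : F)).comp (pG F) := by
    apply MvPolynomial.algHom_ext
    intro i
    fin_cases i <;> simp [pP, pG, map_ofNat]
    · field_simp; norm_num
    · left; norm_num
  simpa [Polynomial.aeval_def, Polynomial.eval₂_eq_eval_map] using DFunLike.congr_fun this f

lemma pG_factor (a b : ℕ) (f : RR F) (h1 : Ex w1 f ((a + 2 * b : ℕ) : ℤ)) (hg : Ex wg f ((a + 4 * b : ℕ) : ℤ)) :
    ∃ Q : Polynomial F, pG F f = (Polynomial.X ^ 2 - 1) ^ (2 * b) * Q ∧ Q.natDegree ≤ a ∧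
      Q.comp (- Polynomial.X) = (-1) ^ a * Q := by
  have key : ∀ d : Fin 4 →₀ ℕ, ∃ Q : Polynomial F, d ∈ f.support →
      pG F (monomial d (coeff d f)) = (Polynomial.X ^ 2 - 1) ^ (2 * b) * Q ∧ Q.natDegree ≤ a ∧
      Q.comp (- Polynomial.X) = (-1) ^ a * Q := by
    intro d
    by_cases hd : d ∈ f.support
    swap
    · exact ⟨0, fun h => absurd h hd⟩
    have e1 := h1 d (by simpa using hd)
    have e2 := hg d (by simpa using hd)
    rw [wgt_w1] at e1
    rw [wgt_wg, gr] at e2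
    simp only [Set.mem_singleton_iff] at e1 e2
    by_cases hd3 : d 3 = 0
    swap
    · refine ⟨0, fun _ => ⟨?_, by simp, by simp⟩⟩
      rw [pG, aeval_monomial, Finsupp.prod_fintype _ _ (by simp), Fin.prod_univ_four]
      simp [hd3]
    have k2 : d 2 = 2 * b + d 0 := by push_cast at e1 e2; omega
    have k1 : d 1 + 2 * d 0 = a := by push_cast at e1 e2; omega
    refine ⟨Polynomial.C (coeff d f) * ((Polynomial.C (2 / 3) * Polynomial.X) ^ d 1 *
      (Polynomial.C (1 / 3) ^ d 2 * (Polynomial.X ^ 2 - 1) ^ d 0)), fun _ => ⟨?_, ?_, ?_⟩⟩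
    · rw [pG, aeval_monomial, Finsupp.prod_fintype _ _ (by simp), Fin.prod_univ_four]
      simp only [Matrix.cons_val_zero, Matrix.cons_val_one, Matrix.cons_val, hd3, mul_pow, k2,
        one_pow, pow_zero, Polynomial.algebraMap_eq, pow_add]
      ring
    · have : (Polynomial.X ^ 2 - 1 : Polynomial F).natDegree ≤ 2 := by compute_degree
      have hh : (Polynomial.C (2 / 3 : F) * Polynomial.X).natDegree ≤ 1 := by compute_degree
      have q1 : ((Polynomial.C (2 / 3 : F) * Polynomial.X) ^ d 1).natDegree ≤ d 1 * 1 :=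
        Polynomial.natDegree_pow_le_of_le _ hh
      have q2 : ((Polynomial.X ^ 2 - 1 : Polynomial F) ^ d 0).natDegree ≤ d 0 * 2 :=
        Polynomial.natDegree_pow_le_of_le _ this
      have q3 : (Polynomial.C (1 / 3 : F) ^ d 2).natDegree = 0 := by
        rw [← Polynomial.C_pow]; exact Polynomial.natDegree_C _
      refine (Polynomial.natDegree_C_mul_le _ _).trans ?_
      refine Polynomial.natDegree_mul_le.trans ?_
      have := Polynomial.natDegree_mul_le (p := Polynomial.C (1 / 3 : F) ^ d 2)
        (q := (Polynomial.X ^ 2 - 1 : Polynomial F) ^ d 0)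
      omega
    · simp only [Polynomial.mul_comp, Polynomial.pow_comp, Polynomial.C_comp, Polynomial.X_comp,
        Polynomial.sub_comp, Polynomial.one_comp, neg_sq]
      have : ((-1 : Polynomial F)) ^ a = (-1) ^ d 1 := by
        rw [← k1, pow_add, pow_mul]; simp
      rw [this, mul_neg, neg_pow]
      ring
  choose Q hQ using key
  refine ⟨∑ d ∈ f.support, Q d, ?_, ?_, ?_⟩
  · conv_lhs => rw [f.as_sum]
    rw [map_sum, Finset.mul_sum]
    exact Finset.sum_congr rfl fun d hd => (hQ d hd).1
  · exact Polynomial.natDegree_sum_le_of_forall_le _ _ fun d hd => (hQ d hd).2.1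
  · rw [Polynomial.sum_comp, Finset.mul_sum]
    exact Finset.sum_congr rfl fun d hd => (hQ d hd).2.2

lemma ex_wg_xi : Ex wg (xipoly F) 4 := by
  unfold xipoly
  have h2 : (3 : RR F) = C 3 := (map_ofNat C 3).symm
  have h4 : (4 : RR F) = C 4 := (map_ofNat C 4).symm
  have x1 : Ex wg (X 1 : RR F) 1 := Sp.X 1 (by simp [wg])
  have x2 : Ex wg (X 2 : RR F) 2 := Sp.X 2 (by simp [wg])
  have x3 : Ex wg (X 3 : RR F) 3 := Sp.X 3 (by simp [wg])
  rw [h2, h4]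
  refine Sp.sub (Sp.C_mul _ (by simpa using Ex.pow x2 2)) ?_
  rw [mul_assoc]
  exact Sp.C_mul _ (by simpa using Ex.mul x3 x1)

lemma pH_coeff (hp : 3 < p) (a b : ℕ) (hd : 0 < a + 2 * b) (c : F) (f : RR F) (h1 : Ex w1 f ((a + 2 * b : ℕ) : ℤ))
    (hk : kill {0} f = C c * (X 1 ^ a * xipoly F ^ b)) :
    (pH F f).natDegree ≤ a + 2 * b ∧ (pH F f).coeff (a + 2 * b) = c * ((1 / 3) ^ a * (4 / 3) ^ b) := by
  have h3 := three_ne (F := F) hp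
  have bound : ∀ (g : RR F) (n : ℕ), Ex w1 g (n : ℤ) → (pH F g).natDegree ≤ n := by
    intro g n hg
    refine natDegree_aeval_le _ w1 ?_ g n (Ex.le hg le_rfl)
    intro i
    fin_cases i <;> simp [w1]
    exact (Polynomial.natDegree_C_mul_le _ _).trans Polynomial.natDegree_X_le
  refine ⟨bound f _ h1, ?_⟩
  obtain ⟨r, hr⟩ := X_dvd_sub_kill 0 f
  have hr1 : Ex w1 (X 0 * r) ((a + 2 * b : ℕ) : ℤ) := by
    rw [← hr]; exact Sp.sub h1 (Sp.kill h1 _)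
  have hr2 : Ex w1 r ((a + 2 * b - 1 : ℕ) : ℤ) := by
    have := ex_of_X_mul 0 hr1
    have e : ((a + 2 * b - 1 : ℕ) : ℤ) = ((a + 2 * b : ℕ) : ℤ) - w1 0 := by simp [w1]; omega
    rw [e]; exact this
  have e : f = kill {0} f + X 0 * r := by rw [← hr]; ring
  rw [e, hk, map_add, Polynomial.coeff_add]
  have z : (pH F (X 0 * r)).coeff (a + 2 * b) = 0 := by
    have : pH F (X 0 * r) = pH F r := by rw [map_mul]; simp [pH]
    rw [this]
    apply Polynomial.coeff_eq_zero_of_natDegree_lt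
    have := bound r _ hr2
    omega
  rw [z, add_zero]
  have hξ : pH F (xipoly F) = Polynomial.C (4 / 3) * Polynomial.X ^ 2 + Polynomial.C (1 / 3) := by
    have e1 : Polynomial.C (4 / 3 : F) = 4 * Polynomial.C (1 / 3) := by
      rw [show (4 : Polynomial F) = Polynomial.C 4 from (map_ofNat Polynomial.C 4).symm, ← Polynomial.C_mul]; congr 1; ring
    have e2 : (3 * Polynomial.C (1 / 3) : Polynomial F) = 1 := by
      rw [show (3 : Polynomial F) = Polynomial.C 3 from (map_ofNat Polynomial.C 3).symm, ← Polynomial.C_mul,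
        mul_one_div_cancel h3, Polynomial.C_1]
    rw [e1]
    simp only [pH, xipoly, map_sub, map_mul, map_pow, map_ofNat, aeval_X, Matrix.cons_val, Polynomial.C_neg]
    linear_combination (Polynomial.C (1 / 3)) * e2
  have hX1 : pH F (X 1) = Polynomial.C (1 / 3) * Polynomial.X := by simp [pH]
  rw [map_mul, map_mul, map_pow, map_pow, hξ, hX1]
  have hC : pH F (C c) = Polynomial.C c := by simp [pH]
  rw [hC, Polynomial.coeff_C_mul]
  congr 1
  have d1 : (Polynomial.C (1 / 3 : F) * Polynomial.X).natDegree ≤ 1 := by compute_degree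
  have d2 : (Polynomial.C (4 / 3 : F) * Polynomial.X ^ 2 + Polynomial.C (1 / 3)).natDegree ≤ 2 := by compute_degree
  have q1 : ((Polynomial.C (1 / 3 : F) * Polynomial.X) ^ a).natDegree ≤ a * 1 :=
    Polynomial.natDegree_pow_le_of_le _ d1
  have q2 : ((Polynomial.C (4 / 3 : F) * Polynomial.X ^ 2 + Polynomial.C (1 / 3)) ^ b).natDegree ≤ b * 2 :=
    Polynomial.natDegree_pow_le_of_le _ d2
  have e3 : a + 2 * b = a * 1 + b * 2 := by ring
  rw [e3, Polynomial.coeff_mul_add_eq_of_natDegree_le q1 q2, Polynomial.coeff_pow_of_natDegree_le d1,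
    Polynomial.coeff_pow_of_natDegree_le d2]
  congr 2 <;> simp [Polynomial.coeff_C]

lemma bad_core (hp : 3 < p) (a b : ℕ) (hq : 2 * a + 2 * b + 3 ≤ p) (hab : a < 2 * b ∨ a = 2 * b + 1) (c : F)
    (f : RR F) (h1 : Ex w1 f ((a + 2 * b : ℕ) : ℤ)) (hg : Ex wg f ((a + 4 * b : ℕ) : ℤ))
    (hk : kill {0} f = C c * (X 1 ^ a * xipoly F ^ b)) (hE : Eder 1 f = 0) : c = 0 := by
  have h3 := three_ne (F := F) hp
  have h2 := two_ne (F := F) hp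
  obtain ⟨hd, hc⟩ := pH_coeff hp a b (by omega) c f h1 hk
  obtain ⟨Q, hQ1, hQ2, hQ3⟩ := pG_factor a b f h1 hg
  have hz : ∀ k, a + 2 * b < k → k < p → (pG F f).coeff k = 0 := by
    intro k hk1 hk2
    rw [pGH hp hE k hk2, Polynomial.coeff_eq_zero_of_natDegree_lt (by omega), mul_zero]
  suffices hs : (pG F f).coeff (a + 2 * b) = 0 by
    rw [pGH hp hE _ (by omega), hc] at hs
    have k1 : ((1 / 3 : F) ^ a * (4 / 3) ^ b) ≠ 0 := by
      have : (4 : F) ≠ 0 := by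
        have : (4 : F) = 2 * 2 := by norm_num
        rw [this]; exact mul_ne_zero h2 h2
      exact mul_ne_zero (pow_ne_zero _ (one_div_ne_zero h3)) (pow_ne_zero _ (div_ne_zero this h3))
    have k2 : ((-1 : F)) ^ (a + 2 * b) ≠ 0 := pow_ne_zero _ (by simp)
    rcases mul_eq_zero.mp hs with h | h
    · exact absurd h k2
    · exact (mul_eq_zero.mp h).resolve_right k1
  rcases hab with hab | hab
  · exact J_case a b hab hq _ Q hQ1 hQ2 hz
  have hpP : pP F f = Polynomial.C ((pP F f).coeff 0) := by
    apply const_of_deriv (p := p)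
    · rw [pP_deriv hp, hE, map_zero]
    · have : (pP F f).natDegree ≤ a + 4 * b := by
        refine natDegree_aeval_le _ wg ?_ f _ (Ex.le hg le_rfl)
        intro i
        fin_cases i <;> simp only [wg, Fin.zero_eta, Fin.mk_one, Fin.reduceFinMk, Matrix.cons_val] 
        · simp
        · exact_mod_cast (by compute_degree : (Polynomial.X + 2 : Polynomial F).natDegree ≤ 1)
        · exact_mod_cast (by compute_degree : (Polynomial.C (1 / 3) * (3 * Polynomial.X ^ 2 + 12 * Polynomial.X + 8) : Polynomial F).natDegree ≤ 2)
        · exact_mod_cast (by compute_degree : (Polynomial.X * (Polynomial.X + 2) * (Polynomial.X + 4) : Polynomial F).natDegree ≤ 3)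
      omega
  have hev : (pG F f).eval 3 = (pG F f).eval (-3) := by
    rw [← pP_zero hp, ← pP_neg hp, hpP]; simp
  have hpar : ∀ x : F, Q.eval (-x) = - Q.eval x := by
    intro x
    have := congrArg (Polynomial.eval x) hQ3
    have ho : ((-1 : Polynomial F)) ^ a = -1 := Odd.neg_one_pow ⟨b, by omega⟩
    rw [ho] at this
    simpa [Polynomial.eval_comp] using this
  have hQ30 : Q.eval 3 = 0 := by
    rw [hQ1] at hev
    simp only [Polynomial.eval_mul, Polynomial.eval_pow, Polynomial.eval_sub, Polynomial.eval_X, Polynomial.eval_one,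
      hpar, neg_sq] at hev
    have h8 : ((3 : F) ^ 2 - 1) ^ (2 * b) ≠ 0 := by
      apply pow_ne_zero
      have : (3 : F) ^ 2 - 1 = 2 * 2 * 2 := by norm_num
      rw [this]; exact mul_ne_zero (mul_ne_zero h2 h2) h2
    have : (2 * ((3 : F) ^ 2 - 1) ^ (2 * b)) * Q.eval 3 = 0 := by linear_combination hev
    rcases mul_eq_zero.mp this with h | h
    · exact absurd h (mul_ne_zero h2 h8)
    · exact h
  have hGd : (pG F f).natDegree ≤ a + 2 * b := by
    have hM : (pG F f).natDegree ≤ a + 4 * b := by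
      refine natDegree_aeval_le _ wg ?_ f _ (Ex.le hg le_rfl)
      intro i
      fin_cases i <;> simp only [wg, Fin.zero_eta, Fin.mk_one, Fin.reduceFinMk, Matrix.cons_val] 
      · simp
      · exact_mod_cast (by compute_degree : (Polynomial.C (2 / 3) * Polynomial.X : Polynomial F).natDegree ≤ 1)
      · exact_mod_cast (by compute_degree : (Polynomial.C (1 / 3) * (Polynomial.X ^ 2 - 1) : Polynomial F).natDegree ≤ 2)
      · simp
    rw [Polynomial.natDegree_le_iff_coeff_eq_zero]
    intro k hk
    by_cases h : k < p
    · exact hz k hk h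
    · exact Polynomial.coeff_eq_zero_of_natDegree_lt (by omega)
  have hmon : (Polynomial.X ^ 2 - 1 : Polynomial F).Monic := by monicity!
  have hmd : (Polynomial.X ^ 2 - 1 : Polynomial F).natDegree = 2 := by compute_degree!
  have hQd : Q.natDegree ≤ 1 := by
    by_cases hQ0 : Q = 0
    · simp [hQ0]
    have := (hmon.pow (2 * b)).natDegree_mul' hQ0
    rw [← hQ1, hmon.natDegree_pow, hmd] at this
    omega
  have hQl := Polynomial.eq_X_add_C_of_natDegree_le_one hQd
  have e1 : Q.coeff 1 * 3 + Q.coeff 0 = 0 := by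
    have := hQ30; rw [hQl] at this; simpa using this
  have e2 : Q.coeff 0 = 0 := by
    have := hpar 0
    rw [hQl] at this; simp at this
    have h : 2 * Q.coeff 0 = 0 := by linear_combination this
    simpa [h2] using h
  have e3 : Q.coeff 1 = 0 := by
    rw [e2, add_zero] at e1; simpa [h3] using e1
  have : Q = 0 := by rw [hQl, e2, e3]; simp
  rw [hQ1, this]; simp

lemma bad (hp : 3 < p) (a b : ℕ) (hq : 2 * a + 2 * b + 3 ≤ p) (hab : a < 2 * b ∨ a = 2 * b + 1) (c : F)
    (f : RR F) (hf : PInv p 1 f) (h1 : Ex w1 f ((a + 2 * b : ℕ) : ℤ)) (hg : Cl p (a + 4 * b) f)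
    (hk : kill {0} f = C c * (X 1 ^ a * xipoly F ^ b)) : c = 0 := by
  have hE1 : Ex wg (C c * (X 1 ^ a * xipoly F ^ b)) ((a + 4 * b : ℕ) : ℤ) := by
    have x1 : Ex wg (X 1 : RR F) 1 := Sp.X 1 (by simp [wg])
    have := Ex.mul (Ex.pow x1 a) (Ex.pow (ex_wg_xi (F := F)) b)
    have e : ((a + 4 * b : ℕ) : ℤ) = a * 1 + b * 4 := by push_cast; ring
    rw [e]; exact Sp.C_mul _ this
  refine bad_core hp a b hq hab c (gcomp (a + 4 * b) f) (Sp.gcomp h1 _) (Ex_gcomp _ _) ?_ ?_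
  · rw [kill_gcomp, hk, gcomp_eq_self hE1]
  · refine topE (f := f) (f' := f - gcomp (a + 4 * b) f) 1 (by ring) (Ex_gcomp _ _) ?_ ?_
    · intro d hd
      rw [coeff_sub, coeff_gcomp] at hd
      split_ifs at hd with h
      · simp at hd
      · rw [sub_zero] at hd
        have k1 := h1 d hd
        have k2 := hg d hd
        rw [wgt_w1] at k1
        rw [wgt_wg]
        simp only [Set.mem_singleton_iff, Set.mem_Iic] at k1 ⊢
        have hgr : gr d ≤ 3 * (a + 2 * b) := by unfold gr; omega
        rcases lt_or_gt_of_ne h with h' | h'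
        · have := modEq_gap k2 h'
          push_cast; omega
        · have := modEq_gap k2.symm h'
          omega
    · have := hf 1
      simpa using this

end badsec

/-- exponents which occur -/
def Cond (p a b c : ℕ) : Prop := 1 ≤ c ∨ p - 1 ≤ 2 * (a + b) ∨ (2 * b ≤ a ∧ a ≠ 2 * b + 1)

/-- admissible monomials -/
def Tset (p : ℕ) [Fact p.Prime] (F : Type) [Field F] [CharP F p] (n g : ℕ) : Set (RR F) :=
  {m | ∃ j a b c, p * j + a + 2 * b + p * c = n ∧ 3 * j + a + 4 * b + 2 * c ≡ g [MOD (p - 1)] ∧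
    Cond p a b c ∧ m = mon p F j a b c}

section claimsec
variable {p : ℕ} [Fact p.Prime] {F : Type} [Field F] [CharP F p]

lemma p_odd (hp : 3 < p) : p % 2 = 1 := by
  rcases (Fact.out : p.Prime).eq_two_or_odd with h | h <;> omega

lemma cond_auto (hp : 3 < p) {a b c n : ℕ} (h : a + 2 * b + p * c = n) (hn : p ≤ n + 2) : Cond p a b c := by
  have := p_odd hp
  unfold Cond
  rcases Nat.eq_zero_or_pos c with rfl | hc
  · right; left; simp at h; omega
  · left; omega

lemma claimI_base (hp : 3 < p) (n g : ℕ) {x : RR F} (hx : PInv p 1 x) (h1 : Ex w1 x (n : ℤ)) (hg : Cl p g x)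
    (hl : Le w3 x (p - 1)) : kill {0} x ∈ Submodule.span F (Tset p F n g) := by
  have hodd := p_odd hp
  have hS : Sy p n (kill {0} x) := ⟨by rw [kill_kill]; rfl, Sp.kill h1 _, hx.kill, Sp.kill hl _⟩
  have hsp := Sy.spanCl hp n g hS (hg.kill _)
  by_cases hn : p ≤ n + 2
  · refine Submodule.span_mono ?_ hsp
    rintro m ⟨a, b, c, h, h', rfl⟩
    exact ⟨0, a, b, c, by simpa using h, by simpa using h', cond_auto hp h hn, rfl⟩
  · by_cases he : ∃ a b, a + 2 * b = n ∧ a + 4 * b ≡ g [MOD (p - 1)]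
    · obtain ⟨a, b, hab, habg⟩ := he
      have hsub : {m | ∃ a b c, a + 2 * b + p * c = n ∧ a + 4 * b + 2 * c ≡ g [MOD (p - 1)] ∧ m = mon p F 0 a b c}
          ⊆ {mon p F 0 a b 0} := by
        rintro m ⟨a', b', c', h, h', rfl⟩
        have hc : c' = 0 := by
          rcases Nat.eq_zero_or_pos c' with h | h
          · exact h
          · nlinarith
        subst hc
        simp only [mul_zero, add_zero] at h h'
        have hh : a' + 4 * b' ≡ a + 4 * b [MOD (p - 1)] := h'.trans habg.symm
        have e1 : a' + 4 * b' = n + 2 * b' := by omega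
        have e2 : a + 4 * b = n + 2 * b := by omega
        rw [e1, e2] at hh
        have hb : b' = b := by
          rcases lt_trichotomy b' b with h | h | h
          · have := modEq_gap hh (by omega); omega
          · exact h
          · have := modEq_gap hh.symm (by omega); omega
        have ha : a' = a := by omega
        subst hb ha; rfl
      have hsp2 := Submodule.span_mono hsub hsp
      rw [Submodule.mem_span_singleton] at hsp2
      obtain ⟨c, hc⟩ := hsp2
      by_cases hC : Cond p a b 0
      · rw [← hc]
        apply Submodule.smul_mem
        exact Submodule.subset_span ⟨0, a, b, 0, by simpa using hab, by simpa using habg, hC, rfl⟩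
      · unfold Cond at hC
        push Not at hC
        have hm : mon p F 0 a b 0 = X 1 ^ a * xipoly F ^ b := by simp [mon]
        have : c = 0 := by
          refine bad hp a b (by omega) (by by_contra h; push Not at h; have := hC.2.2; omega) c x hx (by rw [hab]; exact h1)
            (hg.congr habg.symm) ?_
          rw [← hc, hm, smul_eq_C_mul]
        rw [← hc, this, zero_smul]; exact Submodule.zero_mem _
    · have : {m | ∃ a b c, a + 2 * b + p * c = n ∧ a + 4 * b + 2 * c ≡ g [MOD (p - 1)] ∧ m = mon p F 0 a b c} = ∅ := by
        rw [Set.eq_empty_iff_forall_notMem]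
        rintro m ⟨a', b', c', h, h', rfl⟩
        have hc : c' = 0 := by
          rcases Nat.eq_zero_or_pos c' with h | h
          · exact h
          · nlinarith
        subst hc
        exact he ⟨a', b', by simpa using h, by simpa using h'⟩
      rw [this, Submodule.span_empty, Submodule.mem_bot] at hsp
      rw [hsp]; exact Submodule.zero_mem _

lemma claimI (hp : 3 < p) (n : ℕ) : ∀ (g : ℕ) {f : RR F} (hf : PInv p 1 f) (h1 : Ex w1 f (n : ℤ)) (hg : Cl p g f),
    kill {0} f ∈ Submodule.span F (Tset p F n g) := by
  induction n using Nat.strong_induction_on with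
  | _ n ih =>
    intro g f hf h1 hg
    by_cases hn : n < p
    · exact claimI_base hp n g hf h1 hg ((le3_of_ex h1).mono (by omega))
    · obtain ⟨n', rfl⟩ : ∃ n', n = p + n' := ⟨n - p, by omega⟩
      have hg' : Cl p (3 + (g + 3 * (p - 1) - 3)) f := by
        refine hg.congr ?_
        have : 3 + (g + 3 * (p - 1) - 3) = g + 3 * (p - 1) := by omega
        rw [this]
        exact (Nat.modEq_iff_dvd' (by omega)).mpr (by simp)
      have hgg : 3 + (g + 3 * (p - 1) - 3) ≡ g [MOD (p - 1)] := by
        have : 3 + (g + 3 * (p - 1) - 3) = g + 3 * (p - 1) := by omega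
        rw [this]
        exact ((Nat.modEq_iff_dvd' (by omega)).mpr (by simp)).symm
      obtain ⟨x, Y, rfl, hx, hxP, hYP, hx1, hxc, hY1, hYc⟩ := Nn_div_graded 1 hf h1 hg'
      rw [map_add, map_mul, kill_Nn]
      apply Submodule.add_mem
      · exact claimI_base hp _ g hxP hx1 (hxc.congr hgg) hx
      · have := ih n' (by omega) _ hYP hY1 hYc
        generalize kill {0} Y = Z at this
        induction this using Submodule.span_induction with
        | mem m hm =>
          obtain ⟨j, a, b, c, h, h', hC, rfl⟩ := hm
          refine Submodule.subset_span ⟨j + 1, a, b, c, by rw [← h]; ring, ?_, hC, by unfold mon; ring⟩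
          have : 3 * (j + 1) + a + 4 * b + 2 * c = 3 + (3 * j + a + 4 * b + 2 * c) := by ring
          rw [this]
          exact (Nat.ModEq.add_left 3 h').trans hgg
        | zero => simp
        | add u v _ _ hu hv => rw [mul_add]; exact Submodule.add_mem _ hu hv
        | smul r u _ hu => rw [mul_smul_comm]; exact Submodule.smul_mem _ _ hu

end claimsec

section actsec
variable {p : ℕ} [Fact p.Prime] {F : Type} [Field F] [CharP F p]

abbrev Uu {p : ℕ} (s : ZMod p) : Matrix (Fin 2) (Fin 2) (ZMod p) := !![1, s; 0, 1]
abbrev Lw {p : ℕ} (s : ZMod p) : Matrix (Fin 2) (Fin 2) (ZMod p) := !![1, 0; s, 1]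
abbrev Et (p : ℕ) : Matrix (Fin 2) (Fin 2) (ZMod p) := !![0, 1; -1, 0]

lemma act_X0 (g : Matrix (Fin 2) (Fin 2) (ZMod p)) : act p F g (X 0) =
    C (io p F (g 1 1)) ^ 3 * X 0 + 3 * C (io p F (g 1 1)) ^ 2 * C (io p F (g 1 0)) * X 1
      + 3 * C (io p F (g 1 1)) * C (io p F (g 1 0)) ^ 2 * X 2 + C (io p F (g 1 0)) ^ 3 * X 3 := by
  simp [act, io]
lemma act_X1 (g : Matrix (Fin 2) (Fin 2) (ZMod p)) : act p F g (X 1) =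
    C (io p F (g 1 1)) ^ 2 * C (io p F (g 0 1)) * X 0
      + (C (io p F (g 1 1)) ^ 2 * C (io p F (g 0 0)) + 2 * C (io p F (g 1 1)) * C (io p F (g 0 1)) * C (io p F (g 1 0))) * X 1
      + (2 * C (io p F (g 1 1)) * C (io p F (g 1 0)) * C (io p F (g 0 0)) + C (io p F (g 0 1)) * C (io p F (g 1 0)) ^ 2) * X 2
      + C (io p F (g 1 0)) ^ 2 * C (io p F (g 0 0)) * X 3 := by
  simp [act, io]
lemma act_X2 (g : Matrix (Fin 2) (Fin 2) (ZMod p)) : act p F g (X 2) =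
    C (io p F (g 1 1)) * C (io p F (g 0 1)) ^ 2 * X 0
      + (2 * C (io p F (g 1 1)) * C (io p F (g 0 1)) * C (io p F (g 0 0)) + C (io p F (g 0 1)) ^ 2 * C (io p F (g 1 0))) * X 1
      + (C (io p F (g 1 1)) * C (io p F (g 0 0)) ^ 2 + 2 * C (io p F (g 0 1)) * C (io p F (g 1 0)) * C (io p F (g 0 0))) * X 2
      + C (io p F (g 1 0)) * C (io p F (g 0 0)) ^ 2 * X 3 := by
  simp [act, io]
lemma act_X3 (g : Matrix (Fin 2) (Fin 2) (ZMod p)) : act p F g (X 3) =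
    C (io p F (g 0 1)) ^ 3 * X 0 + 3 * C (io p F (g 0 1)) ^ 2 * C (io p F (g 0 0)) * X 1
      + 3 * C (io p F (g 0 1)) * C (io p F (g 0 0)) ^ 2 * X 2 + C (io p F (g 0 0)) ^ 3 * X 3 := by
  simp [act, io]

lemma act_C (g : Matrix (Fin 2) (Fin 2) (ZMod p)) (c : F) : act p F g (C c) = C c := by
  rw [algHom_C]; rfl

lemma act_mul (g h : Matrix (Fin 2) (Fin 2) (ZMod p)) (f : RR F) :
    act p F (g * h) f = act p F h (act p F g f) := by
  have : act p F (g * h) = (act p F h).comp (act p F g) := by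
    apply MvPolynomial.algHom_ext
    intro i
    fin_cases i
    all_goals
      simp only [Fin.zero_eta, Fin.mk_one, Fin.reduceFinMk, AlgHom.comp_apply, act_X0, act_X1, act_X2, act_X3,
        Matrix.mul_apply, Fin.sum_univ_two, map_add, map_mul, map_pow, act_C, map_ofNat]
      ring
  rw [this]; rfl

lemma act_U (s : ZMod p) (f : RR F) : act p F (Uu s) f = sig 1 (io p F s) f := by
  have : act p F (Uu s) = sig 1 (io p F s) := by
    apply MvPolynomial.algHom_ext
    intro i
    fin_cases i
    all_goals
      simp [act_X0, act_X1, act_X2, act_X3, sig_X0, sig_X1, sig_X2, sig_X3, Uu]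
    all_goals ring
  rw [this]

lemma act_one (f : RR F) : act p F 1 f = f := by
  have : (1 : Matrix (Fin 2) (Fin 2) (ZMod p)) = Uu 0 := by
    rw [Matrix.one_fin_two]
  rw [this, act_U, map_zero, sig_zero]

lemma Et_X0 : act p F (Et p) (X 0) = - X 3 := by rw [act_X0]; simp; ring
lemma Et_X1 : act p F (Et p) (X 1) = X 2 := by rw [act_X1]; simp
lemma Et_X2 : act p F (Et p) (X 2) = - X 1 := by rw [act_X2]; simp
lemma Et_X3 : act p F (Et p) (X 3) = X 0 := by rw [act_X3]; simp

lemma Et_inj : Function.Injective (act p F (Et p)) := by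
  intro f g h
  have h4 : Et p * (Et p * (Et p * Et p)) = 1 := by
    simp [Et, Matrix.one_fin_two]
  have k : ∀ f : RR F, act p F (Et p) (act p F (Et p) (act p F (Et p) (act p F (Et p) f))) = f := by
    intro f
    rw [← act_mul, ← act_mul, ← act_mul, h4, act_one]
  rw [← k f, ← k g, h]

lemma Et_Lw (t : ZMod p) : Et p * Lw t = Uu (-t) * Et p := by
  simp [Et, Lw, Uu]

lemma inv_of_gen {f : RR F} (h1 : act p F (Et p) f = f) (h2 : ∀ t, act p F (Uu t) f = f) : f ∈ invariants p F := by
  have hL : ∀ t, act p F (Lw t) f = f := by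
    intro t
    have := act_mul (F := F) (Et p) (Lw t) f
    rw [Et_Lw, act_mul, h2, h1] at this
    exact this.symm
  have key : ∀ g : Matrix (Fin 2) (Fin 2) (ZMod p), g.det = 1 → g 1 0 ≠ 0 → act p F g f = f := by
    intro g hd hc
    rw [Matrix.det_fin_two] at hd
    have : g = Uu ((g 0 0 - 1) / g 1 0) * Lw (g 1 0) * Uu ((g 1 1 - 1) / g 1 0) := by
      ext i j
      fin_cases i <;> fin_cases j <;> simp [Matrix.mul_apply, Fin.sum_univ_two]
      · field_simp; ring
      · field_simp; linear_combination -hd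
      · field_simp; ring
    rw [this, act_mul, act_mul, h2, hL, h2]
  intro g
  by_cases hc : g.1 1 0 = 0
  · apply Et_inj
    rw [← act_mul, h1]
    have hd := g.2
    rw [Matrix.det_fin_two, hc] at hd
    apply key
    · rw [Matrix.det_mul, g.2]; simp [Matrix.det_fin_two]
    · simp [Matrix.mul_apply, Fin.sum_univ_two, hc]
      intro h
      rw [h] at hd; simp at hd
  · exact key g.1 g.2 hc

lemma inv_of_gen' {f : RR F} (h1 : act p F (Et p) f = f) (h2 : ∀ t, act p F (Lw t) f = f) : f ∈ invariants p F := by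
  apply inv_of_gen h1
  intro t
  apply Et_inj
  rw [← act_mul, ← neg_neg t, ← Et_Lw, act_mul, h1, h2]

lemma inv_U {f : RR F} (h : f ∈ invariants p F) (t : ZMod p) : act p F (Uu t) f = f :=
  h ⟨Uu t, by simp [Matrix.det_fin_two]⟩

lemma inv_Et {f : RR F} (h : f ∈ invariants p F) : act p F (Et p) f = f :=
  h ⟨Et p, by simp [Matrix.det_fin_two]⟩

lemma inv_PInv {f : RR F} (h : f ∈ invariants p F) : PInv p 1 f := fun s => by
  rw [← act_U]; exact inv_U h s

lemma trG_inv (f : RR F) : trG p F f ∈ invariants p F := by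
  intro h
  rw [trG, map_sum]
  have : ∀ g : Matrix.SpecialLinearGroup (Fin 2) (ZMod p), act p F h.1 (act p F g.1 f) = act p F (g * h).1 f := by
    intro g
    rw [Matrix.SpecialLinearGroup.coe_mul, act_mul]
  simp_rw [this]
  exact Equiv.sum_comp (Equiv.mulRight h) (fun g : Matrix.SpecialLinearGroup (Fin 2) (ZMod p) => act p F g.1 f)

lemma trBG_Et {f : RR F} (hf : ∀ (w x : ZMod p), w ≠ 0 → act p F !![w, x; 0, w⁻¹] f = f) :
    act p F (Et p) (trBG p F f) = trBG p F f := by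
  have e2 : act p F (Et p) (act p F (Et p) f) = f := by
    rw [← act_mul]
    have : Et p * Et p = !![-1, 0; 0, (-1)⁻¹] := by simp [Et, inv_neg]
    rw [this]; exact hf _ _ (by simp)
  have l0 : act p F (Lw 0) f = f := by
    have : Lw (0 : ZMod p) = 1 := by rw [Matrix.one_fin_two]
    rw [this, act_one]
  have hs : ∀ s : ZMod p, s ≠ 0 → act p F (Et p) (act p F (Lw s) f) = act p F (Lw (- s⁻¹)) f := by
    intro s hs0
    rw [← act_mul]
    have : Lw s * Et p = !![s⁻¹, 1; 0, (s⁻¹)⁻¹] * Lw (- s⁻¹) := by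
      simp [Lw, Et, hs0]
    rw [this, act_mul, hf _ _ (inv_ne_zero hs0)]
  have h0 : trBG p F f = (∑ s : ZMod p, act p F (Lw s) f) + act p F (Et p) f := rfl
  rw [h0, map_add, map_sum, e2]
  generalize act p F (Et p) = E at *
  generalize hA : (fun s : ZMod p => act p F (Lw s) f) = A at *
  have hA' : ∀ s, act p F (Lw s) f = A s := fun s => by rw [← hA]
  simp only [hA'] at *
  rw [← Finset.add_sum_erase _ _ (Finset.mem_univ (0 : ZMod p)),
      ← Finset.add_sum_erase Finset.univ A (Finset.mem_univ (0 : ZMod p))]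
  have : ∑ s ∈ Finset.univ.erase (0 : ZMod p), E (A s) = ∑ s ∈ Finset.univ.erase (0 : ZMod p), A s := by
    refine Finset.sum_bij' (fun s _ => - s⁻¹) (fun s _ => - s⁻¹) ?_ ?_ ?_ ?_ ?_
    · intro s hs; simpa using hs
    · intro s hs; simpa using hs
    · intro s hs; simp [inv_neg]
    · intro s hs; simp [inv_neg]
    · intro s h
      exact hs s (by simpa using h)
  rw [this, l0]
  ring

lemma trBG_Lw {f : RR F} (hU : ∀ t, act p F (Uu t) f = f) (t : ZMod p) :
    act p F (Lw t) (trBG p F f) = trBG p F f := by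
  have h0 : trBG p F f = (∑ s : ZMod p, act p F (Lw s) f) + act p F (Et p) f := rfl
  have h1 : act p F (Lw t) (act p F (Et p) f) = act p F (Et p) f := by
    rw [← act_mul, Et_Lw, act_mul, hU]
  have h2 : ∀ s, act p F (Lw t) (act p F (Lw s) f) = act p F (Lw (s + t)) f := by
    intro s
    rw [← act_mul]
    have : Lw s * Lw t = Lw (s + t) := by simp [Lw]
    rw [this]
  rw [h0, map_add, map_sum, h1]
  simp_rw [h2]
  have h3 := Equiv.sum_comp (Equiv.addRight t) (fun s => act p F (Lw s) f)
  simp only [Equiv.coe_addRight] at h3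
  rw [h3]

lemma trBG_inv {f : RR F} (hf : ∀ (w x : ZMod p), w ≠ 0 → act p F !![w, x; 0, w⁻¹] f = f) :
    trBG p F f ∈ invariants p F :=
  inv_of_gen' (trBG_Et hf) (trBG_Lw fun t => by simpa using hf 1 t one_ne_zero)

lemma Npoly_eq : Npoly p F = Nn p 1 := by
  unfold Npoly Nn
  exact Finset.prod_congr rfl fun s _ => act_U s _

lemma act_b_X (w x : ZMod p) (hw : w ≠ 0) :
    act p F !![w, x; 0, w⁻¹] (X 0 : RR F) = C (io p F w⁻¹) ^ 3 * X 0 ∧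
    act p F !![w, x; 0, w⁻¹] (X 1 : RR F) = C (io p F w⁻¹) ^ 2 * (C (io p F x) * X 0 + C (io p F w) * X 1) ∧
    act p F !![w, x; 0, w⁻¹] (X 2 : RR F) = C (io p F w⁻¹) * (C (io p F x) ^ 2 * X 0 + 2 * C (io p F w) * C (io p F x) * X 1 + C (io p F w) ^ 2 * X 2) ∧
    act p F !![w, x; 0, w⁻¹] (X 3 : RR F) = C (io p F x) ^ 3 * X 0 + 3 * C (io p F x) ^ 2 * C (io p F w) * X 1
      + 3 * C (io p F x) * C (io p F w) ^ 2 * X 2 + C (io p F w) ^ 3 * X 3 := by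
  refine ⟨?_, ?_, ?_, ?_⟩
  · rw [act_X0]; simp
  · rw [act_X1]; simp; ring
  · rw [act_X2]; simp; ring
  · rw [act_X3]; simp

lemma io_inv_mul (w : ZMod p) (hw : w ≠ 0) : (C (io p F w⁻¹) * C (io p F w) : RR F) = 1 := by
  rw [← C_mul, ← map_mul, inv_mul_cancel₀ hw, map_one, C_1]

lemma act_b_d (w x : ZMod p) (hw : w ≠ 0) : act p F !![w, x; 0, w⁻¹] (dpoly F) = C (io p F w⁻¹) ^ 2 * dpoly F := by
  obtain ⟨e0, e1, e2, e3⟩ := act_b_X (F := F) w x hw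
  have h := io_inv_mul (F := F) w hw
  simp only [dpoly, map_sub, map_mul, map_pow, e0, e1, e2]
  generalize C (io p F w⁻¹) = v at *
  generalize C (io p F w) = u at *
  generalize C (io p F x) = y at *
  linear_combination (v ^ 2 * (v * u + 1) * (X 1 ^ 2 - X 0 * X 2)) * h

lemma act_b_e (w x : ZMod p) (hw : w ≠ 0) : act p F !![w, x; 0, w⁻¹] (epoly F) = C (io p F w⁻¹) ^ 3 * epoly F := by
  obtain ⟨e0, e1, e2, e3⟩ := act_b_X (F := F) w x hw
  have h := io_inv_mul (F := F) w hw
  have h3 : (C (io p F w⁻¹) * C (io p F w) : RR F) ^ 3 = 1 := by rw [h, one_pow]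
  simp only [epoly, map_sub, map_add, map_mul, map_pow, e0, e1, e2, e3, map_ofNat]
  generalize C (io p F w⁻¹) = v at *
  generalize C (io p F w) = u at *
  generalize C (io p F x) = y at *
  linear_combination (v ^ 3 * (2 * X 1 ^ 3 + X 0 * (X 3 * X 0 - 3 * X 2 * X 1))) * h3

lemma act_b_lin (w x s : ZMod p) (hw : w ≠ 0) : act p F !![w, x; 0, w⁻¹] (act p F (Uu s) (X 3)) =
      C (io p F w) ^ 3 * act p F (Uu (w⁻¹ * (w⁻¹ * s + x))) (X 3) := by
  rw [← act_mul, act_X3, act_X3]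
  have h := io_inv_mul (F := F) w hw
  simp only [Uu, Matrix.mul_apply, Fin.sum_univ_two, Matrix.of_apply, Matrix.cons_val', Matrix.cons_val_zero,
      Matrix.cons_val_one, Matrix.cons_val_fin_one, map_add, map_mul, map_one, map_zero, one_mul, mul_zero, add_zero, mul_one, C_1, one_pow]
  generalize C (io p F w⁻¹) = v at *
  generalize C (io p F w) = u at *
  generalize C (io p F x) = y at *
  generalize C (io p F s) = z at *
  have h2 : (v * u) ^ 2 = 1 := by rw [h, one_pow]
  have h3 : (v * u) ^ 3 = 1 := by rw [h, one_pow]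
  linear_combination (- (y + z * v) ^ 3 * X 0) * h3 - 3 * u * (y + z * v) ^ 2 * X 1 * h2 - 3 * u ^ 2 * (y + z * v) * X 2 * h

lemma act_b_N (w x : ZMod p) (hw : w ≠ 0) : act p F !![w, x; 0, w⁻¹] (Npoly p F) = C (io p F w) ^ 3 * Npoly p F := by
  have hcard : ∏ s : ZMod p, (C (io p F w) ^ 3 : RR F) = (C (io p F w) ^ 3 : RR F) := by
    rw [Finset.prod_const, Finset.card_univ, ZMod.card, ← pow_mul, mul_comm, pow_mul]
    congr 1
    rw [← C_pow, ← map_pow, ZMod.pow_card]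
  have hb : Function.Bijective (fun s : ZMod p => w⁻¹ * (w⁻¹ * s + x)) := by
    rw [Finite.injective_iff_bijective.symm]
    intro s t hst
    have hw' := inv_ne_zero hw
    have := mul_left_cancel₀ hw' hst
    exact mul_left_cancel₀ hw' (add_right_cancel this)
  have h2 := hb.prod_comp (fun s => act p F (Uu s) (X 3))
  calc act p F !![w, x; 0, w⁻¹] (Npoly p F) = ∏ s : ZMod p, act p F !![w, x; 0, w⁻¹] (act p F (Uu s) (X 3)) :=
        map_prod _ _ _
    _ = ∏ s : ZMod p, (C (io p F w) ^ 3 * act p F (Uu (w⁻¹ * (w⁻¹ * s + x))) (X 3)) :=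
        Finset.prod_congr rfl fun s _ => act_b_lin w x s hw
    _ = (∏ s : ZMod p, (C (io p F w) ^ 3 : RR F)) * ∏ s : ZMod p, act p F (Uu (w⁻¹ * (w⁻¹ * s + x))) (X 3) :=
        Finset.prod_mul_distrib
    _ = C (io p F w) ^ 3 * Npoly p F := by rw [hcard, h2]; rfl

end actsec

/-- the generating set -/
def Agen (p : ℕ) [Fact p.Prime] (F : Type) [Field F] [CharP F p] : Set (RR F) :=
      ({Dpoly F, Kpoly p F, Lpoly p F, Npoly p F * X 0,
        trBG p F (Npoly p F ^ (p - 1)), trBG p F (Npoly p F * epoly F),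
        trBG p F (Npoly p F ^ ((p + 1) / 3) * dpoly F)} :
          Set (MvPolynomial (Fin 4) F)) ∪
      (fun j : ℕ => trG p F (Npoly p F ^ j *
          (X 2 ^ ((2 + 3 * j / (p - 1) - 1) * (p - 1) - 3 * j) * X 3 ^ (p - 1)))) ''
        (Set.Icc 1 (p - 2)) ∪
      (fun j : ℕ => trG p F (Npoly p F ^ j * X 3 ^ (p - 1 - j))) ''
        (Set.Icc 1 ((p - 2) / 3)) ∪
      (fun j : ℕ => trG p F (Npoly p F ^ j *
          (X 3 ^ (p - 2) * X 2 ^ ((2 + 3 * j / (p - 1) - 1) * (p - 1) + 3 - 3 * j)))) ''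
        {j : ℕ | 2 ≤ j ∧ j ≤ p - 2 ∧ j ≠ (p + 1) / 3 ∧ j ≠ (2 * p - 1) / 3} ∪
      (fun j : ℕ => trG p F (Npoly p F ^ j *
          (X 3 ^ ((5 * p - 7 - 3 * j) / 3) * X 2 ^ 2))) ''
        (Set.Icc ((2 * p - 1) / 3) (p - 2))

/-- the algebra generated -/
def AA (p : ℕ) [Fact p.Prime] (F : Type) [Field F] [CharP F p] : Subalgebra F (RR F) := Algebra.adjoin F (Agen p F)

section invsec
variable {p : ℕ} [Fact p.Prime] {F : Type} [Field F] [CharP F p]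

lemma D_inv : Dpoly F ∈ invariants p F := by
  apply inv_of_gen
  · simp only [Dpoly, map_sub, map_add, map_mul, map_pow, map_ofNat, Et_X0, Et_X1, Et_X2, Et_X3]; ring
  · intro t
    rw [act_U]
    simp only [Dpoly, map_sub, map_add, map_mul, map_pow, map_ofNat, sig_X0, sig_X1, sig_X2, sig_X3, one_mul, C_pow]; ring

lemma L_inv (hp : 3 < p) : Lpoly p F ∈ invariants p F := by
  haveI : CharP (RR F) p := inferInstance
  haveI : ExpChar (RR F) p := ExpChar.prime Fact.out
  have hodd : Odd p := Nat.odd_iff.mpr (p_odd hp)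
  apply inv_of_gen
  · simp only [Lpoly, map_sub, map_add, map_mul, map_pow, map_ofNat, Et_X0, Et_X1, Et_X2, Et_X3, hodd.neg_pow]; ring
  · intro t
    rw [act_U]
    have hc : (C (io p F t) : RR F) ^ p = C (io p F t) := by
      rw [← C_pow, ← map_pow, ZMod.pow_card]
    have hn : ∀ n : ℕ, (n : RR F) ^ p = n := by
      intro n
      have : (n : RR F) = C (io p F n) := by simp
      rw [this, ← C_pow, ← map_pow, ZMod.pow_card]
    have h2 : (2 : RR F) ^ p = 2 := by exact_mod_cast hn 2
    have h3 : (3 : RR F) ^ p = 3 := by exact_mod_cast hn 3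
    simp only [Lpoly, map_sub, map_add, map_mul, map_pow, map_ofNat, sig_X0, sig_X1, sig_X2, sig_X3, one_mul, C_pow,
      add_pow_char, mul_pow, ← pow_mul, mul_comm _ p]
    simp only [pow_mul, hc, h2, h3]
    ring

lemma NX_inv : Npoly p F * X 0 ∈ invariants p F := by
  apply inv_of_gen
  · have hs : ∀ s : ZMod p, s ≠ 0 → act p F (Et p) (act p F (Uu s) (X 3)) =
        C (io p F (-s)) ^ 3 * act p F (Uu (-s⁻¹)) (X 3) := by
      intro s hs
      rw [← act_mul, act_X3, act_X3]
      have h := io_inv_mul (F := F) s hs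
      simp only [Uu, Et, Matrix.mul_apply, Fin.sum_univ_two, Matrix.of_apply, Matrix.cons_val', Matrix.cons_val_zero,
        Matrix.cons_val_one, Matrix.cons_val_fin_one, map_add, map_mul, map_one, map_zero, one_mul, mul_zero, add_zero,
        zero_add, mul_one, C_1, one_pow, map_neg]
      generalize C (io p F s⁻¹) = v at *
      generalize C (io p F s) = u at *
      have h2 : (v * u) ^ 2 = 1 := by rw [h, one_pow]
      have h3 : (v * u) ^ 3 = 1 := by rw [h, one_pow]
      linear_combination (- X 0) * h3 + 3 * u * X 1 * h2 - 3 * u ^ 2 * X 2 * h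
    have h0 : act p F (Et p) (act p F (Uu 0) (X 3)) = X 0 := by
      rw [act_U, map_zero, sig_zero, Et_X3]
    have h0' : act p F (Uu 0) (X 3) = (X 3 : RR F) := by rw [act_U, map_zero, sig_zero]
    have hN : Npoly p F = ∏ s : ZMod p, act p F (Uu s) (X 3) := rfl
    have hw : ∏ s ∈ Finset.univ.erase (0 : ZMod p), (C (io p F (-s)) ^ 3 : RR F) = -1 := by
      rw [Finset.prod_pow, ← map_prod, ← map_prod]
      have : ∏ s ∈ Finset.univ.erase (0 : ZMod p), (-s) = -1 := by
        have h1 := congrArg (fun u : (ZMod p)ˣ => (u : ZMod p)) (FiniteField.prod_univ_units_id_eq_neg_one (K := ZMod p))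
        simp only [Units.coe_prod, Units.val_neg, Units.val_one] at h1
        rw [← h1]
        symm
        refine Finset.prod_bij (fun u _ => - (u : ZMod p)) ?_ ?_ ?_ ?_
        · intro u _; simp
        · intro u _ v _ huv; simpa [Units.ext_iff] using huv
        · intro s hs'
          have hs0 : -s ≠ 0 := by simpa using hs'
          exact ⟨Units.mk0 _ hs0, Finset.mem_univ _, by simp⟩
        · intro u _; simp
      rw [this]; simp; ring
    rw [map_mul, Et_X0, hN, map_prod]
    rw [← Finset.mul_prod_erase _ _ (Finset.mem_univ (0 : ZMod p)),
      ← Finset.mul_prod_erase Finset.univ (fun s => act p F (Uu s) (X 3)) (Finset.mem_univ (0 : ZMod p)), h0, h0',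
      Finset.prod_congr rfl fun s hs' => hs s (by simpa using hs'), Finset.prod_mul_distrib, hw]
    have : ∏ s ∈ Finset.univ.erase (0 : ZMod p), act p F (Uu (-s⁻¹)) (X 3) =
       ∏ s ∈ Finset.univ.erase (0 : ZMod p), act p F (Uu s) (X 3 : RR F) := by
      refine Finset.prod_bij' (fun s _ => - s⁻¹) (fun s _ => - s⁻¹) ?_ ?_ ?_ ?_ ?_
      · intro s hs; simpa using hs
      · intro s hs; simpa using hs
      · intro s hs; simp [inv_neg]
      · intro s hs; simp [inv_neg]
      · intro s h; rfl
    rw [this]; ring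
  · intro t
    rw [act_U, Npoly_eq, map_mul, PInv_Nn 1 t, sig_X0]

lemma trBG_Nd_inv (hp : 3 < p) (hp3 : p % 3 = 2) (f : RR F) (k j : ℕ) (hk : k = 3 * j ∨ 3 * j = k + (p - 1))
    (hf : ∀ w x : ZMod p, w ≠ 0 → act p F !![w, x; 0, w⁻¹] f = C (io p F w⁻¹) ^ k * f) :
    trBG p F (Npoly p F ^ j * f) ∈ invariants p F := by
  apply trBG_inv
  intro w x hw
  rw [map_mul, map_pow, act_b_N w x hw, hf w x hw]
  have h := io_inv_mul (F := F) w hw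
  have h1 : (C (io p F w) ^ 3 : RR F) ^ j = C (io p F w) ^ k := by
    rcases hk with hk | hk
    · rw [hk, pow_mul]
    · rw [← pow_mul, hk, pow_add]
      have : (C (io p F w) : RR F) ^ (p - 1) = 1 := by
        rw [← C_pow, ← map_pow, ZMod.pow_card_sub_one_eq_one hw, map_one, C_1]
      rw [this, mul_one]
  rw [mul_pow, h1]
  have h2 : (C (io p F w⁻¹) : RR F) ^ k * C (io p F w) ^ k = 1 := by rw [← mul_pow, h, one_pow]
  linear_combination (Npoly p F ^ j * f) * h2

lemma AA_le (hp : 3 < p) (hp3 : p % 3 = 2) : AA p F ≤ invariants p F := by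
  unfold AA
  rw [Algebra.adjoin_le_iff]
  have hG : ∀ f : RR F, trG p F f ∈ (invariants p F : Set (RR F)) := trG_inv
  rintro f ((((hf | ⟨j, hj, rfl⟩) | ⟨j, hj, rfl⟩) | ⟨j, hj, rfl⟩) | ⟨j, hj, rfl⟩)
  · simp only [Set.mem_insert_iff, Set.mem_singleton_iff] at hf
    rcases hf with rfl | rfl | rfl | rfl | rfl | rfl | rfl
    · exact D_inv
    · exact neg_mem (trG_inv _)
    · exact L_inv hp
    · exact NX_inv
    · have := trBG_Nd_inv (p := p) hp hp3 (1 : RR F) (2 * (p - 1)) (p - 1) (by omega) (by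
        intro w x hw
        have : (C (io p F w⁻¹) : RR F) ^ (p - 1) = 1 := by
          rw [← C_pow, ← map_pow, ZMod.pow_card_sub_one_eq_one (inv_ne_zero hw), map_one, C_1]
        rw [map_one, mul_comm 2, pow_mul, this]; simp)
      rw [mul_one] at this; exact this
    · have := trBG_Nd_inv (p := p) hp hp3 (epoly F) 3 1 (by omega) (fun w x hw => act_b_e w x hw)
      rw [pow_one] at this; exact this
    · exact trBG_Nd_inv (p := p) hp hp3 (dpoly F) 2 ((p + 1) / 3) (by omega) (fun w x hw => act_b_d w x hw)
  all_goals exact hG _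

end invsec

section homsec
variable {p : ℕ} [Fact p.Prime] {F : Type} [Field F] [CharP F p]

lemma ex_act_X (g : Matrix (Fin 2) (Fin 2) (ZMod p)) (i : Fin 4) : Ex w1 (act p F g (X i)) 1 := by
  have key : ∀ a b c d : F, Ex w1 (C a * X 0 + C b * X 1 + C c * X 2 + C d * X 3 : RR F) 1 := fun a b c d =>
    Sp.add (Sp.add (Sp.add (Sp.C_mul _ (ex_w1_X 0)) (Sp.C_mul _ (ex_w1_X 1))) (Sp.C_mul _ (ex_w1_X 2))) (Sp.C_mul _ (ex_w1_X 3))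
  have h2 : (2 : RR F) = C 2 := (map_ofNat C 2).symm
  have h3 : (3 : RR F) = C 3 := (map_ofNat C 3).symm
  fin_cases i
  · simp only [Fin.zero_eta, act_X0, h2, h3, ← C_pow, ← MvPolynomial.C_mul, ← C_add]; exact key _ _ _ _
  · simp only [Fin.mk_one, act_X1, h2, h3, ← C_pow, ← MvPolynomial.C_mul, ← C_add]; exact key _ _ _ _
  · simp only [Fin.reduceFinMk, act_X2, h2, h3, ← C_pow, ← MvPolynomial.C_mul, ← C_add]; exact key _ _ _ _
  · simp only [Fin.reduceFinMk, act_X3, h2, h3, ← C_pow, ← MvPolynomial.C_mul, ← C_add]; exact key _ _ _ _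

lemma ex_act (g : Matrix (Fin 2) (Fin 2) (ZMod p)) {f : RR F} {n : ℤ} (hf : Ex w1 f n) : Ex w1 (act p F g f) n :=
  Ex.hom _ (fun i => by
    have : w1 i = 1 := by fin_cases i <;> rfl
    rw [this]; exact ex_act_X g i) hf

lemma ex_trG {f : RR F} {n : ℤ} (hf : Ex w1 f n) : Ex w1 (trG p F f) n :=
  Sp.sum _ _ fun g _ => ex_act g.1 hf

lemma ex_trBG {f : RR F} {n : ℤ} (hf : Ex w1 f n) : Ex w1 (trBG p F f) n :=
  Sp.add (Sp.sum _ _ fun g _ => ex_act _ hf) (ex_act _ hf)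

lemma ex_N : Ex w1 (Npoly p F) p := by rw [Npoly_eq]; exact ex_Nn 1

lemma hex {f : RR F} {n : ℤ} (hf : Ex w1 f n) (hn : 0 ≤ n) : ∃ m : ℕ, Ex w1 f m :=
  ⟨n.toNat, by rwa [Int.toNat_of_nonneg hn]⟩

lemma hexN {f : RR F} : (∃ m : ℕ, Ex w1 f m) → ∀ j, ∃ m : ℕ, Ex w1 (Npoly p F ^ j * f) m := by
  rintro ⟨m, hm⟩ j
  exact hex (Ex.mul (Ex.pow (ex_N (p := p)) j) hm) (by positivity)

lemma hexXX (i k : Fin 4) (a b : ℕ) : ∃ m : ℕ, Ex w1 (X i ^ a * X k ^ b : RR F) m :=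
  hex (Ex.mul (Ex.pow (ex_w1_X i) a) (Ex.pow (ex_w1_X k) b)) (by positivity)

lemma Agen_hom : ∀ x ∈ Agen p F, ∃ n : ℕ, Ex w1 x n := by
  have hG : ∀ f : RR F, (∃ m : ℕ, Ex w1 f m) → ∃ m : ℕ, Ex w1 (trG p F f) m := fun f ⟨m, hm⟩ => ⟨m, ex_trG hm⟩
  have hB : ∀ f : RR F, (∃ m : ℕ, Ex w1 f m) → ∃ m : ℕ, Ex w1 (trBG p F f) m := fun f ⟨m, hm⟩ => ⟨m, ex_trBG hm⟩
  have x := fun i => ex_w1_X (F := F) i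
  have h2 : (2 : RR F) = C 2 := (map_ofNat C 2).symm
  have h3 : (3 : RR F) = C 3 := (map_ofNat C 3).symm
  have h4 : (4 : RR F) = C 4 := (map_ofNat C 4).symm
  have h6 : (6 : RR F) = C 6 := (map_ofNat C 6).symm
  have mm : ∀ (a b c d : ℕ), Ex w1 (X 0 ^ a * X 1 ^ b * X 2 ^ c * X 3 ^ d : RR F) ((a + b + c + d : ℕ) : ℤ) := by
    intro a b c d
    have := Ex.mul (Ex.mul (Ex.mul (Ex.pow (x 0) a) (Ex.pow (x 1) b)) (Ex.pow (x 2) c)) (Ex.pow (x 3) d)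
    simpa using this
  rintro f ((((hf | ⟨j, hj, rfl⟩) | ⟨j, hj, rfl⟩) | ⟨j, hj, rfl⟩) | ⟨j, hj, rfl⟩)
  · simp only [Set.mem_insert_iff, Set.mem_singleton_iff] at hf
    rcases hf with rfl | rfl | rfl | rfl | rfl | rfl | rfl
    · refine ⟨4, ?_⟩
      have e : Dpoly F = C 3 * (X 0 ^ 0 * X 1 ^ 2 * X 2 ^ 2 * X 3 ^ 0) - C 4 * (X 0 ^ 0 * X 1 ^ 3 * X 2 ^ 0 * X 3 ^ 1)
          - C 4 * (X 0 ^ 1 * X 1 ^ 0 * X 2 ^ 3 * X 3 ^ 0) + C 6 * (X 0 ^ 1 * X 1 ^ 1 * X 2 ^ 1 * X 3 ^ 1) - X 0 ^ 2 * X 1 ^ 0 * X 2 ^ 0 * X 3 ^ 2 := by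
        rw [Dpoly, ← h3, ← h4, ← h6]; ring
      rw [e]
      exact Sp.sub (Sp.add (Sp.sub (Sp.sub (Sp.C_mul _ (mm 0 2 2 0)) (Sp.C_mul _ (mm 0 3 0 1))) (Sp.C_mul _ (mm 1 0 3 0)))
        (Sp.C_mul _ (mm 1 1 1 1))) (mm 2 0 0 2)
    · obtain ⟨m, hm⟩ := hex (Ex.pow (x 1) (p - 1)) (by positivity)
      exact ⟨m, Sp.neg (ex_trG hm)⟩
    · refine ⟨p + 1, ?_⟩
      have q : ∀ i k : Fin 4, Ex w1 (X i ^ p * X k : RR F) ((p + 1 : ℕ) : ℤ) := by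
        intro i k
        have := Ex.mul (Ex.pow (x i) p) (x k)
        simpa using this
      have q' : ∀ i k : Fin 4, Ex w1 (X i * X k ^ p : RR F) ((p + 1 : ℕ) : ℤ) := by
        intro i k
        rw [mul_comm]; exact q k i
      rw [Lpoly, h3]
      exact Sp.sub (Sp.C_mul _ (Sp.sub (q 2 1) (q' 2 1))) (Sp.sub (q 3 0) (q' 3 0))
    · exact hex (Ex.mul (ex_N (p := p)) (x 0)) (by positivity)
    · exact hB _ (hex (Ex.pow (ex_N (p := p)) _) (by positivity))
    · refine hB _ ?_
      rw [← pow_one (Npoly p F)]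
      refine hexN ⟨3, ?_⟩ 1
      have e : epoly F = C 2 * (X 0 ^ 0 * X 1 ^ 3 * X 2 ^ 0 * X 3 ^ 0) + X 0 ^ 2 * X 1 ^ 0 * X 2 ^ 0 * X 3 ^ 1
         - C 3 * (X 0 ^ 1 * X 1 ^ 1 * X 2 ^ 1 * X 3 ^ 0) := by rw [epoly, ← h2, ← h3]; ring
      rw [e]
      exact Sp.sub (Sp.add (Sp.C_mul _ (mm 0 3 0 0)) (mm 2 0 0 1)) (Sp.C_mul _ (mm 1 1 1 0))
    · refine hB _ (hexN ⟨2, ?_⟩ _)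
      have e : dpoly F = X 0 ^ 0 * X 1 ^ 2 * X 2 ^ 0 * X 3 ^ 0 - X 0 ^ 1 * X 1 ^ 0 * X 2 ^ 1 * X 3 ^ 0 := by rw [dpoly]; ring
      rw [e]
      exact Sp.sub (mm 0 2 0 0) (mm 1 0 1 0)
  · exact hG _ (hexN (hexXX _ _ _ _) _)
  · exact hG _ (hexN (hex (Ex.pow (x 3) _) (by positivity)) _)
  · exact hG _ (hexN (hexXX _ _ _ _) _)
  · exact hG _ (hexN (hexXX _ _ _ _) _)

lemma AA_hcomp {x : RR F} (hx : x ∈ AA p F) : ∀ n, hcomp n x ∈ AA p F := by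
  unfold AA at *
  induction hx using Algebra.adjoin_induction with
  | mem x hx =>
    intro n
    obtain ⟨m, hm⟩ := Agen_hom x hx
    by_cases h : m = n
    · subst h; rw [hcomp_eq_self hm]; exact Algebra.subset_adjoin hx
    · rw [hcomp_of_ne hm (by exact_mod_cast h)]; exact Subalgebra.zero_mem _
  | algebraMap c =>
    intro n
    have h0 : Ex w1 (algebraMap F (RR F) c) 0 := Sp.C c rfl
    by_cases h : n = 0
    · subst h; rw [hcomp_eq_self (by simpa using h0)]; exact Subalgebra.algebraMap_mem _ _
    · rw [hcomp_of_ne h0 (by exact_mod_cast (Ne.symm h))]; exact Subalgebra.zero_mem _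
  | add x y _ _ hx hy =>
    intro n; rw [map_add]; exact Subalgebra.add_mem _ (hx n) (hy n)
  | mul x y _ _ hx hy =>
    intro n
    have e : x * y = ∑ i ∈ Finset.range (x.totalDegree + 1), hcomp i x * y := by
      rw [← Finset.sum_mul, sum_hcomp]
    rw [e, map_sum]
    refine Subalgebra.sum_mem _ fun i _ => ?_
    by_cases hi : i ≤ n
    · obtain ⟨k, rfl⟩ := Nat.exists_eq_add_of_le hi
      rw [hcomp_mul (Ex_hcomp i x)]
      exact Subalgebra.mul_mem _ (hx i) (hy k)
    · rw [hcomp_mul_lt (Ex_hcomp i x) n (by omega)]; exact Subalgebra.zero_mem _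

lemma inv_hcomp {f : RR F} (hf : f ∈ invariants p F) (n : ℕ) : hcomp n f ∈ invariants p F := by
  intro g
  rw [← hcomp_hom (ex_act_X g.1), hf g]

lemma X3_not_dvd_X0 : ¬ (X 3 : RR F) ∣ X 0 := by
  rintro ⟨c, hc⟩
  have := congrArg (kill {3}) hc
  rw [map_mul, kill_X, kill_X] at this
  simp at this

lemma outer (hp : 3 < p) (hp3 : p % 3 = 2)
    (H : ∀ (n : ℕ) (f : RR F), f ∈ invariants p F → Ex w1 f n → ∃ α ∈ AA p F, kill {0} f = kill {0} α) :
    invariants p F ≤ AA p F := by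
  have main : ∀ (n : ℕ) (f : RR F), f ∈ invariants p F → Ex w1 f n → f ∈ AA p F := by
    intro n
    induction n using Nat.strong_induction_on with
    | _ n ih =>
      intro f hf h1
      obtain ⟨α, hα, hk⟩ := H n f hf h1
      have hα' := AA_hcomp hα n
      have hk' : kill {0} (hcomp n α) = kill {0} f := by
        rw [hcomp_kill, ← hk, ← hcomp_kill, hcomp_eq_self h1]
      have hinv : f - hcomp n α ∈ invariants p F := Subalgebra.sub_mem _ hf (AA_le hp hp3 hα')
      have hex1 : Ex w1 (f - hcomp n α) n := Sp.sub h1 (Ex_hcomp n α)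
      have h0 : kill {0} (f - hcomp n α) = 0 := by rw [map_sub, hk', sub_self]
      suffices hs : f - hcomp n α ∈ AA p F by
        have := Subalgebra.add_mem _ hs hα'
        simpa using this
      generalize f - hcomp n α = f' at *
      obtain ⟨h1, rfl⟩ := X_dvd_of_kill 0 f' h0
      have hX0 : (X 0 : RR F) ≠ 0 := X_ne_zero 0
      have hP : PInv p 1 h1 := by
        intro s
        have := inv_PInv hinv s
        rw [map_mul, sig_X0] at this
        exact mul_left_cancel₀ hX0 this
      have hX3 : (X 3 : RR F) ∣ h1 := by
        have h := inv_Et hinv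
        rw [map_mul, Et_X0] at h
        have hd : (X 3 : RR F) ∣ X 0 * h1 := ⟨- act p F (Et p) h1, by rw [← h]; ring⟩
        exact ((X_prime (R := F) (i := (3 : Fin 4))).dvd_or_dvd hd).resolve_left X3_not_dvd_X0
      obtain ⟨h2, rfl⟩ := Nn_dvd (three_ne hp) hP (by
        obtain ⟨r, rfl⟩ := hX3
        rw [map_mul, kill_X]; simp)
      have hN0 : Npoly p F * X 0 ≠ 0 := mul_ne_zero (by rw [Npoly_eq]; exact Nn_ne_zero 1) hX0
      have e : X 0 * (Nn p 1 * h2) = (Npoly p F * X 0) * h2 := by rw [Npoly_eq]; ring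
      rw [e] at hinv hex1
      rw [e]
      have hinv2 : h2 ∈ invariants p F := by
        intro g
        have := hinv g
        rw [map_mul, NX_inv g] at this
        exact mul_left_cancel₀ hN0 this
      have hNX : Ex w1 (Npoly p F * X 0) ((p + 1 : ℕ) : ℤ) := by
        push_cast; exact Ex.mul (ex_N (p := p)) (ex_w1_X 0)
      rw [← hcomp_eq_self hex1]
      by_cases hn : p + 1 ≤ n
      · obtain ⟨k, rfl⟩ := Nat.exists_eq_add_of_le hn
        rw [hcomp_mul hNX]
        refine Subalgebra.mul_mem _ ?_ (ih k (by omega) _ (inv_hcomp hinv2 k) (Ex_hcomp k h2))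
        refine Algebra.subset_adjoin ?_
        left; left; left; left; simp
      · rw [hcomp_mul_lt hNX n (by omega)]; exact Subalgebra.zero_mem _
  intro f hf
  rw [← sum_hcomp f]
  exact Subalgebra.sum_mem _ fun i _ => main i _ (inv_hcomp hf i) (Ex_hcomp i f)

end homsec

section imgsec
variable {p : ℕ} [Fact p.Prime] {F : Type} [Field F] [CharP F p]

lemma kill_act_N (g : Matrix (Fin 2) (Fin 2) (ZMod p)) (hg : g 1 0 ≠ 0) : kill {0} (act p F g (Npoly p F)) = 0 := by
  rw [Npoly, map_prod, map_prod]
  refine Finset.prod_eq_zero (Finset.mem_univ (- g 0 0 / g 1 0)) ?_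
  rw [← act_mul, act_X3]
  have h00 : (Uu (- g 0 0 / g 1 0) * g) 0 0 = 0 := by
    simp [Matrix.mul_apply, Fin.sum_univ_two, Uu]
    field_simp; ring
  rw [h00]
  simp [kill_X]

lemma kill_act_Nx (g : Matrix (Fin 2) (Fin 2) (ZMod p)) (hg : g 1 0 ≠ 0) (j : ℕ) (hj : 1 ≤ j) (x : RR F) :
    kill {0} (act p F g (Npoly p F ^ j * x)) = 0 := by
  rw [map_mul, map_mul, map_pow, map_pow, kill_act_N g hg, zero_pow (by omega), zero_mul]

lemma phi_trBG (j : ℕ) (hj : 1 ≤ j) (x : RR F) :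
    kill {0} (trBG p F (Npoly p F ^ j * x)) = Nn p 0 ^ j * kill {0} x := by
  rw [trBG, map_add, kill_act_Nx _ (by simp) j hj, add_zero, map_sum]
  rw [Finset.sum_eq_single 0]
  · have : (!![1, 0; 0, 1] : Matrix (Fin 2) (Fin 2) (ZMod p)) = 1 := by
      rw [Matrix.one_fin_two]
    rw [this, act_one, map_mul, map_pow, Npoly_eq, kill_Nn]
  · intro s _ hs
    exact kill_act_Nx _ (by simpa using hs) j hj x
  · simp

/-- triangular matrices -/
def trg (w : (ZMod p)ˣ × ZMod p) : Matrix.SpecialLinearGroup (Fin 2) (ZMod p) :=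
  ⟨!![(w.1 : ZMod p), 0; 0, (w.1 : ZMod p)⁻¹] * Uu w.2, by
    rw [Matrix.det_mul, Matrix.det_fin_two_of, Matrix.det_fin_two_of]
    have hw : (w.1 : ZMod p) ≠ 0 := w.1.ne_zero
    rw [mul_inv_cancel₀ hw]; ring⟩

lemma trg_val (w : (ZMod p)ˣ × ZMod p) : (trg w).1 = !![(w.1 : ZMod p), 0; 0, (w.1 : ZMod p)⁻¹] * Uu w.2 := rfl

lemma trg_mat (w : (ZMod p)ˣ × ZMod p) : (trg w).1 = !![(w.1 : ZMod p), w.1 * w.2; 0, (w.1 : ZMod p)⁻¹] := by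
  rw [trg_val]
  generalize (w.1 : ZMod p) = a
  ext i k; fin_cases i <;> fin_cases k <;> simp [Matrix.mul_apply, Fin.sum_univ_two, Uu]

lemma trg_inj : Function.Injective (trg (p := p)) := by
  rintro ⟨w, s⟩ ⟨w', s'⟩ h
  have h' : (trg (w, s)).1 = (trg (w', s')).1 := by rw [h]
  rw [trg_mat, trg_mat] at h'
  have h0 := congrFun (congrFun h' 0) 0
  have h1 := congrFun (congrFun h' 0) 1
  have hw : w = w' := Units.ext h0
  subst hw
  have h2 : (w : ZMod p) * s = w * s' := h1
  rw [mul_left_cancel₀ w.ne_zero h2]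

lemma trg_range (g : Matrix.SpecialLinearGroup (Fin 2) (ZMod p)) (hg : g.1 1 0 = 0) : g ∈ Set.range (trg (p := p)) := by
  have hd := g.2
  rw [Matrix.det_fin_two, hg, mul_zero, sub_zero] at hd
  have h0 : g.1 0 0 ≠ 0 := left_ne_zero_of_mul_eq_one hd
  refine ⟨(Units.mk0 (g.1 0 0) h0, (g.1 0 0)⁻¹ * g.1 0 1), ?_⟩
  apply Subtype.ext
  rw [trg_mat]
  ext i k; fin_cases i <;> fin_cases k
  · simp
  · simp [h0]
  · simp [hg]
  · exact inv_eq_of_mul_eq_one_right hd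

/-- the transfer of a monomial over the unipotent group -/
def th (p : ℕ) [Fact p.Prime] (F : Type) [Field F] [CharP F p] (l k : ℕ) : RR F :=
  ∑ s : ZMod p, sig 0 (io p F s) (X 2 ^ l * X 3 ^ k)

lemma act_diag (w : (ZMod p)ˣ) (j l k : ℕ) (h : p - 1 ∣ 3 * j + l + 3 * k) :
    act p F !![(w : ZMod p), 0; 0, (w : ZMod p)⁻¹] (Npoly p F ^ j * (X 2 ^ l * X 3 ^ k)) = Npoly p F ^ j * (X 2 ^ l * X 3 ^ k) := by
  have hw : (w : ZMod p) ≠ 0 := w.ne_zero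
  obtain ⟨_, _, h2, h3⟩ := act_b_X (F := F) (w : ZMod p) 0 hw
  have hN := act_b_N (F := F) (w : ZMod p) 0 hw
  have hinv := io_inv_mul (F := F) (w : ZMod p) hw
  rw [map_mul, map_mul, map_pow, map_pow, map_pow, hN, h2, h3]
  have e2 : (C (io p F (w : ZMod p)⁻¹) * (C (io p F 0) ^ 2 * X 0 + 2 * C (io p F w) * C (io p F 0) * X 1 + C (io p F w) ^ 2 * X 2) : RR F)
      = C (io p F w) * X 2 := by
    simp only [map_zero]
    linear_combination (C (io p F w) * X 2) * hinv
  have e3 : (C (io p F 0) ^ 3 * X 0 + 3 * C (io p F 0) ^ 2 * C (io p F w) * X 1 + 3 * C (io p F 0) * C (io p F w) ^ 2 * X 2 + C (io p F w) ^ 3 * X 3 : RR F)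
      = C (io p F w) ^ 3 * X 3 := by
    simp only [map_zero]; ring
  rw [e2, e3]
  have hone : (C (io p F w) : RR F) ^ (3 * j + l + 3 * k) = 1 := by
    obtain ⟨m, hm⟩ := h
    rw [hm, pow_mul, ← C_pow, ← map_pow (io p F), ZMod.pow_card_sub_one_eq_one hw, map_one, map_one, one_pow]
  calc _ = (C (io p F w) : RR F) ^ (3 * j + l + 3 * k) * (Npoly p F ^ j * (X 2 ^ l * X 3 ^ k)) := by
        rw [pow_add, pow_add, pow_mul, pow_mul]; ring
    _ = _ := by rw [hone, one_mul]

lemma phi_trG (j l k : ℕ) (hj : 1 ≤ j) (h : p - 1 ∣ 3 * j + l + 3 * k) :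
    kill {0} (trG p F (Npoly p F ^ j * (X 2 ^ l * X 3 ^ k))) = - (Nn p 0 ^ j * th p F l k) := by
  rw [trG, map_sum]
  have := Fintype.sum_of_injective (trg (p := p)) trg_inj
    (fun w : (ZMod p)ˣ × ZMod p => Nn p 0 ^ j * sig 0 (io p F w.2) (X 2 ^ l * X 3 ^ k))
    (fun g => kill {0} (act p F g.1 (Npoly p F ^ j * (X 2 ^ l * X 3 ^ k))))
    (by
      intro g hg
      by_cases h0 : g.1 1 0 = 0
      · exact absurd (trg_range g h0) hg
      · exact kill_act_Nx _ h0 j hj _)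
    (by
      rintro ⟨w, s⟩
      dsimp only
      rw [trg_val, act_mul, act_diag w j l k h, act_U, kill_sig, map_mul (kill {0}), map_pow, Npoly_eq, kill_Nn, map_mul (kill {0}),
        map_pow (kill {0}), map_pow (kill {0}), kill_X, kill_X, if_neg (by decide), if_neg (by decide)]
      have hh : sig 0 (io p F s) (Nn p (0 : F) ^ j) = Nn p 0 ^ j := (PInv_Nn (0 : F)).pow j s
      rw [map_mul (sig 0 (io p F (w, s).2)) (Nn p 0 ^ j), hh])
  rw [← this, Fintype.sum_prod_type]
  simp only [Finset.sum_const, Finset.card_univ, ← Finset.mul_sum]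
  rw [← th, ZMod.card_units, nsmul_eq_mul]
  have h1 : ((p - 1 : ℕ) : RR F) = -1 := by
    rw [Nat.cast_sub (Fact.out : p.Prime).one_le]
    simp [CharP.cast_eq_zero]
  rw [h1]; ring

lemma PInv_sum (x : RR F) : PInv p 0 (∑ s : ZMod p, sig 0 (io p F s) x) := by
  intro t
  rw [map_sum]
  simp only [sig_sig, ← map_add]
  exact Equiv.sum_comp (Equiv.addLeft t) (fun s : ZMod p => sig 0 (io p F s) x)

lemma th_Sy (l k : ℕ) (hk : k ≤ p - 1) : Sy p ((l + k : ℕ) : ℤ) (th p F l k) where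
  k := by
    rw [th, map_sum]
    refine Finset.sum_congr rfl fun s _ => ?_
    rw [kill_sig0]; simp [kill_X]
  e := by
    refine Sp.sum _ _ fun s _ => ex_w1_sig _ _ ?_
    have := Ex.mul (Ex.pow (ex_w1_X (F := F) 2) l) (Ex.pow (ex_w1_X 3) k)
    simpa using this
  i := PInv_sum _
  l := by
    refine Sp.sum _ _ fun s _ => le_w3_sig _ _ ?_
    have h3 : Le w3 (X 3 : RR F) 1 := Sp.X 3 (by simp [w3])
    have := Le.mul (Le.pow (le_w3_X (F := F) 2 (by decide)) l) (Le.pow h3 k)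
    refine Le.mono this ?_
    have := (Fact.out : p.Prime).one_le
    omega

lemma th_Cl (l k : ℕ) : Cl p (2 * l + 3 * k) (th p F l k) := by
  have key : proj p (2 * l + 3 * k) (th p F l k) = th p F l k := by
    rw [proj_apply]
    have h : ∀ w : (ZMod p)ˣ, (io p F w) ^ ((p - 2) * (2 * l + 3 * k)) • tau (io p F w) (th p F l k) = th p F l k := by
      intro w
      have e : tau (io p F w) (th p F l k) = C ((io p F w) ^ (2 * l + 3 * k)) * th p F l k := by
        rw [th, map_sum]
        have h1 : ∀ s : ZMod p, tau (io p F w) (sig 0 (io p F s) (X 2 ^ l * X 3 ^ k))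
            = C ((io p F w) ^ (2 * l + 3 * k)) * sig 0 (io p F (((w⁻¹ : (ZMod p)ˣ) : ZMod p) * s)) (X 2 ^ l * X 3 ^ k) := by
          intro s
          have h2 : s = (w : ZMod p) * (((w⁻¹ : (ZMod p)ˣ) : ZMod p) * s) := by rw [← mul_assoc, Units.mul_inv, one_mul]
          conv_lhs => rw [h2, map_mul (io p F)]
          rw [← sig_tau, map_mul (tau _), map_pow (tau _), map_pow (tau _), tau_X, tau_X]
          simp only [map_mul, map_pow, sig_C]
          simp only [Fin.val_two, show ((3 : Fin 4) : ℕ) = 3 from rfl]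
          rw [pow_add, pow_mul, pow_mul]
          ring
        rw [Finset.sum_congr rfl fun s _ => h1 s, ← Finset.mul_sum]
        congr 1
        exact Equiv.sum_comp (Equiv.mulLeft₀ (((w⁻¹ : (ZMod p)ˣ) : ZMod p)) (Units.ne_zero _)) (fun s : ZMod p => sig 0 (io p F s) (X 2 ^ l * X 3 ^ k))
      rw [e, smul_eq_C_mul, ← mul_assoc, ← MvPolynomial.C_mul, ← pow_add]
      have hd : p - 1 ∣ (p - 2) * (2 * l + 3 * k) + (2 * l + 3 * k) := (cl_dvd _ _).2 rfl
      obtain ⟨m, hm⟩ := hd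
      rw [hm, pow_mul, ← map_pow, ZMod.pow_card_sub_one_eq_one w.ne_zero, map_one, one_pow, C_1, one_mul]
    rw [Finset.sum_congr rfl fun w _ => h w, Finset.sum_const, Finset.card_univ, ZMod.card_units, nsmul_eq_mul]
    have h1 : ((p - 1 : ℕ) : RR F) = -1 := by
      rw [Nat.cast_sub (Fact.out : p.Prime).one_le]
      simp [CharP.cast_eq_zero]
    rw [h1]; ring
  rw [← key]; exact Cl_proj _ _

end imgsec

section twosec
variable {F : Type} [Field F]

/-- exponent of `a₁^i a₂^k` -/
abbrev ee (i k : ℕ) : Fin 4 →₀ ℕ := Finsupp.single 1 i + Finsupp.single 2 k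

lemma mono_ee (i k : ℕ) (c : F) : (monomial (ee i k) c : RR F) = C c * (X 1 ^ i * X 2 ^ k) := by
  rw [C_mul_monomial_eq i k c]
where
  C_mul_monomial_eq (i k : ℕ) (c : F) : (monomial (ee i k) c : RR F) = C c * (X 1 ^ i * X 2 ^ k) := by
    rw [X_pow_eq_monomial, X_pow_eq_monomial, monomial_mul, C_mul_monomial]; simp

lemma expand2 {y : RR F} {n : ℕ} (hk : kill {0, 3} y = y) (hy : Ex w1 y n) :
    y = ∑ i ∈ Finset.range (n + 1), C (coeff (ee i (n - i)) y) * (X 1 ^ i * X 2 ^ (n - i)) := by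
  ext d
  simp only [← mono_ee, coeff_sum, coeff_monomial]
  by_cases hd : coeff d y = 0
  · rw [hd]
    symm
    refine Finset.sum_eq_zero fun i _ => ?_
    split_ifs with h
    · rw [h, hd]
    · rfl
  · have h0 : ∀ i ∈ ({0, 3} : Finset (Fin 4)), d i = 0 := by
      by_contra h
      rw [← hk, coeff_kill, if_neg h] at hd
      exact hd rfl
    have h1 := hy d hd
    rw [wgt_w1] at h1
    have h1 : (d 0 + d 1 + d 2 + d 3 : ℤ) = n := h1
    have hd0 := h0 0 (by simp)
    have hd3 := h0 3 (by simp)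
    have hdd : ee (d 1) (n - d 1) = d := by
      ext i
      fin_cases i <;> simp [hd0, hd3]
      omega
    rw [Finset.sum_eq_single (d 1)]
    · rw [hdd, if_pos rfl]
    · intro i _ hi
      rw [if_neg]
      intro h
      apply hi
      have := DFunLike.congr_fun h 1
      simpa using this
    · intro h
      exfalso; apply h
      simp; omega

/-- dehomogenization -/
def deh (F : Type) [Field F] : RR F →ₐ[F] Polynomial F := aeval ![0, Polynomial.X, 1, 0]

lemma coeff2 {y : RR F} {n : ℕ} (hk : kill {0, 3} y = y) (hy : Ex w1 y n) (i : ℕ) (hi : i ≤ n) :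
    coeff (ee i (n - i)) y = (deh F y).coeff i := by
  conv_rhs => rw [expand2 hk hy]
  simp only [deh, map_sum, map_mul, map_pow, aeval_X, aeval_C]
  simp only [Matrix.cons_val_one, Matrix.cons_val, one_pow, mul_one, Polynomial.finset_sum_coeff]
  simp only [Polynomial.algebraMap_eq, Polynomial.coeff_C_mul, Polynomial.coeff_X_pow]
  simp only [mul_ite, mul_one, mul_zero]
  rw [Finset.sum_ite_eq, if_pos (by simp; omega)]

lemma lead2 {y : RR F} {n a : ℕ} (hk : kill {0, 3} y = y) (hy : Ex w1 y n) (ha : a ≤ n)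
    (h0 : ∀ i < a, coeff (ee i (n - i)) y = 0) :
    ∃ r, y = X 1 ^ a * (C (coeff (ee a (n - a)) y) * X 2 ^ (n - a) + X 1 * r) := by
  refine ⟨∑ i ∈ Finset.range (n - a), C (coeff (ee (a + (1 + i)) (n - (a + (1 + i)))) y) * (X 1 ^ i * X 2 ^ (n - (a + (1 + i)))), ?_⟩
  conv_lhs => rw [expand2 hk hy]
  have e : n + 1 = a + (1 + (n - a)) := by omega
  rw [e, Finset.sum_range_add, Finset.sum_range_add, Finset.sum_eq_zero, zero_add, Finset.sum_range_one, add_zero, mul_add,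
    Finset.mul_sum, Finset.mul_sum]
  · congr 1
    · ring
    · refine Finset.sum_congr rfl fun i _ => ?_
      rw [pow_add, pow_add]; ring
  · intro i hi
    rw [h0 i (Finset.mem_range.mp hi)]; simp

end twosec

section famsec
variable {p : ℕ} [Fact p.Prime] {F : Type} [Field F] [CharP F p]

/-- auxiliary one variable polynomial -/
def Qq (F : Type) [Field F] (l k : ℕ) : Polynomial F := (1 + 2 * Polynomial.X) ^ l * (1 + Polynomial.X) ^ k

lemma sum_all_pow (i : ℕ) (hi : 0 < i) : ∑ s : ZMod p, (io p F s) ^ i = if p - 1 ∣ i then -1 else 0 := by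
  rw [← sum_units_pow (p := p) (F := F) i]
  rw [← Finset.sum_subset (Finset.subset_univ (Finset.univ.erase (0 : ZMod p)))]
  · symm
    refine Finset.sum_bij (fun w _ => (w : ZMod p)) ?_ ?_ ?_ ?_
    · intro w _; simp
    · intro a _ b _ h; exact Units.ext h
    · intro b hb
      exact ⟨Units.mk0 b (by simpa using hb), Finset.mem_univ _, rfl⟩
    · intro w _; rfl
  · intro s _ hs
    have : s = 0 := by simpa using hs
    rw [this, map_zero, zero_pow (by omega)]

lemma deh_th (l k i : ℕ) (hi : 0 < k + i) : (deh F (kill {3} (th p F l k))).coeff i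
    = if p - 1 ∣ k + i then - (3 ^ k * (Qq F l k).coeff i) else 0 := by
  have h : deh F (kill {3} (th p F l k)) = ∑ s : ZMod p, Polynomial.C ((3 * io p F s) ^ k) * (Qq F l k).comp (Polynomial.C (io p F s) * Polynomial.X) := by
    rw [th, map_sum, map_sum]
    refine Finset.sum_congr rfl fun s _ => ?_
    rw [map_mul, map_pow, map_pow, sig0_X2, sig0_X3]
    have k1 : deh F (kill {3} (X 1)) = Polynomial.X := by
      rw [kill_X, if_neg (by decide), deh, aeval_X]; rfl
    have k2 : deh F (kill {3} (X 2)) = 1 := by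
      rw [kill_X, if_neg (by decide), deh, aeval_X]; rfl
    have k3 : deh F (kill {3} (X 3)) = 0 := by
      rw [kill_X, if_pos (by decide), map_zero]
    have kc : ∀ c : F, deh F (C c) = Polynomial.C c := fun c => by rw [deh, aeval_C]; rfl
    simp only [map_add, map_mul, map_pow, k1, k2, k3, kill_C, kc, map_ofNat, Qq, zero_add, mul_one]
    simp only [Polynomial.mul_comp, Polynomial.pow_comp, Polynomial.add_comp, Polynomial.one_comp, Polynomial.X_comp, Polynomial.ofNat_comp]
    have : (3 * Polynomial.C (io p F s) + 3 * Polynomial.C (io p F s) ^ 2 * Polynomial.X : Polynomial F)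
       = (3 * Polynomial.C (io p F s)) * (1 + Polynomial.C (io p F s) * Polynomial.X) := by ring
    rw [this, mul_pow (3 * Polynomial.C (io p F s))]
    ring
  rw [h, Polynomial.finset_sum_coeff]
  have h2 : ∀ s : ZMod p, (Polynomial.C ((3 * io p F s) ^ k) * (Qq F l k).comp (Polynomial.C (io p F s) * Polynomial.X)).coeff i
      = (3 ^ k * (Qq F l k).coeff i) * (io p F s) ^ (k + i) := by
    intro s
    rw [Polynomial.coeff_C_mul, Polynomial.comp_C_mul_X_coeff, mul_pow, pow_add]; ring
  rw [Finset.sum_congr rfl fun s _ => h2 s, ← Finset.mul_sum, sum_all_pow _ hi]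
  split_ifs <;> ring

/-- correction terms -/
def Cor (p : ℕ) [Fact p.Prime] (F : Type) [Field F] [CharP F p] (a0 b0 c0 : ℕ) : Set (RR F) :=
  {m | ∃ a b c, a0 < a ∧ a + 2 * b + p * c = a0 + 2 * b0 + p * c0 ∧ a + 4 * b + 2 * c ≡ a0 + 4 * b0 + 2 * c0 [MOD (p - 1)] ∧
    m = mon p F 0 a b c}

lemma X1_mon (e j a b c : ℕ) : X 1 ^ e * mon p F j a b c = mon p F j (a + e) b c := by
  simp only [mon]; ring

lemma N_mon (e j a b c : ℕ) : Nn p 0 ^ e * mon p F j a b c = mon p F (j + e) a b c := by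
  simp only [mon]; ring

lemma fam (hp : 3 < p) (j l k a0 b0 c0 : ℕ) (hj : 1 ≤ j) (hk1 : 1 ≤ k) (hdvd : p - 1 ∣ 3 * j + l + 3 * k) (hk : a0 + k = p - 1)
    (hn : a0 + 2 * b0 + p * c0 = l + k) (hb : b0 < p) (he : (Qq F l k).coeff a0 ≠ 0) :
    ∃ lam : F, lam ≠ 0 ∧ ∃ z ∈ Submodule.span F (Cor p F a0 b0 c0),
      kill {0} (trG p F (Npoly p F ^ j * (X 2 ^ l * X 3 ^ k))) = C lam * mon p F j a0 b0 c0 + Nn p 0 ^ j * z := by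
  have hS := th_Sy (p := p) (F := F) l k (by omega)
  have hkk : kill {0, 3} (kill {3} (th p F l k)) = kill {3} (th p F l k) := by
    have h1 : kill {3} (th p F l k) = kill {3} (kill {0} (th p F l k)) := by rw [hS.k]
    have h2 : ({0, 3} : Finset (Fin 4)) ∪ ({3} ∪ {0}) = {3} ∪ {0} := by decide
    rw [h1, kill_kill {3}, kill_kill, h2]
  have hex := Sp.kill hS.e {3}
  have ha : a0 ≤ l + k := by omega
  obtain ⟨r, hr⟩ := lead2 hkk hex ha (by
    intro i hi
    rw [coeff2 hkk hex i (by omega), deh_th _ _ _ (by omega), if_neg]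
    intro hd
    have := Nat.le_of_dvd (by omega) hd
    omega)
  rw [coeff2 hkk hex a0 ha, deh_th _ _ _ (by omega), if_pos (by rw [add_comm, hk])] at hr
  obtain ⟨z, hz, hSz⟩ := Sy.lead hp a0 hS b0 c0 hb hn _ r hr
  set l0 : F := -(3 ^ k * (Qq F l k).coeff a0) / 3 ^ b0 with hl0
  have h3 := three_ne (F := F) hp
  refine ⟨-l0, neg_ne_zero.2 (div_ne_zero (neg_ne_zero.2 (mul_ne_zero (pow_ne_zero _ h3) he)) (pow_ne_zero _ h3)), -(X 1 ^ (a0 + 1) * z), ?_, ?_⟩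
  · refine Submodule.neg_mem _ ?_
    have hcl0 : Cl p (a0 + 4 * b0 + 2 * c0) (th p F l k) := by
      refine (th_Cl l k).congr ?_
      have h1 : a0 + 4 * b0 + 2 * c0 + (p - 1) * (1 + 2 * c0) = 2 * l + 3 * k := by
        have e : (p - 1) * c0 + c0 = p * c0 := by
          conv_rhs => rw [show p = (p - 1) + 1 by omega]
          ring
        have : (p - 1) * (1 + 2 * c0) = (p - 1) + 2 * ((p - 1) * c0) := by ring
        omega
      rw [← h1]; simp [Nat.ModEq]
    have hclz : Cl p (a0 + 4 * b0 + 2 * c0) (X 1 ^ (a0 + 1) * z) := by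
      have : X 1 ^ (a0 + 1) * z = th p F l k - C l0 * mon p F 0 a0 b0 c0 := by
        rw [hz]; ring
      rw [this]
      refine Cl.sub hcl0 ?_
      have := Cl.mul (Cl.C (p := p) l0) (cl_mon (p := p) (F := F) 0 a0 b0 c0)
      simpa using this
    rcases lt_or_ge (l + k) (a0 + 1) with hlt | hge
    · have : z = 0 := Sy.zero_of_neg (by push_cast; omega) hSz
      rw [this, mul_zero]; exact Submodule.zero_mem _
    · have hX : Cl p (a0 + 1) (X 1 ^ (a0 + 1) : RR F) := by
        have := Cl.pow (Cl.X (p := p) (F := F) 1) (a0 + 1)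
        simpa using this
      set G := a0 + 4 * b0 + 2 * c0
      have hz2 : Cl p (G + (p - 2) * (a0 + 1)) z := by
        refine Cl.div (m := a0 + 1) (pow_ne_zero _ (X_ne_zero 1)) hX (hclz.congr ?_)
        have : a0 + 1 + (G + (p - 2) * (a0 + 1)) = G + (p - 1) * (a0 + 1) := by
          conv_rhs => rw [show p - 1 = (p - 2) + 1 by omega]
          ring
        rw [this]; simp [Nat.ModEq]
      obtain ⟨m, hm⟩ := Nat.exists_eq_add_of_le hge
      have hSz' : Sy p (m : ℤ) z := by
        have : ((l + k : ℕ) : ℤ) - a0 - 1 = m := by rw [hm]; push_cast; ring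
        rwa [this] at hSz
      have hsp := Sy.spanCl hp m _ hSz' hz2
      have := Submodule.mem_map_of_mem (f := LinearMap.mulLeft F (X 1 ^ (a0 + 1) : RR F)) hsp
      rw [Submodule.map_span] at this
      refine Submodule.span_mono ?_ this
      rintro _ ⟨_, ⟨a, b, c, h1, h2, rfl⟩, rfl⟩
      refine ⟨a + (a0 + 1), b, c, by omega, by omega, ?_, by simp [X1_mon]⟩
      have e : a + (a0 + 1) + 4 * b + 2 * c = (a0 + 1) + (a + 4 * b + 2 * c) := by ring
      rw [e]
      refine (Nat.ModEq.add_left (a0 + 1) h2).trans ?_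
      have : a0 + 1 + (G + (p - 2) * (a0 + 1)) = G + (p - 1) * (a0 + 1) := by
        conv_rhs => rw [show p - 1 = (p - 2) + 1 by omega]
        ring
      rw [this]; simp [Nat.ModEq, G]
  · rw [phi_trG j l k hj hdvd]
    conv_lhs => rw [hz]
    have : mon p F j a0 b0 c0 = Nn p 0 ^ j * mon p F 0 a0 b0 c0 := by rw [N_mon]; simp
    rw [this, C_neg]; ring

lemma Qq_zero (l k : ℕ) : (Qq F l k).coeff 0 = 1 := by
  rw [Polynomial.coeff_zero_eq_eval_zero]; simp [Qq]

lemma Qq_one (l k : ℕ) : (Qq F l k).coeff 1 = 2 * l + k := by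
  have h : (Qq F l k).coeff 1 = (Polynomial.derivative (Qq F l k)).coeff 0 := by
    rw [Polynomial.coeff_derivative]; simp
  rw [h, Polynomial.coeff_zero_eq_eval_zero, Qq]
  simp [Polynomial.derivative_pow]
  ring

lemma choose_ne {n k : ℕ} (hk : k ≤ n) (hn : n < p) : ((n.choose k : ℕ) : F) ≠ 0 := by
  have h := Nat.choose_mul_factorial_mul_factorial hk
  intro h0
  apply fact_ne (F := F) hn
  rw [← h]; push_cast; rw [h0]; ring

lemma Qq_choose (k i : ℕ) : (Qq F 0 k).coeff i = (k.choose i : ℕ) := by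
  simp [Qq, Polynomial.coeff_one_add_X_pow]

lemma Qq_cat (hp : 3 < p) (i k : ℕ) (hk : k + i + 2 = p) (hik : i ≤ k) : (Qq F 2 k).coeff (i + 1) ≠ 0 := by
  have hkF : (k : F) = - i - 2 := by
    have : ((k + i + 2 : ℕ) : F) = 0 := by rw [hk]; exact CharP.cast_eq_zero F p
    push_cast at this
    linear_combination this
  have h1 : ((k.choose (i + 1) : ℕ) : F) * (i + 1) = k.choose i * (k - i) := by
    have := Nat.choose_succ_right_eq k i
    have h2 := congrArg (Nat.cast (R := F)) this
    push_cast [Nat.cast_sub hik] at h2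
    exact h2
  have hc := choose_ne (F := F) (p := p) hik (by omega)
  have h2F := two_ne (F := F) hp
  have hi1 : ((i : F) + 1) ≠ 0 := by
    have := cast_ne (F := F) (p := p) (k := i + 1) (by omega) (by omega)
    exact_mod_cast this
  have hQ : Qq F 2 k = (1 + Polynomial.X) ^ k + 4 * (Polynomial.X * (1 + Polynomial.X) ^ k) + 4 * (Polynomial.X * (Polynomial.X * (1 + Polynomial.X) ^ k)) := by
    rw [Qq]; ring
  intro h
  have e4 : (4 : Polynomial F) = Polynomial.C 4 := (map_ofNat Polynomial.C 4).symm
  rw [hQ, e4] at h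
  simp only [Polynomial.coeff_add, Polynomial.coeff_C_mul, Polynomial.coeff_X_mul, Polynomial.coeff_one_add_X_pow] at h
  rcases Nat.eq_zero_or_pos i with rfl | hi
  · simp at h h1 hkF
    rw [hkF] at h
    apply h2F; linear_combination h
  · obtain ⟨m, rfl⟩ : ∃ m, i = m + 1 := ⟨i - 1, by omega⟩
    rw [Polynomial.coeff_X_mul, Polynomial.coeff_one_add_X_pow] at h
    have h3 : ((k.choose (m + 1) : ℕ) : F) * (m + 1) = k.choose m * (k - m) := by
      have := Nat.choose_succ_right_eq k m
      have h2 := congrArg (Nat.cast (R := F)) this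
      push_cast [Nat.cast_sub (show m ≤ k by omega)] at h2
      exact h2
    push_cast at h1 hkF hi1
    have : ((k.choose (m + 1) : ℕ) : F) * (2 * ((m : F) + 1 + 1)) = 0 := by
      rw [hkF] at h1 h3
      generalize ((k.choose (m + 1 + 1) : ℕ) : F) = A at *
      generalize ((k.choose (m + 1) : ℕ) : F) = B at *
      generalize ((k.choose m : ℕ) : F) = D at *
      linear_combination (2 * (m:F) + 3) * ((m : F) + 1 + 1) * h - (2 * (m:F) + 3) * h1 - 4 * ((m : F) + 1 + 1) * h3
    rcases mul_eq_zero.1 this with h | h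
    · exact hc h
    · rcases mul_eq_zero.1 h with h | h
      · exact h2F h
      · exact hi1 h

end famsec

section imgsec
variable {p : ℕ} [Fact p.Prime] {F : Type} [Field F] [CharP F p]

lemma act_diag_monomial (w : ZMod p) (hw : w ≠ 0) (d : Fin 4 →₀ ℕ) (c : F) :
    act p F !![w, 0; 0, w⁻¹] (monomial d c)
      = monomial d (io p F w ^ (2 * gr d) * io p F w⁻¹ ^ (3 * (d 0 + d 1 + d 2 + d 3)) * c) := by
  have e1 := io_inv_mul (F := F) w hw
  obtain ⟨h0, h1, h2, h3⟩ := act_b_X (F := F) w 0 hw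
  rw [monomial_eq, monomial_eq, Finsupp.prod_fintype _ _ (by simp)]
  simp only [Fin.prod_univ_four, map_mul, map_pow, h0, h1, h2, h3, act_C, gr]
  simp only [map_zero, zero_mul, zero_add, mul_zero, ne_eq, OfNat.ofNat_ne_zero, not_false_eq_true, zero_pow]
  set u : RR F := C (io p F w)
  set v : RR F := C (io p F w⁻¹)
  have hu1 : v ^ 2 * (u * X 1) = (u ^ 2 * v ^ 3) * X 1 := by
    linear_combination (-v ^ 2 * u * X 1) * e1
  have hu2 : v * (u ^ 2 * X 2) = (u ^ 4 * v ^ 3) * X 2 := by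
    linear_combination (-v * u ^ 2 * X 2 - v ^ 2 * u ^ 3 * X 2) * e1
  have hu3 : u ^ 3 * X 3 = (u ^ 6 * v ^ 3) * X 3 := by
    linear_combination (-u ^ 3 * X 3 - v * u ^ 4 * X 3 - v ^ 2 * u ^ 5 * X 3) * e1
  rw [hu1, hu2, hu3]
  ring

lemma coeff_act_diag (w : ZMod p) (hw : w ≠ 0) (d : Fin 4 →₀ ℕ) (f : RR F) :
    coeff d (act p F !![w, 0; 0, w⁻¹] f)
      = io p F w ^ (2 * gr d) * io p F w⁻¹ ^ (3 * (d 0 + d 1 + d 2 + d 3)) * coeff d f := by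
  classical
  induction f using MvPolynomial.induction_on' with
  | monomial e c =>
    rw [act_diag_monomial w hw, coeff_monomial, coeff_monomial]
    split_ifs with h
    · rw [h]
    · simp
  | add f g hf hg => rw [map_add, coeff_add, coeff_add, hf, hg]; ring

lemma inv_wt {f : RR F} (hf : f ∈ invariants p F) (d : Fin 4 →₀ ℕ) (hd : coeff d f ≠ 0) :
    2 * gr d ≡ 3 * (d 0 + d 1 + d 2 + d 3) [MOD (p - 1)] := by
  have key : ∀ w : ZMod p, w ≠ 0 → io p F w ^ (2 * gr d) = io p F w ^ (3 * (d 0 + d 1 + d 2 + d 3)) := by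
    intro w hw
    have h1 := coeff_act_diag w hw d f
    have h2 : act p F !![w, 0; 0, w⁻¹] f = f := hf ⟨!![w, 0; 0, w⁻¹], by
      rw [Matrix.det_fin_two_of, mul_inv_cancel₀ hw]; ring⟩
    rw [h2] at h1
    have h3 : io p F w ^ (2 * gr d) * io p F w⁻¹ ^ (3 * (d 0 + d 1 + d 2 + d 3)) = 1 :=
      mul_right_cancel₀ hd (by rw [one_mul]; exact h1.symm)
    have h4 : io p F w⁻¹ * io p F w = 1 := by rw [← map_mul, inv_mul_cancel₀ hw, map_one]
    calc io p F w ^ (2 * gr d) = io p F w ^ (2 * gr d) * (io p F w⁻¹ * io p F w) ^ (3 * (d 0 + d 1 + d 2 + d 3)) := by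
          rw [h4, one_pow, mul_one]
      _ = _ := by rw [mul_pow, ← mul_assoc, h3, one_mul]
  obtain ⟨w, hw⟩ := IsCyclic.exists_generator (α := (ZMod p)ˣ)
  have ho : orderOf w = p - 1 := by
    rw [orderOf_eq_card_of_forall_mem_zpowers hw, Nat.card_eq_fintype_card, ZMod.card_units]
  have h5 := key w w.ne_zero
  rw [← map_pow, ← map_pow] at h5
  have h6 := io_inj h5
  rw [← ho]
  apply pow_eq_pow_iff_modEq.mp
  ext
  simpa using h6

end imgsec

section Ksec
variable {p : ℕ} [Fact p.Prime] {F : Type} [Field F] [CharP F p]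

/-- big cell -/
def bcell (w : (ZMod p)ˣ × ZMod p × ZMod p) : Matrix.SpecialLinearGroup (Fin 2) (ZMod p) :=
  ⟨!![w.2.1, (w.2.1 * w.2.2 - 1) * (w.1 : ZMod p)⁻¹; (w.1 : ZMod p), w.2.2], by
    rw [Matrix.det_fin_two_of, mul_assoc, inv_mul_cancel₀ w.1.ne_zero]; ring⟩

lemma bcell_inj : Function.Injective (bcell (p := p)) := by
  rintro ⟨w, x, y⟩ ⟨w', x', y'⟩ h
  have h1 := congrArg (fun g => g.1 1 0) h
  have h2 := congrArg (fun g => g.1 0 0) h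
  have h3 := congrArg (fun g => g.1 1 1) h
  simp only [bcell, Matrix.of_apply, Matrix.cons_val', Matrix.cons_val_zero, Matrix.cons_val_one, Matrix.cons_val_fin_one] at h1 h2 h3
  rw [Units.ext h1, h2, h3]

lemma bcell_range (g : Matrix.SpecialLinearGroup (Fin 2) (ZMod p)) (hg : g.1 1 0 ≠ 0) : g ∈ Set.range (bcell (p := p)) := by
  refine ⟨(Units.mk0 _ hg, g.1 0 0, g.1 1 1), ?_⟩
  have hd := g.2
  rw [Matrix.det_fin_two] at hd
  apply Subtype.ext
  have h : (g.1 0 0 * g.1 1 1 - 1) * (g.1 1 0)⁻¹ = g.1 0 1 := by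
    rw [mul_inv_eq_iff_eq_mul₀ hg]; linear_combination hd
  ext i j
  fin_cases i <;> fin_cases j <;> simp [bcell, h]

lemma sum_lin (hp : 3 < p) (x : ZMod p) (hx : x ≠ 0) : ∑ y : ZMod p, (io p F (3 * x * y - 1)) ^ (p - 1) = -1 := by
  have h3 : (3 : ZMod p) ≠ 0 := three_ne hp
  have e := Equiv.sum_comp ((Equiv.mulLeft₀ (3 * x) (mul_ne_zero h3 hx)).trans (Equiv.subRight (1 : ZMod p)))
    (fun t : ZMod p => (io p F t) ^ (p - 1))
  rw [sum_all_pow _ (by omega), if_pos dvd_rfl] at e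
  rw [← e]; rfl

lemma cast_pm : ((p - 1 : ℕ) : F) = -1 := by
  rw [Nat.cast_sub (Fact.out : p.Prime).one_le]
  simp [CharP.cast_eq_zero]

lemma K_sum (hp : 3 < p) : ∑ g : Matrix.SpecialLinearGroup (Fin 2) (ZMod p),
    (io p F (g.1 1 0 * (2 * (g.1 0 0 * g.1 1 1) + g.1 0 1 * g.1 1 0))) ^ (p - 1) = -1 := by
  have hp1 : p - 1 ≠ 0 := by omega
  rw [← Fintype.sum_of_injective (bcell (p := p)) bcell_inj
    (fun w => (io p F (3 * w.2.1 * w.2.2 - 1)) ^ (p - 1)) _ (by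
      intro g hg
      by_cases h0 : g.1 1 0 = 0
      · rw [h0, zero_mul, map_zero, zero_pow hp1]
      · exact absurd (bcell_range g h0) hg)
    (by
      rintro ⟨w, x, y⟩
      have hw := w.ne_zero
      simp only [bcell, Matrix.of_apply, Matrix.cons_val', Matrix.cons_val_zero, Matrix.cons_val_one, Matrix.cons_val_fin_one]
      generalize (w : ZMod p) = v at hw
      rw [mul_assoc (x * y - 1), inv_mul_cancel₀ hw, ← map_pow, ← map_pow, mul_pow, ZMod.pow_card_sub_one_eq_one hw, one_mul]
      congr 2; ring)]
  rw [Fintype.sum_prod_type]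
  simp only [Finset.sum_const, Finset.card_univ, ZMod.card_units, nsmul_eq_mul, cast_pm]
  rw [Fintype.sum_prod_type]
  have h1 : ∀ x : ZMod p, ∑ y : ZMod p, (io p F (3 * x * y - 1)) ^ (p - 1) = if x = 0 then 0 else -1 := by
    intro x
    split_ifs with h
    · rw [h]; simp
    · exact sum_lin hp x h
  simp only [h1]
  have h2 : ∀ x : ZMod p, (if x = 0 then (0 : F) else -1) = -1 + if x = 0 then 1 else 0 := by
    intro x; split_ifs <;> simp
  simp only [h2, Finset.sum_add_distrib, Finset.sum_const, Finset.card_univ, ZMod.card, Finset.sum_ite_eq', Finset.mem_univ, if_true]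
  simp

lemma K_inv : Kpoly p F ∈ invariants p F := neg_mem (trG_inv _)

lemma K_ex : Ex w1 (Kpoly p F) ((p - 1 : ℕ) : ℤ) := by
  refine Sp.neg (ex_trG ?_)
  have := Ex.pow (ex_w1_X (F := F) 1) (p - 1)
  simpa using this

lemma K_X2 (hp : 3 < p) : kill {0, 1, 3} (Kpoly p F) = X 2 ^ (p - 1) := by
  rw [Kpoly, trG, map_neg, map_sum]
  have h : ∀ g : Matrix.SpecialLinearGroup (Fin 2) (ZMod p), kill {0, 1, 3} (act p F g.1 (X 1 ^ (p - 1)))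
    = C ((io p F (g.1 1 0 * (2 * (g.1 0 0 * g.1 1 1) + g.1 0 1 * g.1 1 0))) ^ (p - 1)) * X 2 ^ (p - 1) := by
    intro g
    rw [map_pow, map_pow, act_X1]
    simp only [map_add, map_mul, map_pow, kill_C, kill_X, map_ofNat]
    rw [if_pos (by decide), if_pos (by decide), if_neg (by decide), if_pos (by decide), ← mul_pow]
    congr 1
    ring
  rw [Finset.sum_congr rfl fun g _ => h g, ← Finset.sum_mul, ← map_sum, K_sum hp]
  simp

lemma kill_Et (f : RR F) : kill {0, 2, 3} (act p F (Et p) f) = act p F (Et p) (kill {0, 1, 3} f) := by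
  have : (kill {0, 2, 3}).comp (act p F (Et p)) = (act p F (Et p)).comp (kill {0, 1, 3}) := by
    apply MvPolynomial.algHom_ext
    intro i
    fin_cases i <;> simp [Et_X0, Et_X1, Et_X2, Et_X3, kill_X]
  exact congrArg (fun h => h f) this

lemma K_X1 (hp : 3 < p) : kill {0, 2, 3} (Kpoly p F) = X 1 ^ (p - 1) := by
  have h := kill_Et (Kpoly p F)
  rw [inv_Et K_inv, K_X2 hp, map_pow, Et_X2] at h
  rw [h, Even.neg_pow]
  have := p_odd hp
  exact Nat.even_iff.mpr (by omega)

lemma phiK (hp : 3 < p) : ∃ α κ : F, α ≠ 0 ∧ κ ≠ 0 ∧ ∃ y ∈ Submodule.span F {m | ∃ b, 4 * b = p - 1 ∧ m = mon p F 0 (2 * b) b 0},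
    kill {0} (Kpoly p F) = C α * mon p F 0 0 ((p - 1) / 2) 0 + C κ * mon p F 0 (p - 1) 0 0 + y := by
  have hodd := p_odd hp
  set S : Set (RR F) := {m | ∃ b, 4 * b = p - 1 ∧ m = mon p F 0 (2 * b) b 0} with hS
  have hmem : kill {0} (Kpoly p F) ∈ Submodule.span F (insert (mon p F 0 0 ((p - 1) / 2) 0) (insert (mon p F 0 (p - 1) 0 0) S)) := by
    rw [← sum_proj (p := p) (kill {0} (Kpoly p F))]
    refine Submodule.sum_mem _ fun g hg => ?_
    rw [← kill_proj]
    by_cases hc : 2 * g ≡ 0 [MOD (p - 1)]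
    · have hSy : Sy p ((p - 1 : ℕ) : ℤ) (kill {0} (proj p g (Kpoly p F))) := by
        have hE : Ex w1 (kill {0} (proj p g (Kpoly p F))) ((p - 1 : ℕ) : ℤ) := Sp.kill (Sp.proj K_ex g) _
        refine ⟨?_, hE, PInv.kill (PInv_proj (inv_PInv K_inv) g), ?_⟩
        · rw [kill_kill]; rfl
        · have := le3_of_ex hE
          rwa [Nat.cast_sub (by omega), Nat.cast_one] at this
      refine Submodule.span_mono ?_ (Sy.spanCl hp _ g hSy (Cl.kill (Cl_proj g _) _))
      rintro m ⟨a, b, c, h1, h2, rfl⟩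
      have hc0 : c = 0 := by
        by_contra h
        have : p * 1 ≤ p * c := Nat.mul_le_mul_left _ (by omega)
        omega
      subst hc0
      have h3 : 2 * (a + 4 * b) ≡ 0 [MOD (p - 1)] := by
        have := (h2.mul_left 2).trans hc
        simpa using this
      have h4 : p - 1 ∣ 2 * (a + 4 * b) := (Nat.modEq_zero_iff_dvd).mp h3
      have h5 : p - 1 ∣ 4 * b := by
        have : 2 * (a + 4 * b) = (p - 1) * 2 + 4 * b := by omega
        rw [this] at h4
        exact (Nat.dvd_add_right (Dvd.intro _ rfl)).mp h4
      obtain ⟨k, hk⟩ := h5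
      have hk3 : k < 3 := by
        by_contra h
        have : (p - 1) * 3 ≤ (p - 1) * k := Nat.mul_le_mul_left _ (by omega)
        omega
      interval_cases k
      · right; left
        have : b = 0 := by omega
        subst this
        congr 1 <;> omega
      · right; right
        exact ⟨b, by omega, by congr 1 <;> omega⟩
      · left
        have : b = (p - 1) / 2 := by omega
        subst this
        congr 1 <;> omega
    · have : proj p g (Kpoly p F) = 0 := by
        ext d
        rw [coeff_proj]
        split_ifs with h
        · by_contra hd
          have h1 := inv_wt K_inv d hd
          have h2 := K_ex d hd
          rw [wgt_w1, Set.mem_singleton_iff] at h2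
          have h3 : d 0 + d 1 + d 2 + d 3 = p - 1 := by exact_mod_cast h2
          rw [h3] at h1
          apply hc
          refine ((h.mul_left 2).symm.trans h1).trans ?_
          simp [Nat.ModEq]
        · simp
      rw [this, map_zero]; exact Submodule.zero_mem _
  rw [Submodule.mem_span_insert] at hmem
  obtain ⟨α, z, hz, hα⟩ := hmem
  rw [Submodule.mem_span_insert] at hz
  obtain ⟨κ, y, hy, hκ⟩ := hz
  have e4 : (4 : RR F) = C 4 := (map_ofNat C 4).symm
  have e3 : (3 : RR F) = C 3 := (map_ofNat C 3).symm
  have hq : (p - 1) / 2 ≠ 0 := by omega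
  have hq1 : p - 1 ≠ 0 := by omega
  have hx2 : kill {0, 1, 3} (xipoly F) = C 3 * X 2 ^ 2 := by
    rw [xipoly, e3, e4]
    simp only [map_sub, map_mul, map_pow, kill_C, kill_X]
    rw [if_neg (by decide), if_pos (by decide), if_pos (by decide)]; ring
  have hx1 : kill {0, 2, 3} (xipoly F) = 0 := by
    rw [xipoly, e3, e4]
    simp only [map_sub, map_mul, map_pow, kill_C, kill_X]
    rw [if_pos (by decide), if_pos (by decide), if_neg (by decide)]; ring
  have hX2 : kill {0, 1, 3} (X 1 : RR F) = 0 := by rw [kill_X, if_pos (by decide)]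
  have hX1 : kill {0, 2, 3} (X 1 : RR F) = X 1 := by rw [kill_X, if_neg (by decide)]
  have hy2 : kill {0, 1, 3} y = 0 := by
    have : y ∈ LinearMap.ker (kill {0, 1, 3} : RR F →ₐ[F] RR F).toLinearMap := by
      refine Submodule.span_le.mpr ?_ hy
      rintro m ⟨b, hb, rfl⟩
      have hb0 : 2 * b ≠ 0 := by omega
      simp [mon, hX2, hb0]
    exact this
  have hy1 : kill {0, 2, 3} y = 0 := by
    have : y ∈ LinearMap.ker (kill {0, 2, 3} : RR F →ₐ[F] RR F).toLinearMap := by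
      refine Submodule.span_le.mpr ?_ hy
      rintro m ⟨b, hb, rfl⟩
      have hb0 : b ≠ 0 := by omega
      simp [mon, hx1, hb0]
    exact this
  have eq : kill {0} (Kpoly p F) = C α * mon p F 0 0 ((p - 1) / 2) 0 + C κ * mon p F 0 (p - 1) 0 0 + y := by
    rw [hα, hκ, smul_eq_C_mul, smul_eq_C_mul, add_assoc]
  refine ⟨α, κ, ?_, ?_, y, hy, eq⟩
  · rintro rfl
    have := congrArg (kill {0, 1, 3}) eq
    rw [kill_kill {0, 1, 3}, show ({0, 1, 3} ∪ {0} : Finset (Fin 4)) = {0, 1, 3} by decide, K_X2 hp, map_add, map_add, hy2, map_mul, map_mul, kill_C, kill_C] at this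
    simp [mon, hX2, hq1] at this
  · rintro rfl
    have := congrArg (kill {0, 2, 3}) eq
    rw [kill_kill {0, 2, 3}, show ({0, 2, 3} ∪ {0} : Finset (Fin 4)) = {0, 2, 3} by decide, K_X1 hp, map_add, map_add, hy1, map_mul, map_mul, kill_C, kill_C] at this
    simp [mon, hx1, hq] at this

end Ksec

/-- image of the algebra modulo `a₀` -/
def AB (p : ℕ) [Fact p.Prime] (F : Type) [Field F] [CharP F p] : Subalgebra F (RR F) := (AA p F).map (kill {0})

/-- torus condition -/
def Hc (p j a b c : ℕ) : Prop := ((p : ℤ) - 1) ∣ 3 * (j : ℤ) + 2 * b + c - a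

section abs
variable {p : ℕ} [Fact p.Prime] {F : Type} [Field F] [CharP F p]

lemma k0_0 : kill {0} (X 0 : RR F) = 0 := by rw [kill_X, if_pos (by decide)]
lemma k0_1 : kill {0} (X 1 : RR F) = X 1 := by rw [kill_X, if_neg (by decide)]
lemma k0_2 : kill {0} (X 2 : RR F) = X 2 := by rw [kill_X, if_neg (by decide)]
lemma k0_3 : kill {0} (X 3 : RR F) = X 3 := by rw [kill_X, if_neg (by decide)]

lemma mem_Ab {x : RR F} (h : x ∈ Agen p F) : kill {0} x ∈ AB p F :=
  ⟨x, Algebra.subset_adjoin h, rfl⟩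

lemma Ab_C_mul {x : RR F} (c : F) (h : x ∈ AB p F) : C c * x ∈ AB p F := by
  rw [← smul_eq_C_mul]; exact Subalgebra.smul_mem _ h c

lemma Ab_of_C_mul {x : RR F} {c : F} (hc : c ≠ 0) (h : C c * x ∈ AB p F) : x ∈ AB p F := by
  have := Ab_C_mul c⁻¹ h
  rwa [← mul_assoc, ← C_mul, inv_mul_cancel₀ hc, C_1, one_mul] at this

lemma mon_mul (j a b c j' a' b' c' : ℕ) : mon p F j a b c * mon p F j' a' b' c' = mon p F (j + j') (a + a') (b + b') (c + c') := by
  simp only [mon]; ring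

lemma Ab_D : mon p F 0 2 1 0 ∈ AB p F := by
  have h := mem_Ab (p := p) (F := F) (x := Dpoly F) (by simp [Agen])
  have : kill {0} (Dpoly F) = mon p F 0 2 1 0 := by
    simp only [Dpoly, map_sub, map_add, map_mul, map_pow, k0_0, k0_1, k0_2, k0_3, map_ofNat, mon, xipoly]
    ring
  rwa [this] at h

lemma Ab_L (hp : 3 < p) : mon p F 0 1 0 1 ∈ AB p F := by
  have h := mem_Ab (p := p) (F := F) (x := Lpoly p F) (by simp [Agen])
  have : kill {0} (Lpoly p F) = C 3 * mon p F 0 1 0 1 := by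
    have e3 : (3 : RR F) = C 3 := (map_ofNat C 3).symm
    rw [← e3]
    simp only [Lpoly, map_sub, map_add, map_mul, map_pow, k0_0, k0_1, k0_2, k0_3, map_ofNat, mon, be]
    rw [zero_pow (by omega)]
    obtain ⟨m, rfl⟩ : ∃ m, p = m + 1 := ⟨p - 1, by omega⟩
    simp only [Nat.add_sub_cancel]
    ring
  rw [this] at h
  exact Ab_of_C_mul (three_ne hp) h

lemma Ab_e (hp : 3 < p) : mon p F 1 3 0 0 ∈ AB p F := by
  have h := mem_Ab (p := p) (F := F) (x := trBG p F (Npoly p F * epoly F)) (by simp [Agen])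
  have h2 := phi_trBG (p := p) (F := F) 1 le_rfl (epoly F)
  rw [pow_one, pow_one] at h2
  rw [h2] at h
  have : Nn p 0 * kill {0} (epoly F) = C 2 * mon p F 1 3 0 0 := by
    have e2 : (2 : RR F) = C 2 := (map_ofNat C 2).symm
    rw [← e2]
    simp only [epoly, map_sub, map_add, map_mul, map_pow, k0_0, k0_1, k0_2, k0_3, map_ofNat, mon]
    ring
  rw [this] at h
  exact Ab_of_C_mul (two_ne hp) h

lemma Ab_d (hp : 3 < p) : mon p F ((p + 1) / 3) 2 0 0 ∈ AB p F := by
  have h := mem_Ab (p := p) (F := F) (x := trBG p F (Npoly p F ^ ((p + 1) / 3) * dpoly F)) (by simp [Agen])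
  rw [phi_trBG _ (by omega)] at h
  have : Nn p 0 ^ ((p + 1) / 3) * kill {0} (dpoly F) = mon p F ((p + 1) / 3) 2 0 0 := by
    simp only [dpoly, map_sub, map_add, map_mul, map_pow, k0_0, k0_1, k0_2, k0_3, map_ofNat, mon]
    ring
  rwa [this] at h

lemma Ab_del (hp : 3 < p) : mon p F (p - 1) 0 0 0 ∈ AB p F := by
  have h := mem_Ab (p := p) (F := F) (x := trBG p F (Npoly p F ^ (p - 1))) (by simp [Agen])
  have h2 := phi_trBG (p := p) (F := F) (p - 1) (by omega) 1
  rw [mul_one, map_one, mul_one] at h2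
  rw [h2] at h
  have : Nn p 0 ^ (p - 1) = mon p F (p - 1) 0 0 0 := by simp [mon]
  rwa [this] at h

lemma cor_H {j a b c a0 b0 c0 : ℕ} (hp : 3 < p) (h : Hc p j a0 b0 c0) (hn : a + 2 * b + p * c = a0 + 2 * b0 + p * c0)
    (hc : a + 4 * b + 2 * c ≡ a0 + 4 * b0 + 2 * c0 [MOD (p - 1)]) :
    (((p : ℤ) - 1) ∣ 2 * b + c - (2 * b0 + c0)) ∧ Hc p j a b c := by
  have h1 := (Nat.modEq_iff_dvd.mp hc)
  push_cast [Nat.cast_sub (show 1 ≤ p by omega)] at h1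
  have h2 : (a : ℤ) + 2 * b + p * c = a0 + 2 * b0 + p * c0 := by exact_mod_cast hn
  obtain ⟨k1, hk1⟩ := h1
  obtain ⟨k, hk⟩ := h
  have e : (2 * b + c - (2 * b0 + c0) : ℤ) = ((p : ℤ) - 1) * (-k1 + c - c0) := by linear_combination -hk1 - h2
  refine ⟨⟨_, e⟩, ?_⟩
  have e2 : (a : ℤ) - a0 = ((p : ℤ) - 1) * (-(-k1 + c - c0) - c + c0) := by linear_combination h2 - e
  exact ⟨k + (-k1 + c - c0) - (-(-k1 + c - c0) - c + c0), by linear_combination hk + e - e2⟩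

/-- `IH`: admissible monomials of the same degree with larger `a` -/
def IHa (p : ℕ) [Fact p.Prime] (F : Type) [Field F] [CharP F p] (j a0 n : ℕ) : Prop :=
  ∀ a b c, a0 < a → a + 2 * b + p * c = n → c ≤ 1 → Hc p j a b c → Cond p a b c → mon p F j a b c ∈ AB p F

lemma famM (hp : 3 < p) (j l k a0 b0 c0 : ℕ) (hj : 1 ≤ j) (hk1 : 1 ≤ k) (hk : a0 + k = p - 1)
    (hn : a0 + 2 * b0 + p * c0 = l + k) (hn2 : l + k < 2 * p) (hH : Hc p j a0 b0 c0) (he : (Qq F l k).coeff a0 ≠ 0)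
    (hG : trG p F (Npoly p F ^ j * (X 2 ^ l * X 3 ^ k)) ∈ Agen p F)
    (IH : IHa p F j a0 (a0 + 2 * b0 + p * c0)) :
    mon p F j a0 b0 c0 ∈ AB p F := by
  have hdvd : p - 1 ∣ 3 * j + l + 3 * k := by
    obtain ⟨t, ht⟩ := hH
    rw [← Int.natCast_dvd_natCast]
    have h1 : (a0 : ℤ) + k = p - 1 := by omega
    have h2 : (a0 : ℤ) + 2 * b0 + p * c0 = l + k := by exact_mod_cast hn
    push_cast [Nat.cast_sub (show 1 ≤ p by omega)]
    exact ⟨t + c0 + 2, by linear_combination ht - h2 + 2 * h1⟩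
  obtain ⟨lam, hlam, z, hz, heq⟩ := fam hp j l k a0 b0 c0 hj hk1 hdvd hk hn (by
    have := Nat.zero_le (p * c0)
    omega) he
  have h1 := mem_Ab hG
  rw [heq] at h1
  have h2 : Nn p 0 ^ j * z ∈ AB p F := by
    have : z ∈ (Subalgebra.toSubmodule (AB p F)).comap (LinearMap.mulLeft F (Nn p 0 ^ j : RR F)) := by
      refine Submodule.span_le.mpr ?_ hz
      rintro _ ⟨a, b, c, e1, e2, e3, rfl⟩
      show Nn p 0 ^ j * mon p F 0 a b c ∈ AB p F
      rw [N_mon, zero_add]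
      obtain ⟨hd, hH'⟩ := cor_H hp hH e2 e3
      have hc1 : c ≤ 1 := by
        by_contra hcc
        have : p * 2 ≤ p * c := Nat.mul_le_mul_left _ (by omega)
        omega
      refine IH a b c e1 (by omega) hc1 hH' ?_
      by_cases hnp : p ≤ l + k + 2
      · exact cond_auto hp (n := l + k) (by omega) hnp
      · exfalso
        have hc0 : c = 0 := by
          by_contra hcc
          have : p * 1 ≤ p * c := Nat.mul_le_mul_left _ (by omega)
          omega
        have hc0' : c0 = 0 := by
          by_contra hcc
          have : p * 1 ≤ p * c0 := Nat.mul_le_mul_left _ (by omega)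
          omega
        subst hc0 hc0'
        have hb : b < b0 := by omega
        have := Int.eq_zero_of_abs_lt_dvd hd (by
          rw [abs_lt]; constructor <;> push_cast <;> omega)
        omega
    exact this
  have h3 := Subalgebra.sub_mem _ h1 h2
  rw [add_sub_cancel_right] at h3
  exact Ab_of_C_mul hlam h3

lemma floor_lem {m j l k : ℕ} (hm : 0 < m) (h : 3 * j + l = m * k) (h1 : 1 ≤ l) (h2 : l ≤ m) :
    (2 + 3 * j / m - 1) * m = 3 * j + l := by
  have hk : 1 ≤ k := by
    by_contra hk
    have : k = 0 := by omega
    subst this; omega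
  obtain ⟨k', rfl⟩ : ∃ k', k = k' + 1 := ⟨k - 1, by omega⟩
  have e : 3 * j = m * k' + (m - l) := by
    rw [mul_add] at h; omega
  have : 3 * j / m = k' := by
    rw [e, Nat.mul_add_div hm, Nat.div_eq_of_lt (by omega), add_zero]
  rw [this, h, show 2 + k' - 1 = k' + 1 by omega, mul_comm]

lemma fam1M (hp : 3 < p) (j l b c : ℕ) (hj : 1 ≤ j) (hj2 : j ≤ p - 2) (hl : 1 ≤ l) (hl2 : l ≤ p - 2)
    (hn : 2 * b + p * c = l + (p - 1)) (hH : Hc p j 0 b c) (IH : IHa p F j 0 (2 * b + p * c)) :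
    mon p F j 0 b c ∈ AB p F := by
  refine famM hp j l (p - 1) 0 b c hj (by omega) (by omega) (by omega) (by omega) hH (by rw [Qq_zero]; exact one_ne_zero) ?_ (by rwa [zero_add])
  have hdvd : p - 1 ∣ 3 * j + l := by
    obtain ⟨t, ht⟩ := hH
    rw [← Int.natCast_dvd_natCast]
    have h2 : 2 * (b : ℤ) + p * c = l + (p - 1) := by
      have : ((2 * b + p * c : ℕ) : ℤ) = ((l + (p - 1) : ℕ) : ℤ) := by rw [hn]
      push_cast [Nat.cast_sub (show 1 ≤ p by omega)] at this
      linarith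
    push_cast [Nat.cast_sub (show 1 ≤ p by omega)] at ht ⊢
    exact ⟨t + c - 1, by linear_combination ht - h2⟩
  obtain ⟨k, hk⟩ := hdvd
  refine Or.inl (Or.inl (Or.inl (Or.inr ⟨j, ⟨hj, hj2⟩, ?_⟩)))
  dsimp only
  rw [floor_lem (by omega) hk hl (by omega), Nat.add_sub_cancel_left]

lemma fam2M (hp : 3 < p) (j b : ℕ) (hj : 1 ≤ j) (hj2 : j ≤ (p - 2) / 3) 
    (hn : 2 * j + 2 * b = p - 1) (IH : IHa p F j j (j + 2 * b)) :
    mon p F j j b 0 ∈ AB p F := by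
  refine famM hp j 0 (p - 1 - j) j b 0 hj (by omega) (by omega) (by omega) (by omega) ⟨1, ?_⟩ ?_ ?_ (by simpa using IH)
  · push_cast; omega
  · rw [Qq_choose]; exact choose_ne (p := p) (by omega) (by omega)
  · refine Or.inl (Or.inl (Or.inr ⟨j, ⟨hj, hj2⟩, ?_⟩))
    simp

lemma fam3M (hp : 3 < p) (j l b c : ℕ) (hj : 2 ≤ j) (hj2 : j ≤ p - 2) (hj3 : j ≠ (p + 1) / 3) (hj4 : j ≠ (2 * p - 1) / 3)
    (hl : 4 ≤ l) (hl2 : l ≤ p)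
    (hn : 1 + 2 * b + p * c = l + (p - 2)) (hH : Hc p j 1 b c) (IH : IHa p F j 1 (1 + 2 * b + p * c)) :
    mon p F j 1 b c ∈ AB p F := by
  refine famM hp j l (p - 2) 1 b c (by omega) (by omega) (by omega) (by omega) (by omega) hH ?_ ?_ IH
  · rw [Qq_one]
    have e : (2 * (l : F) + ((p - 2 : ℕ) : F)) = ((2 * (l - 1) : ℕ) : F) := by
      push_cast [Nat.cast_sub (show 2 ≤ p by omega), Nat.cast_sub (show 1 ≤ l by omega)]
      rw [CharP.cast_eq_zero F p]; ring
    rw [e]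
    intro h
    rw [CharP.cast_eq_zero_iff F p] at h
    rcases (Fact.out : p.Prime).dvd_mul.mp h with h | h
    · have := Nat.le_of_dvd (by omega) h; omega
    · have := Nat.le_of_dvd (by omega) h; omega
  have hdvd : p - 1 ∣ 3 * j + (l - 3) := by
    obtain ⟨t, ht⟩ := hH
    rw [← Int.natCast_dvd_natCast]
    have h2 : 1 + 2 * (b : ℤ) + p * c = l + (p - 2) := by
      have : ((1 + 2 * b + p * c : ℕ) : ℤ) = ((l + (p - 2) : ℕ) : ℤ) := by rw [hn]
      push_cast [Nat.cast_sub (show 2 ≤ p by omega)] at this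
      linarith
    push_cast [Nat.cast_sub (show 1 ≤ p by omega), Nat.cast_sub (show 3 ≤ l by omega)] at ht ⊢
    exact ⟨t + c - 1, by linear_combination ht - h2⟩
  obtain ⟨k, hk⟩ := hdvd
  refine Or.inl (Or.inr ⟨j, ⟨hj, hj2, hj3, hj4⟩, ?_⟩)
  dsimp only
  rw [floor_lem (by omega) hk (by omega) (by omega), show 3 * j + (l - 3) + 3 - 3 * j = l by omega, mul_comm (X 2 ^ l)]

lemma fam4M (hp : 3 < p) (i j b : ℕ) (hj : j = (2 * p - 1) / 3 + i) (hj2 : j ≤ p - 2) (hp3 : p % 3 = 2)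
    (hn : 2 * i + 2 * b = p - 1) (IH : IHa p F j (i + 1) (i + 1 + 2 * b)) :
    mon p F j (i + 1) b 0 ∈ AB p F := by
  refine famM hp j 2 (p - 2 - i) (i + 1) b 0 (by omega) (by omega) (by omega) (by omega) (by omega) ⟨3, ?_⟩ ?_ ?_ (by simpa using IH)
  · push_cast; omega
  · exact Qq_cat hp i _ (by omega) (by omega)
  · refine Or.inr ⟨j, ⟨by omega, hj2⟩, ?_⟩
    dsimp only
    rw [show (5 * p - 7 - 3 * j) / 3 = p - 2 - i by omega, mul_comm (X 2 ^ 2)]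

end abs

section claimA
variable {p : ℕ} [Fact p.Prime] {F : Type} [Field F] [CharP F p]

/-- induction hypothesis: smaller degree -/
def IH1 (p : ℕ) [Fact p.Prime] (F : Type) [Field F] [CharP F p] (j a b c : ℕ) : Prop :=
  ∀ j' a' b' c', 1 ≤ j' → c' ≤ 1 → Hc p j' a' b' c' → Cond p a' b' c' →
    p * j' + a' + 2 * b' + p * c' < p * j + a + 2 * b + p * c → mon p F j' a' b' c' ∈ AB p F

/-- induction hypothesis: same degree, larger `a` -/
def IH2 (p : ℕ) [Fact p.Prime] (F : Type) [Field F] [CharP F p] (j a b c : ℕ) : Prop :=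
  ∀ j' a' b' c', 1 ≤ j' → c' ≤ 1 → Hc p j' a' b' c' → Cond p a' b' c' →
    p * j' + a' + 2 * b' + p * c' = p * j + a + 2 * b + p * c → a < a' → mon p F j' a' b' c' ∈ AB p F

lemma Hc_of {j a b c j' a' b' c' : ℕ} (h : Hc p j a b c) (t : ℤ)
    (e : 3 * (j' : ℤ) + 2 * b' + c' - a' = 3 * (j : ℤ) + 2 * b + c - a + t * ((p : ℤ) - 1)) : Hc p j' a' b' c' := by
  obtain ⟨k, hk⟩ := h
  exact ⟨k + t, by rw [e, hk]; ring⟩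

lemma Hc_vals {r j a b c : ℕ} (hr : p = 6 * r + 5) (h : Hc p j a b c) (x : ℤ) (hx : x = 3 * (j : ℤ) + 2 * b + c - a) :
    x ≤ -(6 * r + 4) ∨ x = 0 ∨ x = 6 * r + 4 ∨ x = 12 * r + 8 ∨ x = 18 * r + 12 ∨ x = 24 * r + 16 ∨ 30 * r + 20 ≤ x := by
  obtain ⟨k, hk⟩ := h
  rw [← hx] at hk
  have e : (p : ℤ) - 1 = 6 * r + 4 := by omega
  rw [e] at hk
  have hr0 : (0 : ℤ) ≤ r := by omega
  rcases lt_trichotomy k 0 with h | h | h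
  · left; nlinarith
  · right; left; rw [hk, h]; ring
  · rcases le_or_gt 5 k with h5 | h5
    · right; right; right; right; right; right; nlinarith
    · interval_cases k <;> omega

lemma IH2.toA {j a b c : ℕ} (h : IH2 p F j a b c) (hj : 1 ≤ j) : IHa p F j a (a + 2 * b + p * c) :=
  fun a' b' c' h1 h2 h3 h4 h5 => h j a' b' c' hj h3 h4 h5 (by omega) h1

lemma Ab_mul {j a b c j1 a1 b1 c1 j2 a2 b2 c2 : ℕ} (h1 : mon p F j1 a1 b1 c1 ∈ AB p F) (h2 : mon p F j2 a2 b2 c2 ∈ AB p F)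
    (ej : j = j1 + j2) (ea : a = a1 + a2) (eb : b = b1 + b2) (ec : c = c1 + c2) : mon p F j a b c ∈ AB p F := by
  subst ej ea eb ec
  rw [← mon_mul]; exact mul_mem h1 h2

lemma Dstep {j a b c : ℕ} (hj : 1 ≤ j) (hc : c ≤ 1) (hH : Hc p j a b c) (ih : IH1 p F j a b c) (ha : 2 ≤ a) (hb : 1 ≤ b)
    (hC : Cond p (a - 2) (b - 1) c) : mon p F j a b c ∈ AB p F :=
  Ab_mul (Ab_D) (ih j (a - 2) (b - 1) c hj hc (Hc_of hH 0 (by push_cast [Nat.cast_sub ha, Nat.cast_sub hb]; ring)) hC (by omega))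
    (by omega) (by omega) (by omega) (by omega)

lemma Lstep (hp : 3 < p) {j a b : ℕ} (hj : 1 ≤ j) (hH : Hc p j a b 1) (ih : IH1 p F j a b 1) (ha : 1 ≤ a)
    (hC : Cond p (a - 1) b 0) : mon p F j a b 1 ∈ AB p F :=
  Ab_mul (Ab_L hp) (ih j (a - 1) b 0 hj (by omega) (Hc_of hH 0 (by push_cast [Nat.cast_sub ha]; ring)) hC (by omega))
    (by omega) (by omega) (by omega) (by omega)

lemma Nstep (hp : 3 < p) {j a b c : ℕ} (hj : p ≤ j) (hc : c ≤ 1) (hH : Hc p j a b c) (ih : IH1 p F j a b c)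
    (hC : Cond p a b c) : mon p F j a b c ∈ AB p F := by
  refine Ab_mul (Ab_del hp) (ih (j - (p - 1)) a b c (by omega) hc (Hc_of hH (-3) ?_) hC ?_)
    (by omega) (by omega) (by omega) (by omega)
  · rw [Nat.cast_sub (by omega), Nat.cast_sub (by omega)]; push_cast; ring
  · have : p * (j - (p - 1)) < p * j := Nat.mul_lt_mul_of_pos_left (by omega) (by omega)
    omega

lemma prod_step {j a b c : ℕ} (ih : IH1 p F j a b c) (j1 a1 b1 c1 j2 a2 b2 c2 : ℕ) 
    (h1 : 1 ≤ j1) (h2 : 1 ≤ j2) (hp : 3 < p) (hc : c ≤ 1)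
    (ej : j = j1 + j2) (ea : a = a1 + a2) (eb : b = b1 + b2) (ec : c = c1 + c2)
    (hH1 : Hc p j1 a1 b1 c1) (hH2 : Hc p j2 a2 b2 c2) (hC1 : Cond p a1 b1 c1) (hC2 : Cond p a2 b2 c2) :
    mon p F j a b c ∈ AB p F := by
  subst ej ea eb ec
  have e1 : p * 1 ≤ p * j1 := Nat.mul_le_mul_left _ h1
  have e2 : p * 1 ≤ p * j2 := Nat.mul_le_mul_left _ h2
  have m1 := mul_add p j1 j2
  have m2 := mul_add p c1 c2
  exact Ab_mul (ih j1 a1 b1 c1 h1 (by omega) hH1 hC1 (by omega)) (ih j2 a2 b2 c2 h2 (by omega) hH2 hC2 (by omega)) rfl rfl rfl rfl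

lemma Kexp {x : RR F} (hp : 3 < p) (j a b c : ℕ) (hx : mon p F j a b c ∈ AB p F) : ∃ α κ : F, α ≠ 0 ∧ κ ≠ 0 ∧
    ∃ z : RR F, C α * mon p F j a (b + (p - 1) / 2) c + C κ * mon p F j (a + (p - 1)) b c + z ∈ AB p F ∧
      ((∀ b', 4 * b' = p - 1 → mon p F j (a + 2 * b') (b + b') c ∈ AB p F) → z ∈ AB p F) := by
  obtain ⟨α, κ, hα, hκ, y, hy, e⟩ := phiK (F := F) hp
  refine ⟨α, κ, hα, hκ, mon p F j a b c * y, ?_, ?_⟩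
  · have h1 : kill {0} (Kpoly p F) ∈ AB p F := mem_Ab (by simp [Agen])
    have := mul_mem hx h1
    rw [e] at this
    have e2 : mon p F j a b c * (C α * mon p F 0 0 ((p - 1) / 2) 0 + C κ * mon p F 0 (p - 1) 0 0 + y)
      = C α * (mon p F j a b c * mon p F 0 0 ((p - 1) / 2) 0) + C κ * (mon p F j a b c * mon p F 0 (p - 1) 0 0) + mon p F j a b c * y := by ring
    rw [e2, mon_mul, mon_mul] at this
    simp only [add_zero] at this
    exact this
  · intro h
    have : y ∈ (Subalgebra.toSubmodule (AB p F)).comap (LinearMap.mulLeft F (mon p F j a b c)) := by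
      refine Submodule.span_le.mpr ?_ hy
      rintro _ ⟨b', h4, rfl⟩
      rw [SetLike.mem_coe, Submodule.mem_comap, LinearMap.mulLeft_apply, Subalgebra.mem_toSubmodule, mon_mul, add_zero, add_zero]
      exact h b' h4
    rw [Submodule.mem_comap, LinearMap.mulLeft_apply, Subalgebra.mem_toSubmodule] at this
    exact this

lemma Kstep (hp : 3 < p) {j a b c : ℕ} (hj : 1 ≤ j) (hc : c ≤ 1) (hH : Hc p j a b c) (ih : IH1 p F j a b c) (ih2 : IH2 p F j a b c)
    (hb : (p - 1) / 2 ≤ b) (hC : Cond p a (b - (p - 1) / 2) c) : mon p F j a b c ∈ AB p F := by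
  have hodd := p_odd hp
  have hm := ih j a (b - (p - 1) / 2) c hj hc (Hc_of hH (-1) (by omega)) hC (by omega)
  obtain ⟨α, κ, hα, hκ, z, h1, h2⟩ := Kexp (x := 0) hp j a _ c hm
  have h3 : mon p F j (a + (p - 1)) (b - (p - 1) / 2) c ∈ AB p F :=
    ih2 j _ _ c hj hc (Hc_of hH (-2) (by omega)) (Or.inr (Or.inl (by omega))) (by omega) (by omega)
  have h4 : z ∈ AB p F := h2 fun b' hb' =>
    ih2 j _ _ c hj hc (Hc_of hH (-1) (by omega)) (Or.inr (Or.inl (by omega))) (by omega) (by omega)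
  have h5 := sub_mem (sub_mem h1 h4) (Ab_C_mul κ h3)
  rw [add_sub_cancel_right, add_sub_cancel_right, Nat.sub_add_cancel hb] at h5
  exact Ab_of_C_mul hα h5

lemma Kback (hp : 3 < p) {a : ℕ} (hH : Hc p 1 a 0 0) (ih : IH1 p F 1 a 0 0)
    (ha : p + 2 ≤ a) : mon p F 1 a 0 0 ∈ AB p F := by
  have hodd := p_odd hp
  have hm := ih 1 (a - (p - 1)) 0 0 le_rfl (by omega) (Hc_of hH 1 (by omega)) (Or.inr (Or.inr (by omega))) (by omega)
  obtain ⟨α, κ, hα, hκ, z, h1, h2⟩ := Kexp (x := 0) hp 1 _ 0 0 hm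
  have h3 : mon p F 1 (a - (p - 1)) (0 + (p - 1) / 2) 0 ∈ AB p F :=
    Ab_mul Ab_D (ih 1 (a - (p - 1) - 2) ((p - 1) / 2 - 1) 0 le_rfl (by omega) (Hc_of hH 2 (by omega)) (Or.inr (Or.inl (by omega))) (by omega))
      (by omega) (by omega) (by omega) (by omega)
  have h4 : z ∈ AB p F := h2 fun b' hb' =>
    Ab_mul Ab_D (ih 1 (a - (p - 1) + 2 * b' - 2) (b' - 1) 0 le_rfl (by omega) (Hc_of hH 1 (by omega)) (Or.inr (Or.inl (by omega))) (by omega))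
      (by omega) (by omega) (by omega) (by omega)
  have h5 := sub_mem (sub_mem h1 h4) (Ab_C_mul α h3)
  rw [add_sub_cancel_right, add_sub_cancel_left, Nat.sub_add_cancel (by omega)] at h5
  exact Ab_of_C_mul hκ h5

end claimA

section claimA2
variable {p : ℕ} [Fact p.Prime] {F : Type} [Field F] [CharP F p]

lemma Hc_mk {r j a b c : ℕ} (hr : p = 6 * r + 5) (k : ℤ) (h : 3 * (j : ℤ) + 2 * b + c - a = (6 * r + 4) * k) : Hc p j a b c :=
  ⟨k, by rw [h, hr]; push_cast; ring⟩

lemma stepC1 (r : ℕ) (hr : p = 6 * r + 5) {j a b : ℕ} (hj : 1 ≤ j) (hj2 : j ≤ p - 1) (hH : Hc p j a b 1)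
    (ih : IH1 p F j a b 1) (ih2 : IH2 p F j a b 1) : mon p F j a b 1 ∈ AB p F := by
  have hp : 3 < p := by omega
  have hv := Hc_vals hr hH _ rfl
  push_cast at hv
  by_cases hL : 1 ≤ a ∧ Cond p (a - 1) b 0
  · exact Lstep hp hj hH ih hL.1 hL.2
  by_cases hD : 2 ≤ a ∧ 1 ≤ b
  · exact Dstep hj le_rfl hH ih hD.1 hD.2 (Or.inl le_rfl)
  by_cases hK : (p - 1) / 2 ≤ b
  · exact Kstep hp hj le_rfl hH ih ih2 hK (Or.inl le_rfl)
  unfold Cond at hL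
  rcases Nat.eq_zero_or_pos a with ha | ha
  · subst ha
    refine fam1M hp j (2 * b + 1) b 1 hj (by omega) (by omega) (by omega) (by omega) hH ?_
    have := ih2.toA hj
    rwa [zero_add] at this
  rcases Nat.lt_or_ge a 2 with ha2 | ha2
  · obtain rfl : a = 1 := by omega
    by_cases hx : j = 2 * r + 2
    · exact prod_step ih 1 1 b 0 (2 * r + 1) 0 0 1 le_rfl (by omega) hp le_rfl (by omega) (by omega) (by omega) (by omega)
        (Hc_mk hr 1 (by omega)) (Hc_mk hr 1 (by omega)) (Or.inr (Or.inl (by omega))) (Or.inl le_rfl)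
    · exact fam3M hp j (2 * b + 3) b 1 (by omega) (by omega) (by omega) (by omega) (by omega) (by omega) (by omega) hH (ih2.toA hj)
  · obtain rfl : b = 0 := by omega
    obtain rfl : a = 2 := by omega
    exact prod_step ih (2 * r + 2) 2 0 0 (2 * r + 1) 0 0 1 (by omega) (by omega) hp le_rfl (by omega) (by omega) (by omega) (by omega)
        (Hc_mk hr 1 (by omega)) (Hc_mk hr 1 (by omega)) (Or.inr (Or.inr (by omega))) (Or.inl le_rfl)

lemma stepB0 (r : ℕ) (hr : p = 6 * r + 5) {j a : ℕ} (hj : 1 ≤ j) (hj2 : j ≤ p - 1) (hH : Hc p j a 0 0) (hC : Cond p a 0 0)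
    (ih : IH1 p F j a 0 0) (ih2 : IH2 p F j a 0 0) : mon p F j a 0 0 ∈ AB p F := by
  have hp : 3 < p := by omega
  have hv := Hc_vals hr hH _ rfl
  push_cast at hv
  unfold Cond at hC
  rcases Nat.eq_zero_or_pos a with ha | ha
  · subst ha
    obtain rfl : j = p - 1 := by omega
    exact Ab_del hp
  have ha1 : a ≠ 1 := by omega
  by_cases ha2 : a = 2
  · subst ha2
    obtain rfl : j = (p + 1) / 3 := by omega
    exact Ab_d hp
  by_cases ha3 : a = 3 ∧ j = 1
  · obtain ⟨rfl, rfl⟩ := ha3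
    exact Ab_e hp
  by_cases ha4 : a = 4
  · subst ha4
    exact Ab_mul (Ab_d hp) (Ab_d hp) (by omega) rfl rfl rfl
  by_cases hj1 : j = 1
  · subst hj1
    exact Kback hp hH ih (by omega)
  · refine prod_step ih 1 3 0 0 (j - 1) (a - 3) 0 0 le_rfl (by omega) hp (by omega) (by omega) (by omega) (by omega) (by omega)
        (Hc_mk hr 0 (by omega)) (Hc_of hH 0 (by omega)) (Or.inr (Or.inr (by omega))) (Or.inr (Or.inr ?_))
    omega

lemma stepC0 (r : ℕ) (hr : p = 6 * r + 5) {j a b : ℕ} (hj : 1 ≤ j) (hj2 : j ≤ p - 1) (hH : Hc p j a b 0) (hC : Cond p a b 0)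
    (ih : IH1 p F j a b 0) (ih2 : IH2 p F j a b 0) : mon p F j a b 0 ∈ AB p F := by
  have hp : 3 < p := by omega
  have hp3 : p % 3 = 2 := by omega
  have hv := Hc_vals hr hH _ rfl
  rcases Nat.eq_zero_or_pos b with hb | hb
  · subst hb
    exact stepB0 r hr hj hj2 hH hC ih ih2
  push_cast at hv
  by_cases hD : 2 ≤ a ∧ Cond p (a - 2) (b - 1) 0
  · exact Dstep hj (by omega) hH ih hD.1 hb hD.2
  by_cases hK : (p - 1) / 2 ≤ b ∧ Cond p a (b - (p - 1) / 2) 0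
  · exact Kstep hp hj (by omega) hH ih ih2 hK.1 hK.2
  unfold Cond at hC hD hK
  have hA := ih2.toA hj
  rcases Nat.eq_zero_or_pos a with ha | ha
  · subst ha
    refine fam1M hp j (2 * b - (p - 1)) b 0 hj (by omega) (by omega) (by omega) (by omega) hH ?_
    rwa [zero_add] at hA
  rcases Nat.lt_or_ge a 2 with ha2 | ha2
  · obtain rfl : a = 1 := by omega
    by_cases h1 : j = 1
    · subst h1
      exact fam2M hp 1 b le_rfl (by omega) (by omega) hA
    by_cases h2 : b = (p - 1) / 2
    · exact fam4M hp 0 j b (by omega) (by omega) hp3 (by omega) hA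
    · exact fam3M hp j (2 * b + 3 - p) b 0 (by omega) (by omega) (by omega) (by omega) (by omega) (by omega) (by omega) hH hA
  by_cases e0 : 2 * (a + b) = p - 1
  · obtain rfl : j = a := by omega
    exact fam2M hp j b hj (by omega) (by omega) hA
  by_cases e1 : 2 * (a + b) = p + 1
  · obtain ⟨i, rfl⟩ : ∃ i, a = i + 1 := ⟨a - 1, by omega⟩
    exact fam4M hp i j b (by omega) (by omega) hp3 (by omega) hA
  · refine prod_step ih (2 * r + 2) 2 0 0 (a - 2) (a - 2) b 0 (by omega) (by omega) hp (by omega) (by omega) (by omega) (by omega) (by omega)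
        (Hc_mk hr 1 (by omega)) (Hc_mk hr 1 (by omega)) (Or.inr (Or.inr (by omega))) (Or.inr (Or.inl (by omega)))

lemma claimA (r : ℕ) (hr : p = 6 * r + 5) : ∀ n t j a b c : ℕ, p * j + a + 2 * b + p * c = n → a + t = n → 1 ≤ j → c ≤ 1 →
    Hc p j a b c → Cond p a b c → mon p F j a b c ∈ AB p F := by
  have hp : 3 < p := by omega
  intro n
  induction n using Nat.strong_induction_on with
  | _ n ihn =>
  intro t
  induction t using Nat.strong_induction_on with
  | _ t iht =>
  intro j a b c hn ht hj hc hH hC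
  have ih1 : IH1 p F j a b c := fun j' a' b' c' g1 g2 g3 g4 g5 => by
    have e : a' ≤ p * j' + a' + 2 * b' + p * c' := by omega
    exact ihn _ (by omega) (p * j' + a' + 2 * b' + p * c' - a') j' a' b' c' rfl (by omega) g1 g2 g3 g4
  have ih2 : IH2 p F j a b c := fun j' a' b' c' g1 g2 g3 g4 g5 g6 => by
    have e : a' ≤ p * j' + a' + 2 * b' + p * c' := by omega
    exact iht (n - a') (by omega) j' a' b' c' (by omega) (by omega) g1 g2 g3 g4
  rcases Nat.lt_or_ge j p with hjp | hjp
  · rcases Nat.eq_zero_or_pos c with h0 | h0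
    · subst h0
      exact stepC0 r hr hj (by omega) hH hC ih1 ih2
    · obtain rfl : c = 1 := by omega
      exact stepC1 r hr hj (by omega) hH ih1 ih2
  · exact Nstep hp hjp hc hH ih1 hC

end claimA2

section claimB
variable {p : ℕ} [Fact p.Prime] {F : Type} [Field F] [CharP F p]

lemma claimIII (r : ℕ) (hr : p = 6 * r + 5) : ∀ c j a b : ℕ, 1 ≤ j → 
    Hc p j a b c → Cond p a b c → mon p F j a b c ∈ AB p F := by
  have hp : 3 < p := by omega
  intro c
  induction c using Nat.strong_induction_on with
  | _ c ih =>
  intro j a b hj hH hC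
  rcases Nat.lt_or_ge c 2 with hc | hc
  · exact claimA r hr _ (p * j + 2 * b + p * c) j a b c rfl (by ring) hj (by omega) hH hC
  obtain ⟨c, rfl⟩ : ∃ c', c = c' + 2 := ⟨c - 2, by omega⟩
  obtain ⟨h, hh, hrel⟩ := relation (p := p) (F := F) hp
  have hq : (p - 1) / 2 = 3 * r + 2 := by omega
  have hp1 : p - 1 = 6 * r + 4 := by omega
  rw [hq, hp1] at hrel
  have key : C (3 : F) * mon p F j a b (c + 2) =
      C ((1 / 3 : F) ^ (2 * (3 * r + 2))) * mon p F j a (b + 1 + 2 * (3 * r + 2)) c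
      - C (2 * (1 / 3 : F) ^ (3 * r + 2)) * mon p F j (a + (6 * r + 4)) (b + 1 + (3 * r + 2)) c
      + mon p F j (a + 2 * (6 * r + 4)) (b + 1) c
      + mon p F (j + 1) a b c * h := by
    have e3 : (3 : RR F) = C 3 := (map_ofNat C 3).symm
    have e2 : (2 : RR F) = C 2 := (map_ofNat C 2).symm
    have : C (3 : F) * mon p F j a b (c + 2) = mon p F j a b c * (3 * be p F ^ 2) := by
      rw [e3]; unfold mon; ring
    rw [this, hrel]
    simp only [map_mul, map_pow, ← e2, mon]
    generalize C (1 / 3 : F) = y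
    ring
  have hA : ∀ j' a' b' c' : ℕ, 1 ≤ j' → c' < c + 2 → p ≤ (a' + 2 * b' + p * c') + 2 → Hc p j' a' b' c' →
      mon p F j' a' b' c' ∈ AB p F := fun j' a' b' c' h1 h2 h3 h4 =>
    ih c' h2 j' a' b' h1 h4 (cond_auto hp rfl h3)
  have hpz : (p : ℤ) = 6 * r + 5 := by rw [hr]; push_cast; ring
  refine Ab_of_C_mul (three_ne hp) ?_
  rw [key]
  refine add_mem (add_mem (sub_mem (Ab_C_mul _ ?_) (Ab_C_mul _ ?_)) ?_) ?_
  · refine hA _ _ _ _ hj (by omega) (by omega) (Hc_of hH 2 ?_)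
    push_cast; rw [hpz]; ring
  · refine hA _ _ _ _ hj (by omega) (by omega) (Hc_of hH 0 ?_)
    push_cast; rw [hpz]; ring
  · refine hA _ _ _ _ hj (by omega) (by omega) (Hc_of hH (-2) ?_)
    push_cast; rw [hpz]; ring
  · clear hrel key
    induction hh using Submodule.span_induction with
    | mem x hx =>
      obtain ⟨a', b', c', hn, hcl, rfl⟩ := hx
      rw [mon_mul]
      have hc' : c' ≤ 1 := by
        by_contra hcon
        have : p * 2 ≤ p * c' := Nat.mul_le_mul_left p (by omega)
        omega
      refine hA _ _ _ _ (by omega) (by omega) ?_ ?_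
      · have : p * (c + c') = p * c + p * c' := by ring
        omega
      · obtain ⟨t, ht⟩ := (Nat.modEq_iff_dvd.1 hcl)
        have hn' : (a' : ℤ) + 2 * b' + p * c' = p := by exact_mod_cast hn
        have : (((p - 1 : ℕ)) : ℤ) = p - 1 := by rw [Nat.cast_sub (by omega)]; simp
        rw [this] at ht
        push_cast at ht
        refine Hc_of hH (-2 * t - 3 + 3 * c') ?_
        push_cast
        linear_combination (-2) * ht -  3 * hn'
    | zero => rw [mul_zero]; exact zero_mem _
    | add x y _ _ hx hy => rw [mul_add]; exact add_mem hx hy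
    | smul s x _ hx => rw [mul_smul_comm]; exact Subalgebra.smul_mem _ hx s

end claimB

section part4
variable {p : ℕ} [Fact p.Prime] {F : Type} [Field F] [CharP F p]

lemma kill_ex_eq {x y : RR F} (h : x = y) (S : Finset (Fin 4)) : kill S x = kill S y := by rw [h]

lemma part4 (r : ℕ) (hr : p = 6 * r + 5) {f : RR F} (hf : f ∈ invariants p F) {n : ℕ} (hn : Ex w1 f n)
    (h0 : kill {0, 3} f = 0) : kill {0} f ∈ AB p F := by
  have hp : 3 < p := by omega
  rw [← sum_proj (p := p) f, map_sum]
  refine Subalgebra.sum_mem _ fun g _ => ?_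
  by_cases hz : proj p g f = 0
  · rw [hz, map_zero]; exact zero_mem _
  have hgn : 2 * g ≡ 3 * n [MOD (p - 1)] := by
    obtain ⟨d, hd⟩ := MvPolynomial.ne_zero_iff.1 hz
    rw [coeff_proj] at hd
    split_ifs at hd with h
    · have h1 := inv_wt hf d hd
      have h2 : wgt w1 d = n := hn d hd
      rw [wgt_w1] at h2
      have h3 : d 0 + d 1 + d 2 + d 3 = n := by exact_mod_cast h2
      rw [h3] at h1
      exact (h.symm.mul_left 2).trans h1
    · exact absurd rfl hd
  have iP : PInv p 1 (proj p g f) := PInv_proj (inv_PInv hf) g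
  have eP : Ex w1 (proj p g f) n := Sp.proj hn g
  have cP : Cl p g (proj p g f) := Cl_proj g f
  have kP : kill {3} (kill {0} (proj p g f)) = 0 := by
    rw [kill_kill, kill_proj]
    have : ({3} ∪ {0} : Finset (Fin 4)) = {0, 3} := by decide
    rw [this, h0, map_zero]
  generalize proj p g f = fg at iP eP cP kP
  obtain ⟨z, hz⟩ := Nn_dvd (three_ne hp) iP.kill kP
  rcases Nat.lt_or_ge n p with hnp | hnp
  · have : z = 0 := by
      apply Nn_mul_eq_zero (p := p) 0
      rw [← hz]
      exact (le3_of_ex (Sp.kill eP _)).mono (by omega)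
    rw [hz, this, mul_zero]; exact zero_mem _
  obtain ⟨n', rfl⟩ : ∃ n', n = p + n' := ⟨n - p, by omega⟩
  have cP' : Cl p (3 + (g + 3 * (p - 2))) fg := cP.congr (by
    have : 3 + (g + 3 * (p - 2)) = g + (p - 1) * 3 := by omega
    rw [this]
    exact (Nat.modEq_iff_dvd' (by omega)).2 ⟨3, by omega⟩)
  obtain ⟨x, Y, h, hx, -, iY, -, -, eY, cY⟩ := Nn_div_graded 1 iP eP cP'
  have hk : kill {0} fg = kill {0} x + Nn p 0 * kill {0} Y := by
    rw [h, map_add, map_mul (kill {0}), kill_Nn]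
  have hx0 : (0 : RR F) + Nn p 0 * z = kill {0} x + Nn p 0 * kill {0} Y := by
    rw [zero_add, ← hz, hk]
  have := (Nn_uniq 0 hx0 Sp.zero (Sp.kill hx _)).1
  rw [hk, ← this, zero_add]
  have hI := claimI hp n' _ iY eY cY
  clear hk hx0
  generalize kill {0} Y = y at hI
  induction hI using Submodule.span_induction with
  | mem m hm =>
    obtain ⟨j, a, b, c, e1, e2, hC, rfl⟩ := hm
    have : Nn p (0 : F) * mon p F j a b c = mon p F (j + 1) a b c := by
      rw [← N_mon, pow_one]
    rw [this]
    refine claimIII r hr c (j + 1) a b (by omega) ?_ hC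
    obtain ⟨s, hs⟩ := Nat.modEq_iff_dvd.1 hgn
    obtain ⟨t, ht⟩ := Nat.modEq_iff_dvd.1 e2
    have hpz : (p : ℤ) = 6 * r + 5 := by rw [hr]; push_cast; ring
    have e1' : (p : ℤ) * j + a + 2 * b + p * c = n' := by exact_mod_cast e1
    have c1 : (((p - 1 : ℕ)) : ℤ) = p - 1 := by rw [Nat.cast_sub (by omega)]; simp
    have c2 : (((p - 2 : ℕ)) : ℤ) = p - 2 := by rw [Nat.cast_sub (by omega)]; simp
    rw [c1] at hs ht
    push_cast at hs ht
    rw [c2] at ht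
    refine ⟨-s - 2 * t + 3 * j + 3 * c + 9, ?_⟩
    push_cast
    linear_combination -3 * e1' - hs - 2 * ht
  | zero => rw [mul_zero]; exact zero_mem _
  | add x y _ _ hx hy => rw [mul_add]; exact add_mem hx hy
  | smul s x _ hx => rw [mul_smul_comm]; exact Subalgebra.smul_mem _ hx s

end part4

section part3
variable {p : ℕ} [Fact p.Prime] {F : Type} [Field F] [CharP F p]

/-- image of the generated algebra in the polynomials in the two middle variables -/
def AH (p : ℕ) [Fact p.Prime] (F : Type) [Field F] [CharP F p] : Subalgebra F (RR F) := (AA p F).map (kill {0, 3})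

lemma kk_0 : kill {0, 3} (X 0 : RR F) = 0 := by simp [kill_X]
lemma kk_1 : kill {0, 3} (X 1 : RR F) = X 1 := by simp [kill_X]
lemma kk_2 : kill {0, 3} (X 2 : RR F) = X 2 := by simp [kill_X]
lemma kk_3 : kill {0, 3} (X 3 : RR F) = 0 := by simp [kill_X]

lemma mem_AH {x : RR F} (h : x ∈ Agen p F) : kill {0, 3} x ∈ AH p F :=
  ⟨x, Algebra.subset_adjoin h, rfl⟩

lemma AH_C_mul {x : RR F} (c : F) (h : x ∈ AH p F) : C c * x ∈ AH p F := by
  rw [← smul_eq_C_mul]; exact Subalgebra.smul_mem _ h c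

lemma AH_of_C_mul {x : RR F} {c : F} (hc : c ≠ 0) (h : C c * x ∈ AH p F) : x ∈ AH p F := by
  have := AH_C_mul c⁻¹ h
  rwa [← mul_assoc, ← C_mul, inv_mul_cancel₀ hc, C_1, one_mul] at this

lemma AH_D (hp : 3 < p) : ((X 1 * X 2) ^ 2 : RR F) ∈ AH p F := by
  have h := mem_AH (p := p) (F := F) (x := Dpoly F) (by simp [Agen])
  have : kill {0, 3} (Dpoly F) = C 3 * (X 1 * X 2) ^ 2 := by
    have e3 : (3 : RR F) = C 3 := (map_ofNat C 3).symm
    rw [← e3]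
    simp only [Dpoly, map_sub, map_add, map_mul, map_pow, kk_0, kk_1, kk_2, kk_3, map_ofNat]
    ring
  rw [this] at h
  exact AH_of_C_mul (three_ne hp) h

lemma AH_L (hp : 3 < p) : ((X 1 * X 2) * (X 2 ^ (p - 1) - X 1 ^ (p - 1)) : RR F) ∈ AH p F := by
  have h := mem_AH (p := p) (F := F) (x := Lpoly p F) (by simp [Agen])
  have : kill {0, 3} (Lpoly p F) = C 3 * ((X 1 * X 2) * (X 2 ^ (p - 1) - X 1 ^ (p - 1))) := by
    have e3 : (3 : RR F) = C 3 := (map_ofNat C 3).symm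
    rw [← e3]
    simp only [Lpoly, map_sub, map_add, map_mul, map_pow, kk_0, kk_1, kk_2, kk_3, map_ofNat]
    obtain ⟨m, hm⟩ : ∃ m, p = m + 1 := ⟨p - 1, by omega⟩
    rw [hm]
    simp only [Nat.add_sub_cancel]
    ring
  rw [this] at h
  exact AH_of_C_mul (three_ne hp) h

lemma AH_K (hp : 3 < p) : (X 1 ^ (p - 1) + X 2 ^ (p - 1) : RR F) ∈ AH p F := by
  have h := mem_AH (p := p) (F := F) (x := Kpoly p F) (by simp [Agen])
  obtain ⟨α, κ, -, -, y, hy, hK⟩ := phiK (p := p) (F := F) hp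
  have hodd := p_odd hp
  have exi : kill {3} (xipoly F) = 3 * X 2 ^ 2 := by
    simp [xipoly, kill_X, map_ofNat]
  have e3 : (3 : RR F) = C 3 := (map_ofNat C 3).symm
  have hyk : ∃ c : F, ∃ b : ℕ, 1 ≤ b ∧ kill {3} y = C c * ((X 1 * X 2) ^ 2) ^ b := by
    by_cases hb : ∃ b, 4 * b = p - 1
    · obtain ⟨b, hb⟩ := hb
      have : {m | ∃ b, 4 * b = p - 1 ∧ m = mon p F 0 (2 * b) b 0} = {mon p F 0 (2 * b) b 0} := by
        ext m
        constructor
        · rintro ⟨b', hb', rfl⟩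
          obtain rfl : b' = b := by omega
          rfl
        · rintro rfl
          exact ⟨b, hb, rfl⟩
      rw [this, Submodule.mem_span_singleton] at hy
      obtain ⟨c, rfl⟩ := hy
      refine ⟨c * 3 ^ b, b, by omega, ?_⟩
      rw [smul_eq_C_mul, map_mul (kill {3}), kill_C]
      simp only [mon, pow_zero, one_mul, mul_one, map_mul, map_pow, exi, ← e3]
      have : kill {3} (X 1 : RR F) = X 1 := by simp [kill_X]
      rw [this]
      ring
    · have : {m | ∃ b, 4 * b = p - 1 ∧ m = mon p F 0 (2 * b) b 0} = ∅ := by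
        ext m
        simp only [Set.mem_setOf_eq, Set.mem_empty_iff_false, iff_false]
        rintro ⟨b, hb', -⟩
        exact hb ⟨b, hb'⟩
      rw [this, Submodule.span_empty, Submodule.mem_bot] at hy
      exact ⟨0, 1, le_rfl, by rw [hy, map_zero]; simp⟩
  obtain ⟨c, b, hb, hyb⟩ := hyk
  have hKK : kill {0, 3} (Kpoly p F) = C (α * 3 ^ ((p - 1) / 2)) * X 2 ^ (p - 1) + C κ * X 1 ^ (p - 1) +
      C c * ((X 1 * X 2) ^ 2) ^ b := by
    have : kill {0, 3} (Kpoly p F) = kill {3} (kill {0} (Kpoly p F)) := by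
      rw [kill_kill]; congr 2; decide
    have hk1 : kill {3} (X 1 : RR F) = X 1 := by simp [kill_X]
    rw [this, hK, map_add, map_add, hyb, map_mul (kill {3}), map_mul (kill {3}), kill_C, kill_C]
    simp only [mon, pow_zero, one_mul, mul_one, map_mul, map_pow, exi, ← e3, hk1]
    rw [mul_pow, ← pow_mul, show 2 * ((p - 1) / 2) = p - 1 by omega]
    ring
  have k1 := K_X1 (p := p) (F := F) hp
  have k2 := K_X2 (p := p) (F := F) hp
  have s1 : kill {0, 2, 3} (Kpoly p F) = kill {2} (kill {0, 3} (Kpoly p F)) := by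
    rw [kill_kill]; congr 2; decide
  have s2 : kill {0, 1, 3} (Kpoly p F) = kill {1} (kill {0, 3} (Kpoly p F)) := by
    rw [kill_kill]; congr 2; decide
  have hpz : p - 1 ≠ 0 := by omega
  have hbz : b ≠ 0 := by omega
  have g1 : kill {2} (X 1 : RR F) = X 1 := by simp [kill_X]
  have g2 : kill {2} (X 2 : RR F) = 0 := by simp [kill_X]
  have g3 : kill {1} (X 1 : RR F) = 0 := by simp [kill_X]
  have g4 : kill {1} (X 2 : RR F) = X 2 := by simp [kill_X]
  rw [s1, hKK, map_add, map_add, map_mul (kill {2}), map_mul (kill {2}), map_mul (kill {2}) (C c), kill_C, kill_C, kill_C,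
    map_pow, map_pow, map_pow, map_pow, map_mul (kill {2}), g1, g2, zero_pow hpz, mul_zero, mul_zero, zero_pow two_ne_zero,
    zero_pow hbz, mul_zero, zero_add, add_zero] at k1
  rw [s2, hKK, map_add, map_add, map_mul (kill {1}), map_mul (kill {1}), map_mul (kill {1}) (C c), kill_C, kill_C, kill_C,
    map_pow, map_pow, map_pow, map_pow, map_mul (kill {1}), g3, g4, zero_pow hpz, mul_zero, zero_mul, zero_pow two_ne_zero,
    zero_pow hbz, mul_zero, add_zero, add_zero] at k2
  rw [hKK, k1, k2] at h
  have := sub_mem h (AH_C_mul c (pow_mem (AH_D (p := p) (F := F) hp) b))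
  rw [add_sub_cancel_right, add_comm] at this
  exact this

lemma AH_Q (hp : 3 < p) : ∀ m i : ℕ, ((X 1 * X 2) ^ i * ((X 2 ^ (p - 1)) ^ m + (-1) ^ i * (X 1 ^ (p - 1)) ^ m) : RR F) ∈ AH p F := by
  have hodd := p_odd hp
  have hD := AH_D (p := p) (F := F) hp
  have hL := AH_L (p := p) (F := F) hp
  have hK := AH_K (p := p) (F := F) hp
  have hu : ((X 1 * X 2) ^ (p - 1) : RR F) ∈ AH p F := by
    have := pow_mem hD ((p - 1) / 2)
    rwa [← pow_mul, show 2 * ((p - 1) / 2) = p - 1 by omega] at this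
  intro m
  induction m using Nat.twoStepInduction with
  | zero =>
    intro i
    rcases Nat.even_or_odd' i with ⟨k, rfl | rfl⟩
    · rw [pow_zero, pow_zero, pow_mul, pow_mul, neg_one_sq, one_pow, mul_one]
      exact mul_mem (pow_mem hD k) (add_mem (one_mem _) (one_mem _))
    · rw [pow_zero, pow_zero, pow_succ (-1 : RR F), pow_mul (-1 : RR F), neg_one_sq, one_pow]
      simp [zero_mem]
  | one =>
    intro i
    rcases Nat.even_or_odd' i with ⟨k, rfl | rfl⟩
    · rw [pow_one, pow_one, pow_mul, pow_mul, neg_one_sq, one_pow, one_mul, add_comm]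
      exact mul_mem (pow_mem hD k) hK
    · rw [pow_one, pow_one, pow_succ (-1 : RR F), pow_mul (-1 : RR F), neg_one_sq, one_pow]
      have := mul_mem (pow_mem hD k) hL
      convert this using 1
      ring
  | more m ih1 ih2 =>
    intro i
    have := sub_mem (mul_mem hK (ih2 i)) (mul_mem hu (ih1 i))
    convert this using 1
    rw [mul_pow]
    rw [mul_pow]
    generalize (X 1 ^ (p - 1) : RR F) = x
    generalize (X 2 ^ (p - 1) : RR F) = y
    ring

lemma AH_T (hp : 3 < p) {i k : ℕ} (h : i ≡ k [MOD (p - 1)]) :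
    (X 1 ^ i * X 2 ^ k + X 2 ^ i * (- X 1) ^ k : RR F) ∈ AH p F := by
  have hodd := p_odd hp
  have hev : Even (p - 1) := ⟨(p - 1) / 2, by omega⟩
  rcases le_total i k with hik | hik
  · obtain ⟨m, hm⟩ := (Nat.modEq_iff_dvd' hik).1 h
    obtain rfl : k = i + (p - 1) * m := by omega
    have := AH_Q (F := F) hp m i
    convert this using 1
    rw [neg_pow, pow_add (-1 : RR F), pow_mul (-1 : RR F), hev.neg_one_pow, one_pow]
    ring
  · obtain ⟨m, hm⟩ := (Nat.modEq_iff_dvd' hik).1 h.symm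
    obtain rfl : i = k + (p - 1) * m := by omega
    have := mul_mem (pow_mem (neg_mem (one_mem (AH p F))) k) (AH_Q (F := F) hp m k)
    convert this using 1
    rw [neg_pow]
    have e : ((-1 : RR F) ^ k) * (-1) ^ k = 1 := by rw [← mul_pow]; simp
    linear_combination (-(X 1 * X 2) ^ k * (X 1 ^ (p - 1)) ^ m) * e

lemma kill_Et' (f : RR F) : kill {0, 3} (act p F (Et p) f) = act p F (Et p) (kill {0, 3} f) := by
  have : (kill {0, 3}).comp (act p F (Et p)) = (act p F (Et p)).comp (kill {0, 3}) := by
    apply MvPolynomial.algHom_ext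
    intro i
    fin_cases i <;> simp [Et_X0, Et_X1, Et_X2, Et_X3, kill_X]
  exact congrArg (fun h => h f) this

lemma part3 (hp : 3 < p) {f : RR F} (hf : f ∈ invariants p F) {n : ℕ} (hn : Ex w1 f n) :
    kill {0, 3} f ∈ AH p F := by
  have hs : act p F (Et p) (kill {0, 3} f) = kill {0, 3} f := by
    rw [← kill_Et', inv_Et hf]
  have hx := expand2 (y := kill {0, 3} f) (n := n) (by rw [kill_kill]; congr 1) (Sp.kill hn _)
  have h2 : C (2 : F) * kill {0, 3} f = kill {0, 3} f + act p F (Et p) (kill {0, 3} f) := by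
    rw [hs, map_ofNat C 2, two_mul]
  refine AH_of_C_mul (two_ne hp) ?_
  rw [h2, hx, map_sum, ← Finset.sum_add_distrib]
  refine Subalgebra.sum_mem _ fun i hi => ?_
  rw [map_mul (act p F (Et p)), act_C, ← mul_add, map_mul (act p F (Et p)), map_pow, map_pow, Et_X1, Et_X2]
  by_cases hc : coeff (ee i (n - i)) (kill {0, 3} f) = 0
  · rw [hc, C_0, zero_mul]; exact zero_mem _
  refine AH_C_mul _ (AH_T hp ?_)
  rw [coeff_kill] at hc
  split_ifs at hc with hh
  · have := inv_wt hf _ hc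
    simp only [gr, ee, Finsupp.add_apply, Finsupp.single_apply] at this
    simp at this
    have e1 : 2 * (i + 2 * (n - i)) = (i + 2 * (n - i)) + (i + (n - i)) + (n - i) := by ring
    have e2 : 3 * (i + (n - i)) = (i + 2 * (n - i)) + (i + (n - i)) + i := by ring
    rw [e1, e2] at this
    exact (Nat.ModEq.add_left_cancel' _ this).symm
  · exact absurd rfl hc

lemma main_le (hp : 3 < p) (hp3 : p % 3 = 2) : invariants p F ≤ AA p F := by
  have hodd := p_odd hp
  obtain ⟨r, hr⟩ : ∃ r, p = 6 * r + 5 := ⟨p / 6, by omega⟩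
  refine outer hp hp3 fun n f hf hn => ?_
  obtain ⟨α, hα, hαf⟩ := part3 hp hf hn
  have hα' : kill {0, 3} (hcomp n α) = kill {0, 3} f := by
    have e : kill {0, 3} α = kill {0, 3} f := hαf
    rw [hcomp_kill, e, hcomp_eq_self (Sp.kill hn _)]
  have hαA := AA_hcomp hα n
  have h4 := part4 r hr (sub_mem hf (AA_le hp hp3 hαA)) (Sp.sub hn (Ex_hcomp n α))
    (by rw [map_sub, hα', sub_self])
  obtain ⟨β, hβ, hβf⟩ := h4
  have e : kill {0} β = kill {0} (f - hcomp n α) := hβf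
  refine ⟨β + hcomp n α, add_mem hβ hαA, ?_⟩
  rw [map_add, e, map_sub, sub_add_cancel]

end part3

/-- for `p ≡ -1 (mod 3)`, `F[V]^{SL₂(F_p)}` is generated as an `F`-algebra by
`D, K, L, N·a₀, δ = tr_B^G(N^{p-1}), ẽ = tr_B^G(N·e), d̃ = tr_B^G(N^{(p+1)/3}·d)` together
with the transfers
`tr^G(N^j a₂^{(m-1)(p-1)-3j} a₃^{p-1})` for `1 ≤ j ≤ p-2`,
`tr^G(N^j a₃^{p-1-j})` for `1 ≤ j ≤ (p-2)/3`,
`tr^G(N^j a₃^{p-2} a₂^{(m-1)(p-1)+3-3j})` for `2 ≤ j ≤ p-2`, `j ∉ {(p+1)/3, (2p-1)/3}`, and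
`tr^G(N^j a₃^{(5p-7-3j)/3} a₂²)` for `(2p-1)/3 ≤ j ≤ p-2`,
where `m = 2 + ⌊3j/(p-1)⌋`. -/
theorem generators_two_mod_three (p : ℕ) [Fact p.Prime] (hp : 3 < p) (hp3 : p % 3 = 2)
    (F : Type) [Field F] [CharP F p] :
    invariants p F = Algebra.adjoin F (
      ({Dpoly F, Kpoly p F, Lpoly p F, Npoly p F * X 0,
        trBG p F (Npoly p F ^ (p - 1)), trBG p F (Npoly p F * epoly F),
        trBG p F (Npoly p F ^ ((p + 1) / 3) * dpoly F)} :
          Set (MvPolynomial (Fin 4) F)) ∪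
      (fun j : ℕ => trG p F (Npoly p F ^ j *
          (X 2 ^ ((2 + 3 * j / (p - 1) - 1) * (p - 1) - 3 * j) * X 3 ^ (p - 1)))) ''
        (Set.Icc 1 (p - 2)) ∪
      (fun j : ℕ => trG p F (Npoly p F ^ j * X 3 ^ (p - 1 - j))) ''
        (Set.Icc 1 ((p - 2) / 3)) ∪
      (fun j : ℕ => trG p F (Npoly p F ^ j *
          (X 3 ^ (p - 2) * X 2 ^ ((2 + 3 * j / (p - 1) - 1) * (p - 1) + 3 - 3 * j)))) ''
        {j : ℕ | 2 ≤ j ∧ j ≤ p - 2 ∧ j ≠ (p + 1) / 3 ∧ j ≠ (2 * p - 1) / 3} ∪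
      (fun j : ℕ => trG p F (Npoly p F ^ j *
          (X 3 ^ ((5 * p - 7 - 3 * j) / 3) * X 2 ^ 2))) ''
        (Set.Icc ((2 * p - 1) / 3) (p - 2))) := by
  exact le_antisymm (main_le hp hp3) (AA_le hp hp3)

end
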